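/- arXiv:2110.13687 — 10 statements merged into one kernel-verified Lean document; each statement's English description precedes it below -/
import Mathlib

section
/- Assume conditions (C1) and (C2) hold. Let q be a prime with q ≠ 2, q ≠ p, q ∤ N, and such that p is not a square in ℚ_q. Then X_{p,A,B,C,D,M,N} has a ℚ_q-point, i.e. there exists a nonzero vector (u,v,x,y,z) ∈ ℚ_q^5 with y² − p·x² = M·u·v and z² − p·x² = (A·u + B·v)(C·u + D·v). -/
open MvPolynomial in
/-- If `Q` is an anisotropic binary polynomial function of degree at most `2` and `R` has degree
less than `4`, then `Q ^ 2 + R` takes a value which is not a nonzero square. -/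
theorem FiniteField.exists_eval_sq_add_eq_zero_or_not_isSquare
    {K : Type*} [Field K] [Fintype K] (hK : ringChar K ≠ 2)
    (Q R : MvPolynomial (Fin 2) K) (hQ : Q.totalDegree ≤ 2) (hR : R.totalDegree < 4)
    (hQ0 : ∀ w, eval w Q = 0 ↔ w = 0) :
    ∃ w, eval w (Q ^ 2 + R) = 0 ∨ ¬ IsSquare (eval w (Q ^ 2 + R)) := by
  classical
  by_contra! h
  obtain ⟨n, hn⟩ : ∃ n, Fintype.card K = 2 * n + 1 :=
    Nat.odd_iff.mpr (FiniteField.odd_card_of_char_ne_two hK)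
  have hcard : 1 < Fintype.card K := Fintype.one_lt_card
  have hpow (a : K) (ha : a ≠ 0) : a ^ (2 * n) = 1 := by
    simpa [hn] using FiniteField.pow_card_sub_one_eq_one a ha
  have hdeg : ((Q ^ 2 + R) ^ n - (Q ^ 2) ^ n).totalDegree
      < (Fintype.card K - 1) * Fintype.card (Fin 2) := by
    have hQ2 : (Q ^ 2).totalDegree ≤ 4 := (totalDegree_pow _ _).trans (by omega)
    have hF : (Q ^ 2 + R).totalDegree ≤ 4 := (totalDegree_add _ _).trans (by omega)
    rw [← (Commute.all (Q ^ 2 + R) (Q ^ 2)).geom_sum₂_mul, add_sub_cancel_left]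
    refine (totalDegree_mul _ _).trans_lt ?_
    have : (∑ i ∈ Finset.range n, (Q ^ 2 + R) ^ i * (Q ^ 2) ^ (n - 1 - i)).totalDegree
        ≤ 4 * (n - 1) := by
      refine totalDegree_finsetSum_le fun i hi ↦ ?_
      rw [Finset.mem_range] at hi
      refine (totalDegree_mul _ _).trans ?_
      have h1 := (totalDegree_pow (Q ^ 2 + R) i).trans (Nat.mul_le_mul_left i hF)
      have h2 := (totalDegree_pow (Q ^ 2) (n - 1 - i)).trans (Nat.mul_le_mul_left _ hQ2)
      omega
    rw [Fintype.card_fin]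
    omega
  have hsum := sum_eval_eq_zero _ hdeg
  have hval (w : Fin 2 → K) : eval w ((Q ^ 2 + R) ^ n - (Q ^ 2) ^ n) = if w = 0 then 1 else 0 := by
    obtain ⟨hw0, s, hs⟩ := h w
    have hs0 : s ≠ 0 := by
      rintro rfl
      simp [hs] at hw0
    have h1 : eval w ((Q ^ 2 + R) ^ n) = 1 := by
      rw [map_pow, hs, ← pow_two, ← pow_mul, hpow s hs0]
    have h2 : eval w ((Q ^ 2) ^ n) = if w = 0 then 0 else 1 := by
      rw [← pow_mul, map_pow]
      split_ifs with hw
      · rw [(hQ0 w).mpr hw, zero_pow (by omega)]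
      · exact hpow _ (mt (hQ0 w).mp hw)
    rw [map_sub, h1, h2]
    split_ifs <;> simp
  simp [hval] at hsum

/-- A binary quadratic form with nonsquare discriminant is anisotropic. -/
theorem eq_zero_of_quadratic_form_eq_zero {K : Type*} [Field K] {a b c u v : K}
    (hd : ¬ IsSquare (b ^ 2 - 4 * a * c)) (h : a * u ^ 2 + b * u * v + c * v ^ 2 = 0) :
    u = 0 ∧ v = 0 := by
  have ha : a ≠ 0 := by
    rintro rfl
    exact hd ⟨b, by ring⟩
  have hv : v = 0 := by
    by_contra hv
    refine hd ⟨(2 * a * u + b * v) / v, ?_⟩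
    field_simp
    linear_combination -4 * a * h
  subst hv
  simpa [ha] using h

open MvPolynomial in
/-- The two quadrics over a finite field share a point with `y + z = 1`. -/
theorem FiniteField.exists_point_add_eq_one
    {K : Type*} [Field K] [Fintype K] (hK : ringChar K ≠ 2) {p : K} (hp : ¬ IsSquare p)
    {A B C D M : K} (hd : ¬ IsSquare ((A * D + B * C - M) ^ 2 - 4 * A * B * C * D)) :
    ∃ u v x y z : K, y + z = 1 ∧ y ^ 2 - p * x ^ 2 = M * u * v ∧
      z ^ 2 - p * x ^ 2 = (A * u + B * v) * (C * u + D * v) := by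
  classical
  have h2 : (2 : K) ≠ 0 := Ring.two_ne_zero hK
  have hp0 : p ≠ 0 := by
    rintro rfl
    exact hp (IsSquare.zero)
  let Q : MvPolynomial (Fin 2) K := MvPolynomial.C (A * C) * X 0 ^ 2
    + MvPolynomial.C (A * D + B * C - M) * (X 0 * X 1) + MvPolynomial.C (B * D) * X 1 ^ 2
  let R : MvPolynomial (Fin 2) K := 1 - MvPolynomial.C 2 * Q - MvPolynomial.C (4 * M) * (X 0 * X 1)
  have hmul (a : K) (f : MvPolynomial (Fin 2) K) :
      (MvPolynomial.C a * f).totalDegree ≤ f.totalDegree := by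
    simpa using totalDegree_mul (MvPolynomial.C a) f
  have hsq (i : Fin 2) : (X i ^ 2 : MvPolynomial (Fin 2) K).totalDegree ≤ 2 := by
    simp [totalDegree_X_pow]
  have hxy : (X 0 * X 1 : MvPolynomial (Fin 2) K).totalDegree ≤ 2 := by
    simpa using totalDegree_mul (X 0 : MvPolynomial (Fin 2) K) (X 1)
  have hQ : Q.totalDegree ≤ 2 :=
    (totalDegree_add _ _).trans <| max_le ((totalDegree_add _ _).trans <|
      max_le ((hmul _ _).trans (hsq 0)) ((hmul _ _).trans hxy)) ((hmul _ _).trans (hsq 1))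
  have hR : R.totalDegree ≤ 2 :=
    (totalDegree_sub _ _).trans <| max_le ((totalDegree_sub _ _).trans <|
      max_le (by simp) ((hmul _ _).trans hQ)) ((hmul _ _).trans hxy)
  have hQ0 (w : Fin 2 → K) : eval w Q = 0 ↔ w = 0 := by
    constructor
    · intro hw
      obtain ⟨h0, h1⟩ := eq_zero_of_quadratic_form_eq_zero (a := A * C) (b := A * D + B * C - M)
        (c := B * D) (u := w 0) (v := w 1) (by convert hd using 2; ring) (by
          simp only [Q, map_add, map_mul, map_pow, eval_C, eval_X] at hw
          linear_combination hw)
      ext i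
      fin_cases i <;> assumption
    · rintro rfl
      simp [Q]
  obtain ⟨w, hw⟩ := exists_eval_sq_add_eq_zero_or_not_isSquare hK Q R hQ (by omega) hQ0
  set F := eval w (Q ^ 2 + R) with hF
  have hpF : IsSquare (p * F) := by
    rcases hw with h0 | h0
    · simp [h0]
    · have hF0 : F ≠ 0 := by
        intro h
        exact h0 (h ▸ IsSquare.zero)
      rw [← quadraticChar_one_iff_isSquare (mul_ne_zero hp0 hF0), map_mul,
        quadraticChar_neg_one_iff_not_isSquare.mpr hp, quadraticChar_neg_one_iff_not_isSquare.mpr h0]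
      norm_num
  obtain ⟨s, hs⟩ := hpF
  refine ⟨w 0, w 1, s / (2 * p), (1 - eval w Q) / 2, (1 + eval w Q) / 2, ?_, ?_, ?_⟩
  · field_simp
    ring
  all_goals
    simp only [F, Q, R, map_add, map_sub, map_mul, map_pow, map_one, eval_C, eval_X] at hs ⊢
    field_simp
    linear_combination hs

/-- A `q`-adic integer whose reduction modulo an odd prime `q` is a nonzero square is a square. -/
theorem PadicInt.isSquare_of_toZMod_eq_sq {q : ℕ} [Fact q.Prime] (hq : q ≠ 2) {c : ℤ_[q]}
    {s : ZMod q} (hs : s ≠ 0) (h : toZMod c = s ^ 2) : IsSquare c := by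
  have h2 : (2 : ZMod q) ≠ 0 := Ring.two_ne_zero (by rwa [ZMod.ringChar_zmod_n])
  obtain ⟨t, rfl⟩ := ZMod.ringHom_surjective (toZMod (p := q)) s
  have hmem (a : ℤ_[q]) : a ∈ IsLocalRing.maximalIdeal ℤ_[q] ↔ toZMod a = 0 := by
    rw [← ker_toZMod, RingHom.mem_ker]
  obtain ⟨r, hr, -⟩ := HenselianRing.is_henselian (I := IsLocalRing.maximalIdeal ℤ_[q])
    (Polynomial.X ^ 2 - Polynomial.C c) (Polynomial.monic_X_pow_sub_C c two_ne_zero) t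
    (by rw [hmem]; simp [h])
    (by
      apply IsUnit.map
      rw [← not_not (a := IsUnit _), ← mem_nonunits_iff, ← IsLocalRing.mem_maximalIdeal, hmem]
      simpa [hs, ← one_add_one_eq_two] using h2)
  exact ⟨r, by simpa [sub_eq_zero, pow_two, eq_comm] using hr⟩

/-- Assuming (C1) and (C2), if `q` is a prime different from `2` and `p`,
not dividing `N`, and `p` is not a square in `ℚ_q`, then `X_{p,A,B,C,D,M,N}` has a
`ℚ_q`-point. -/
theorem stmt_2
    (p : ℕ) (hp : p.Prime) (hpodd : p ≠ 2)
    (A B C D M N : ℤ)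
    (hC1 : (A * D + B * C - M) ^ 2 - 4 * A * B * C * D = (p : ℤ) * N ^ 2)
    (hC2 : N * M * (A * D - B * C) ≠ 0)
    (q : ℕ) [Fact q.Prime] (hq2 : q ≠ 2) (hqp : q ≠ p)
    (hqN : ¬ ((q : ℤ) ∣ N))
    (hnsq : ¬ ∃ s : ℚ_[q], s ^ 2 = (p : ℚ_[q])) :
    ∃ u v x y z : ℚ_[q],
      ¬ (u = 0 ∧ v = 0 ∧ x = 0 ∧ y = 0 ∧ z = 0) ∧
      y ^ 2 - (p : ℚ_[q]) * x ^ 2 = (M : ℚ_[q]) * u * v ∧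
      z ^ 2 - (p : ℚ_[q]) * x ^ 2
        = ((A : ℚ_[q]) * u + (B : ℚ_[q]) * v) * ((C : ℚ_[q]) * u + (D : ℚ_[q]) * v) := by
  have lift {c : ℤ_[q]} {s : ZMod q} (hs : s ≠ 0) (h : PadicInt.toZMod c = s ^ 2) :
      ∃ t : ℚ_[q], t ≠ 0 ∧ t ^ 2 = c := by
    obtain ⟨t, rfl⟩ := PadicInt.isSquare_of_toZMod_eq_sq hq2 hs h
    refine ⟨t, ?_, by push_cast; ring⟩
    rw [Ne, PadicInt.coe_eq_zero]
    rintro rfl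
    exact pow_ne_zero 2 hs (by simpa using h.symm)
  have hpq : (p : ZMod q) ≠ 0 := by
    rw [Ne, ZMod.natCast_eq_zero_iff, Nat.prime_dvd_prime_iff_eq Fact.out hp]
    exact hqp
  have hpQ : (p : ℚ_[q]) ≠ 0 := Nat.cast_ne_zero.mpr hp.ne_zero
  have hN : (N : ZMod q) ≠ 0 := by rwa [Ne, ZMod.intCast_zmod_eq_zero_iff_dvd]
  have hpsq : ¬ IsSquare (p : ZMod q) := by
    rintro ⟨s, hs⟩
    obtain ⟨t, -, ht⟩ := lift (c := (p : ℤ_[q])) (s := s) (by rintro rfl; simp [hpq] at hs)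
      (by rw [map_natCast, hs, pow_two])
    exact hnsq ⟨t, by simpa using ht⟩
  have hC1' : ((A * D + B * C - M) ^ 2 - 4 * A * B * C * D : ZMod q) = p * N ^ 2 := by
    exact_mod_cast congrArg (Int.cast : ℤ → ZMod q) hC1
  have hd : ¬ IsSquare ((A * D + B * C - M) ^ 2 - 4 * A * B * C * D : ZMod q) := by
    rw [hC1']
    rintro ⟨s, hs⟩
    refine hpsq ⟨s / N, ?_⟩
    field_simp
    linear_combination hs
  have hABCD : (A * B * C * D : ZMod q) ≠ 0 := by
    intro h
    exact hd ⟨A * D + B * C - M, by linear_combination -4 * h⟩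
  have hA : (A : ZMod q) ≠ 0 := by rintro h; simp [h] at hABCD
  have hC : (C : ZMod q) ≠ 0 := by rintro h; simp [h] at hABCD
  have hM : (M : ZMod q) ≠ 0 := by
    intro h
    exact hd ⟨A * D - B * C, by rw [h]; ring⟩
  obtain ⟨u, v, x, y, z, hyz, hy, hz⟩ := FiniteField.exists_point_add_eq_one
    (by rwa [ZMod.ringChar_zmod_n]) hpsq hd
  obtain ⟨u', rfl⟩ := ZMod.ringHom_surjective (PadicInt.toZMod (p := q)) u
  obtain ⟨v', rfl⟩ := ZMod.ringHom_surjective (PadicInt.toZMod (p := q)) v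
  obtain ⟨x', rfl⟩ := ZMod.ringHom_surjective (PadicInt.toZMod (p := q)) x
  by_cases hy0 : y = 0
  · obtain rfl : z = 1 := by simpa [hy0] using hyz
    subst hy0
    by_cases hx0 : PadicInt.toZMod x' = 0
    · have huv : PadicInt.toZMod u' = 0 ∨ PadicInt.toZMod v' = 0 := by
        simpa [hx0, hM, or_assoc] using hy.symm
      rcases huv with h0 | h0
      · rw [h0, hx0] at hz
        have hv : PadicInt.toZMod v' ≠ 0 := by
          intro h
          simp [h] at hz
        obtain ⟨t, ht0, ht⟩ := lift (c := B * D) (inv_ne_zero hv) (by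
          simp only [map_mul, map_intCast]
          field_simp
          linear_combination -hz)
        push_cast at ht
        exact ⟨0, 1, 0, 0, t, by simp, by ring, by linear_combination ht⟩
      · rw [h0, hx0] at hz
        have hu : PadicInt.toZMod u' ≠ 0 := by
          intro h
          simp [h] at hz
        obtain ⟨t, ht0, ht⟩ := lift (c := A * C) (inv_ne_zero hu) (by
          simp only [map_mul, map_intCast]
          field_simp
          linear_combination -hz)
        push_cast at ht
        exact ⟨1, 0, 0, 0, t, by simp, by ring, by linear_combination ht⟩
    · obtain ⟨X, hX0, hX⟩ := lift (c := -(p * (M * u' * v'))) (mul_ne_zero hpq hx0) (by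
        simp only [map_neg, map_mul, map_natCast, map_intCast]
        linear_combination p * hy)
      obtain ⟨Z, -, hZ⟩ := lift (c := (A * u' + B * v') * (C * u' + D * v') - M * u' * v')
        (s := 1) one_ne_zero (by
          simp only [map_add, map_sub, map_mul, map_intCast]
          linear_combination hy - hz)
      push_cast at hX hZ
      refine ⟨u', v', X / p, 0, Z, by simp [hX0, hpQ], ?_, ?_⟩
      · field_simp
        linear_combination -hX
      · field_simp
        linear_combination p * hZ - hX
  by_cases hz0 : z = 0
  · obtain rfl : y = 1 := by simpa [hz0] using hyz
    subst hz0
    by_cases hx0 : PadicInt.toZMod x' = 0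
    · have hL : (A * PadicInt.toZMod u' + B * PadicInt.toZMod v' : ZMod q) = 0 ∨
          (C * PadicInt.toZMod u' + D * PadicInt.toZMod v' : ZMod q) = 0 := by
        simpa [hx0] using hz.symm
      rw [hx0] at hy
      have hv : PadicInt.toZMod v' ≠ 0 := by
        intro h
        simp [h] at hy
      rcases hL with h0 | h0
      · obtain ⟨t, ht0, ht⟩ := lift (c := -(M * A * B)) (div_ne_zero hA hv) (by
          simp only [map_neg, map_mul, map_intCast]
          field_simp
          linear_combination -A * hy - M * PadicInt.toZMod v' * h0)
        push_cast at ht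
        exact ⟨-B, A, 0, t, 0, by simp [ht0], by linear_combination ht, by ring⟩
      · obtain ⟨t, ht0, ht⟩ := lift (c := -(M * C * D)) (div_ne_zero hC hv) (by
          simp only [map_neg, map_mul, map_intCast]
          field_simp
          linear_combination -C * hy - M * PadicInt.toZMod v' * h0)
        push_cast at ht
        exact ⟨-D, C, 0, t, 0, by simp [ht0], by linear_combination ht, by ring⟩
    · obtain ⟨X, hX0, hX⟩ := lift (c := -(p * ((A * u' + B * v') * (C * u' + D * v'))))
        (mul_ne_zero hpq hx0) (by
          simp only [map_neg, map_add, map_mul, map_natCast, map_intCast]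
          linear_combination p * hz)
      obtain ⟨Y, -, hY⟩ := lift (c := M * u' * v' - (A * u' + B * v') * (C * u' + D * v'))
        (s := 1) one_ne_zero (by
          simp only [map_add, map_sub, map_mul, map_intCast]
          linear_combination hz - hy)
      push_cast at hX hY
      refine ⟨u', v', X / p, Y, 0, by simp [hX0, hpQ], ?_, ?_⟩
      · field_simp
        linear_combination p * hY - hX
      · field_simp
        linear_combination -hX
  obtain ⟨Y, hY0, hY⟩ := lift (c := p * x' ^ 2 + M * u' * v') hy0 (by
    simp only [map_add, map_mul, map_pow, map_natCast, map_intCast]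
    linear_combination -hy)
  obtain ⟨Z, -, hZ⟩ := lift (c := p * x' ^ 2 + (A * u' + B * v') * (C * u' + D * v')) hz0 (by
    simp only [map_add, map_mul, map_pow, map_natCast, map_intCast]
    linear_combination -hz)
  push_cast at hY hZ
  exact ⟨u', v', x', Y, Z, by simp [hY0], by linear_combination hY, by linear_combination hZ⟩
end

section
/- Assume conditions (C1) and (C2) hold and that X := X_{p,A,B,C,D,M,N} has a ℚ_p-point. Then for at least one of the three polynomial functions f(u,v,x,y,z) ∈ { u·(A·u + B·v), u·(z − y), (A·u + B·v)·(z − y) } there exist ℚ_p-points P_1 and P_2 of X with f(P_1) ≠ 0 and f(P_2) ≠ 0 such that f(P_1) = s² − p·t² for some s, t ∈ ℚ_p, while f(P_2) ≠ s² − p·t² for all s, t ∈ ℚ_p. (Equivalently, the invariant map at p of one of the three nontrivial quaternion classes 𝒜 = (p, u/(Au+Bv)), ℬ = (p, (z−y)/u), 𝒞 = (p, (Au+Bv)/(z−y)) in Br X is surjective.) -/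
/-- A point of `X_{p,A,B,C,D,M,N}` over `ℚ_p`: a nonzero vector satisfying both equations. -/
def IsQpPoint (p : ℕ) [Fact p.Prime] (A B C D M : ℤ)
    (u v x y z : ℚ_[p]) : Prop :=
  ¬ (u = 0 ∧ v = 0 ∧ x = 0 ∧ y = 0 ∧ z = 0) ∧
  y ^ 2 - (p : ℚ_[p]) * x ^ 2 = (M : ℚ_[p]) * u * v ∧
  z ^ 2 - (p : ℚ_[p]) * x ^ 2
    = ((A : ℚ_[p]) * u + (B : ℚ_[p]) * v) * ((C : ℚ_[p]) * u + (D : ℚ_[p]) * v)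

/-- The invariant map at `p` of the quaternion class determined by `f` is surjective:
there are `ℚ_p`-points `P₁, P₂` of `X` with `f(P₁), f(P₂) ≠ 0`, where `f(P₁)` is of the
form `s² − p·t²` (a norm from `ℚ_p(√p)`) and `f(P₂)` is not. -/
def SurjInvAt (p : ℕ) [Fact p.Prime] (A B C D M : ℤ)
    (f : ℚ_[p] → ℚ_[p] → ℚ_[p] → ℚ_[p] → ℚ_[p] → ℚ_[p]) : Prop :=
  ∃ u₁ v₁ x₁ y₁ z₁ u₂ v₂ x₂ y₂ z₂ : ℚ_[p],
    IsQpPoint p A B C D M u₁ v₁ x₁ y₁ z₁ ∧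
    IsQpPoint p A B C D M u₂ v₂ x₂ y₂ z₂ ∧
    f u₁ v₁ x₁ y₁ z₁ ≠ 0 ∧ f u₂ v₂ x₂ y₂ z₂ ≠ 0 ∧
    (∃ s t : ℚ_[p], f u₁ v₁ x₁ y₁ z₁ = s ^ 2 - (p : ℚ_[p]) * t ^ 2) ∧
    (∀ s t : ℚ_[p], f u₂ v₂ x₂ y₂ z₂ ≠ s ^ 2 - (p : ℚ_[p]) * t ^ 2)

namespace PadicNormResidue

variable {p : ℕ} [Fact p.Prime]

lemma norm_p_pos : 0 < ‖(p : ℚ_[p])‖ :=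
  norm_pos_iff.2 (Nat.cast_ne_zero.2 (Fact.out : p.Prime).ne_zero)

lemma p_ne_zero : (p : ℚ_[p]) ≠ 0 := norm_pos_iff.1 norm_p_pos

/-- The value group is discrete: below one, norms are at most `‖p‖`. -/
lemma norm_le_norm_p_of_lt_one {w : ℚ_[p]} (h : ‖w‖ < 1) : ‖w‖ ≤ ‖(p : ℚ_[p])‖ := by
  have := (Padic.norm_le_pow_iff_norm_lt_pow_add_one w (-1)).2 (by simpa using h)
  simpa using this

lemma norm_le_norm_p_mul_of_lt {w w' : ℚ_[p]} (h : ‖w‖ < ‖w'‖) :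
    ‖w‖ ≤ ‖(p : ℚ_[p])‖ * ‖w'‖ := by
  have h0 : 0 < ‖w'‖ := (norm_nonneg _).trans_lt h
  have := norm_le_norm_p_of_lt_one (p := p) (w := w / w') (by
    rw [norm_div]; exact (div_lt_one h0).2 h)
  rwa [norm_div, div_le_iff₀ h0] at this

lemma norm_eq_of_norm_sub_lt {w w' : ℚ_[p]} (h : ‖w - w'‖ < ‖w'‖) : ‖w‖ = ‖w'‖ :=
  Padic.norm_eq_of_norm_sub_lt_right h

lemma norm_sub_eq_max {w w' : ℚ_[p]} (h : ‖w‖ ≠ ‖w'‖) : ‖w - w'‖ = max ‖w‖ ‖w'‖ := by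
  have := Padic.add_eq_max_of_ne (p := p) (q := w) (r := -w') (by simpa using h)
  simpa [sub_eq_add_neg] using this

lemma norm_sub_le_max (w w' : ℚ_[p]) : ‖w - w'‖ ≤ max ‖w‖ ‖w'‖ := by
  have := Padic.nonarchimedean (p := p) w (-w')
  simpa [sub_eq_add_neg] using this

lemma norm_sq_ne_norm_p_mul_sq {s t : ℚ_[p]} (hs : s ≠ 0) :
    ‖s ^ 2‖ ≠ ‖(p : ℚ_[p]) * t ^ 2‖ := by
  intro h
  have ht : t ≠ 0 := by
    rintro rfl
    simp [hs] at h
  have hp1 : (1 : ℝ) < p := by exact_mod_cast (Fact.out : p.Prime).one_lt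
  rw [Padic.norm_eq_zpow_neg_valuation (pow_ne_zero 2 hs),
    Padic.norm_eq_zpow_neg_valuation (mul_ne_zero p_ne_zero (pow_ne_zero 2 ht))] at h
  have h2 := zpow_right_injective₀ (by linarith) hp1.ne' h
  rw [Padic.valuation_mul p_ne_zero (pow_ne_zero 2 ht)] at h2
  simp only [Padic.valuation_pow, Padic.valuation_p] at h2
  push_cast at h2
  omega

lemma norm_sq_sub_p_mul_sq (s t : ℚ_[p]) :
    ‖s ^ 2 - p * t ^ 2‖ = max ‖s ^ 2‖ ‖(p : ℚ_[p]) * t ^ 2‖ := by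
  by_cases hs : s = 0
  · subst hs
    rw [zero_pow two_ne_zero, zero_sub, norm_neg, norm_zero, max_eq_right (norm_nonneg _)]
  · exact norm_sub_eq_max (norm_sq_ne_norm_p_mul_sq hs)

lemma toZMod_eq_zero_iff {x : ℤ_[p]} : PadicInt.toZMod x = 0 ↔ ‖x‖ < 1 := by
  rw [← RingHom.mem_ker, PadicInt.ker_toZMod, IsLocalRing.mem_maximalIdeal, PadicInt.mem_nonunits]

lemma norm_eq_one_of_toZMod_ne_zero {x : ℤ_[p]} (h : PadicInt.toZMod x ≠ 0) :
    ‖(x : ℚ_[p])‖ = 1 :=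
  le_antisymm x.norm_le_one (not_lt.1 fun h' => h (toZMod_eq_zero_iff.2 h'))

lemma exists_toZMod_eq (s : ZMod p) : ∃ S : ℤ_[p], PadicInt.toZMod S = s :=
  ⟨(s.val : ℕ), by simp⟩

lemma norm_two (hp : p ≠ 2) : ‖(2 : ℚ_[p])‖ = 1 := by
  have := (Padic.norm_natCast_eq_one_iff (p := p) (n := 2)).2
    ((Nat.coprime_primes Fact.out Nat.prime_two).2 hp)
  simpa using this

lemma exists_sq_of_norm_sub_one_lt (hp : p ≠ 2) {w : ℚ_[p]} (h : ‖w - 1‖ < 1) :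
    ∃ g : ℚ_[p], g ^ 2 = w ∧ ‖g - 1‖ < 1 := by
  have hw : ‖w‖ ≤ 1 := by
    have := norm_eq_of_norm_sub_lt (w := w) (w' := 1) (by simpa using h)
    simp [this]
  let W : ℤ_[p] := ⟨w, hw⟩
  have h2 : ‖(1 + 1 : ℤ_[p])‖ = 1 := by
    rw [PadicInt.norm_def]
    push_cast
    rw [one_add_one_eq_two, norm_two hp]
  have hW : ‖(1 : ℤ_[p]) - W‖ < 1 := by
    rw [norm_sub_rev, PadicInt.norm_def]
    exact h
  obtain ⟨z, hz, hz1, -⟩ := hensels_lemma (p := p) (R := ℤ_[p])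
    (F := (Polynomial.X ^ 2 - Polynomial.C W)) (a := 1) (by
      simpa [Polynomial.derivative_X_pow, one_add_one_eq_two.symm, h2] using hW)
  refine ⟨z, ?_, ?_⟩
  · have : z ^ 2 = W := by simpa [sub_eq_zero] using hz
    have := congrArg (fun x : ℤ_[p] => (x : ℚ_[p])) this
    simpa using this
  · have : ‖z - 1‖ < 1 := by
      simpa [Polynomial.derivative_X_pow, one_add_one_eq_two.symm, h2] using hz1
    rw [PadicInt.norm_def] at this
    simpa using this

lemma exists_sq_mul (hp : p ≠ 2) {w w' : ℚ_[p]} (h : ‖w - w'‖ < ‖w'‖) :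
    ∃ g : ℚ_[p], w = w' * g ^ 2 ∧ ‖g - 1‖ < 1 := by
  have h0 : w' ≠ 0 := norm_pos_iff.1 ((norm_nonneg _).trans_lt h)
  obtain ⟨g, hg, hg1⟩ := exists_sq_of_norm_sub_one_lt hp (w := w / w') (by
    rw [div_sub_one h0, norm_div]
    exact (div_lt_one (norm_pos_iff.2 h0)).2 h)
  exact ⟨g, by rw [hg]; field_simp, hg1⟩

/-- The unit part of `w`, with respect to the uniformizer `-p`; zero if `w = 0`. -/
noncomputable def unitPart (w : ℚ_[p]) : ℤ_[p] :=
  ⟨w * (-(p : ℚ_[p])) ^ (-w.valuation), by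
    by_cases h : w = 0
    · simp [h]
    · rw [norm_mul, norm_zpow, norm_neg, ← norm_zpow, Padic.norm_p_zpow,
        Padic.norm_eq_zpow_neg_valuation h, ← zpow_add₀ (by
          exact_mod_cast (Fact.out : p.Prime).ne_zero)]
      simp⟩

lemma coe_unitPart (w : ℚ_[p]) :
    (unitPart w : ℚ_[p]) = w * (-(p : ℚ_[p])) ^ (-w.valuation) := rfl

/-- The residue of the unit part of `w`, with respect to the uniformizer `-p`. -/
noncomputable def lead (w : ℚ_[p]) : ZMod p := PadicInt.toZMod (unitPart w)

lemma lead_ne_zero {w : ℚ_[p]} (h : w ≠ 0) : lead w ≠ 0 := by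
  rw [lead, Ne, toZMod_eq_zero_iff, PadicInt.norm_def, coe_unitPart, norm_mul, norm_zpow, norm_neg,
    ← norm_zpow, Padic.norm_p_zpow,
    Padic.norm_eq_zpow_neg_valuation h, ← zpow_add₀ (by
      exact_mod_cast (Fact.out : p.Prime).ne_zero)]
  simp

lemma lead_mul {a b : ℚ_[p]} (ha : a ≠ 0) (hb : b ≠ 0) : lead (a * b) = lead a * lead b := by
  rw [lead, lead, lead, ← map_mul]
  congr 1
  apply PadicInt.ext
  push_cast
  rw [coe_unitPart, coe_unitPart, coe_unitPart, Padic.valuation_mul ha hb, neg_add,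
    zpow_add₀ (neg_ne_zero.2 p_ne_zero)]
  ring

lemma lead_congr {a b : ℚ_[p]} (h : ‖a - b‖ < ‖b‖) : lead a = lead b := by
  have hn := norm_eq_of_norm_sub_lt h
  have hb : b ≠ 0 := norm_pos_iff.1 ((norm_nonneg _).trans_lt h)
  have ha : a ≠ 0 := norm_pos_iff.1 (hn ▸ norm_pos_iff.2 hb)
  have hp1 : (1 : ℝ) < p := by exact_mod_cast (Fact.out : p.Prime).one_lt
  have hv : a.valuation = b.valuation := by
    rw [Padic.norm_eq_zpow_neg_valuation ha, Padic.norm_eq_zpow_neg_valuation hb] at hn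
    have := zpow_right_injective₀ (by linarith) hp1.ne' hn
    omega
  rw [lead, lead, ← sub_eq_zero, ← map_sub, toZMod_eq_zero_iff, PadicInt.norm_def]
  push_cast
  rw [coe_unitPart, coe_unitPart, hv, ← sub_mul, norm_mul, norm_zpow, norm_neg, ← norm_zpow]
  have h1 : ‖b‖ * ‖(p : ℚ_[p]) ^ (-b.valuation)‖ = 1 := by
    rw [Padic.norm_p_zpow, Padic.norm_eq_zpow_neg_valuation hb, ← zpow_add₀ (by linarith)]
    simp
  rw [← h1]
  exact mul_lt_mul_of_pos_right h (norm_pos_iff.2 (zpow_ne_zero _ p_ne_zero))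

lemma lead_coe {S : ℤ_[p]} (h : PadicInt.toZMod S ≠ 0) :
    lead (S : ℚ_[p]) = PadicInt.toZMod S := by
  have h1 := norm_eq_one_of_toZMod_ne_zero h
  have h0 : (S : ℚ_[p]) ≠ 0 := norm_pos_iff.1 (by rw [h1]; exact one_pos)
  have hp1 : (1 : ℝ) < p := by exact_mod_cast (Fact.out : p.Prime).one_lt
  have hv : (S : ℚ_[p]).valuation = 0 := by
    rw [Padic.norm_eq_zpow_neg_valuation h0] at h1
    have := zpow_right_injective₀ (by linarith) hp1.ne' (h1.trans (zpow_zero (p : ℝ)).symm)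
    omega
  rw [lead]
  congr 1
  apply PadicInt.ext
  rw [coe_unitPart, hv]
  simp

lemma lead_neg_p : lead (-(p : ℚ_[p])) = 1 := by
  rw [lead, ← map_one (PadicInt.toZMod (p := p))]
  congr 1
  apply PadicInt.ext
  have hv : (-(p : ℚ_[p])).valuation = 1 := by
    rw [← Padic.valuation_p (p := p)]
    have hp1 : (1 : ℝ) < p := by exact_mod_cast (Fact.out : p.Prime).one_lt
    have := norm_neg (p : ℚ_[p])
    rw [Padic.norm_eq_zpow_neg_valuation (neg_ne_zero.2 p_ne_zero),
      Padic.norm_eq_zpow_neg_valuation p_ne_zero] at this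
    have := zpow_right_injective₀ (by linarith) hp1.ne' this
    omega
  rw [coe_unitPart, hv]
  simp

/-- The norm residue symbol `(p, w)_p`. -/
noncomputable def chi (w : ℚ_[p]) : ℤ := quadraticChar (ZMod p) (lead w)

@[simp]
lemma chi_zero : chi (0 : ℚ_[p]) = 0 := by
  have : unitPart (0 : ℚ_[p]) = 0 := PadicInt.ext (by simp [coe_unitPart])
  simp [chi, lead, this]

lemma chi_mul (a b : ℚ_[p]) : chi (a * b) = chi a * chi b := by
  by_cases ha : a = 0
  · simp [ha]
  by_cases hb : b = 0
  · simp [hb]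
  simp only [chi, lead_mul ha hb, map_mul]

lemma ne_zero_of_chi_eq_one {w : ℚ_[p]} (h : chi w = 1) : w ≠ 0 := by
  rintro rfl
  simp at h

lemma ne_zero_of_chi_eq_neg_one {w : ℚ_[p]} (h : chi w = -1) : w ≠ 0 := by
  rintro rfl
  simp at h

lemma chi_cases {w : ℚ_[p]} (h : w ≠ 0) : chi w = 1 ∨ chi w = -1 :=
  quadraticChar_dichotomy (lead_ne_zero h)

lemma chi_congr {a b : ℚ_[p]} (h : ‖a - b‖ < ‖b‖) : chi a = chi b := by
  simp only [chi, lead_congr h]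

lemma chi_coe {S : ℤ_[p]} (h : PadicInt.toZMod S ≠ 0) :
    chi (S : ℚ_[p]) = quadraticChar (ZMod p) (PadicInt.toZMod S) := by
  simp only [chi, lead_coe h]

lemma chi_neg_p : chi (-(p : ℚ_[p])) = 1 := by
  simp [chi, lead_neg_p]

lemma chi_mul_self {w : ℚ_[p]} (h : w ≠ 0) : chi w * chi w = 1 := by
  rcases chi_cases h with h | h <;> simp [h]

lemma chi_sq {w : ℚ_[p]} (h : w ≠ 0) : chi (w ^ 2) = 1 := by
  rw [sq, chi_mul, chi_mul_self h]

lemma eq_sq_or_of_chi_eq_one (hp : p ≠ 2) {w : ℚ_[p]} (h : chi w = 1) :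
    ∃ r : ℚ_[p], r ≠ 0 ∧ (w = r ^ 2 ∨ w = -(p : ℚ_[p]) * r ^ 2) := by
  have h0 := ne_zero_of_chi_eq_one h
  have hp0 : (-(p : ℚ_[p])) ≠ 0 := neg_ne_zero.2 p_ne_zero
  obtain ⟨s, hs⟩ := (quadraticChar_one_iff_isSquare (lead_ne_zero h0)).1 h
  obtain ⟨S, rfl⟩ := exists_toZMod_eq s
  have hS : PadicInt.toZMod S ≠ 0 := by
    intro h'
    rw [h', mul_zero] at hs
    exact lead_ne_zero h0 hs
  have hS1 := norm_eq_one_of_toZMod_ne_zero hS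
  have hS0 : (S : ℚ_[p]) ≠ 0 := norm_pos_iff.1 (by rw [hS1]; exact one_pos)
  rw [lead, ← map_mul, ← sub_eq_zero, ← map_sub, toZMod_eq_zero_iff, PadicInt.norm_def] at hs
  push_cast at hs
  rw [coe_unitPart] at hs
  obtain ⟨g, hg, hg1⟩ := exists_sq_mul hp (w' := (S : ℚ_[p]) * S) (lt_of_lt_of_eq hs (by
    simp [hS1]))
  have hg0 : g ≠ 0 := by
    rintro rfl
    simp at hg1
  have hw : w = (-(p : ℚ_[p])) ^ w.valuation * (S * g) ^ 2 := by
    rw [zpow_neg, ← div_eq_mul_inv, div_eq_iff (zpow_ne_zero _ hp0)] at hg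
    linear_combination hg
  rcases Int.even_or_odd' w.valuation with ⟨n, hn | hn⟩
  · refine ⟨(-(p : ℚ_[p])) ^ n * (S * g), by positivity, Or.inl ?_⟩
    conv_lhs => rw [hw, hn, two_mul, zpow_add₀ hp0]
    ring
  · refine ⟨(-(p : ℚ_[p])) ^ n * (S * g), by positivity, Or.inr ?_⟩
    conv_lhs => rw [hw, hn, two_mul, zpow_add₀ hp0, zpow_add₀ hp0, zpow_one]
    ring

lemma chi_sq_sub_p_mul_sq {s t : ℚ_[p]} (h : s ^ 2 - (p : ℚ_[p]) * t ^ 2 ≠ 0) :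
    chi (s ^ 2 - (p : ℚ_[p]) * t ^ 2) = 1 := by
  have hneg : ∀ t : ℚ_[p], t ≠ 0 → chi (-((p : ℚ_[p]) * t ^ 2)) = 1 := fun t ht => by
    rw [← neg_mul, chi_mul, chi_neg_p, chi_sq ht,
      one_mul]
  by_cases hs : s = 0
  · subst hs
    have ht : t ≠ 0 := by rintro rfl; simp at h
    rw [← hneg t ht]; congr 1; ring
  rcases lt_or_gt_of_ne (norm_sq_ne_norm_p_mul_sq (t := t) hs) with hlt | hlt
  · have ht : t ≠ 0 := by rintro rfl; simp at hlt; linarith [sq_nonneg ‖s‖]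
    rw [← hneg t ht]
    apply chi_congr
    simpa [sub_eq_add_neg] using hlt
  · rw [← chi_sq hs]
    apply chi_congr
    simpa using hlt

lemma exists_eq_iff_chi (hp : p ≠ 2) {w : ℚ_[p]} (h0 : w ≠ 0) :
    (∃ s t : ℚ_[p], w = s ^ 2 - p * t ^ 2) ↔ chi w = 1 := by
  constructor
  · rintro ⟨s, t, rfl⟩
    exact chi_sq_sub_p_mul_sq h0
  · intro h
    obtain ⟨r, -, h | h⟩ := eq_sq_or_of_chi_eq_one hp h
    · exact ⟨r, 0, by rw [h]; ring⟩
    · exact ⟨0, r, by rw [h]; ring⟩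

lemma exists_sq_eq_neg_one (hp : p ≠ 2) (h : chi (-1 : ℚ_[p]) = 1) :
    ∃ i : ℚ_[p], i ^ 2 = -1 := by
  obtain ⟨r, hr, h | h⟩ := eq_sq_or_of_chi_eq_one hp h
  · exact ⟨r, h.symm⟩
  · exact absurd (by rw [one_pow]; linear_combination -h)
      (fun h' : (1 : ℚ_[p]) ^ 2 = p * r ^ 2 =>
        norm_sq_ne_norm_p_mul_sq one_ne_zero (congrArg norm h'))

lemma chi_p (h : chi (-1 : ℚ_[p]) = 1) : chi (p : ℚ_[p]) = 1 := by
  have := chi_mul (-1) (p : ℚ_[p])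
  rw [neg_one_mul, chi_neg_p, h] at this
  linarith

lemma eq_sq_or_p_mul_sq (hp : p ≠ 2) (h1 : chi (-1 : ℚ_[p]) = 1) {w : ℚ_[p]}
    (h : chi w = 1) : ∃ r : ℚ_[p], r ≠ 0 ∧ (w = r ^ 2 ∨ w = p * r ^ 2) := by
  obtain ⟨i, hi⟩ := exists_sq_eq_neg_one hp h1
  obtain ⟨r, hr, h | h⟩ := eq_sq_or_of_chi_eq_one hp h
  · exact ⟨r, hr, Or.inl h⟩
  · refine ⟨i * r, mul_ne_zero (by rintro rfl; simp at hi) hr, Or.inr ?_⟩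
    rw [mul_pow, hi, h]; ring

end PadicNormResidue

section QuadraticChar

variable {F : Type*} [Field F] [Fintype F] [DecidableEq F]

lemma two_mul_card_nonsquares_add_one (hF : ringChar F ≠ 2) :
    2 * (Finset.univ.filter fun a : F => quadraticChar F a = -1).card + 1 = Fintype.card F := by
  have h := quadraticChar_sum_zero hF
  have h1 : ∀ a : F, quadraticChar F a =
      1 - (if a = 0 then 1 else 0) - 2 * (if quadraticChar F a = -1 then 1 else 0) := by
    intro a
    by_cases ha : a = 0
    · simp [ha]
    · rcases quadraticChar_dichotomy ha with h | h <;> simp [ha, h]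
  rw [Finset.sum_congr rfl fun a _ => h1 a, Finset.sum_sub_distrib, Finset.sum_sub_distrib,
    ← Finset.mul_sum] at h
  simp only [Finset.sum_const, Finset.sum_boole, Finset.card_univ, Finset.filter_eq',
    Finset.mem_univ, if_true, Finset.card_singleton] at h
  simp only [nsmul_eq_mul, mul_one, Nat.cast_one] at h
  omega

/-- Two injective images of the set of nonsquares that both omit two given elements intersect. -/
lemma exists_eq_of_injOn_nonsquares (hF : ringChar F ≠ 2) {f g : F → F} {x y : F} (hxy : x ≠ y)
    (hf : Set.InjOn f {a | quadraticChar F a = -1})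
    (hg : Set.InjOn g {a | quadraticChar F a = -1})
    (hfx : ∀ a, quadraticChar F a = -1 → f a ≠ x ∧ f a ≠ y)
    (hgx : ∀ a, quadraticChar F a = -1 → g a ≠ x ∧ g a ≠ y) :
    ∃ a b, quadraticChar F a = -1 ∧ quadraticChar F b = -1 ∧ f a = g b := by
  by_contra! hcon
  set N := Finset.univ.filter fun a : F => quadraticChar F a = -1 with hN
  have hmem : ∀ a, a ∈ N ↔ quadraticChar F a = -1 := fun a => by simp [hN]
  have h1 : (N.image f).card = N.card := Finset.card_image_of_injOn (by simpa [hN] using hf)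
  have h2 : (N.image g).card = N.card := Finset.card_image_of_injOn (by simpa [hN] using hg)
  have h3 : Disjoint (N.image f) (N.image g) := by
    rw [Finset.disjoint_left]
    intro s hs hs'
    obtain ⟨a, ha, rfl⟩ := Finset.mem_image.1 hs
    obtain ⟨b, hb, hab⟩ := Finset.mem_image.1 hs'
    exact hcon a b ((hmem a).1 ha) ((hmem b).1 hb) hab.symm
  have h4 : Disjoint (N.image f ∪ N.image g) {x, y} := by
    rw [Finset.disjoint_left]
    intro s hs hs'
    rw [Finset.mem_insert, Finset.mem_singleton] at hs'
    rcases Finset.mem_union.1 hs with hs | hs <;> obtain ⟨a, ha, rfl⟩ := Finset.mem_image.1 hs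
    · exact hs'.elim (hfx a ((hmem a).1 ha)).1 (hfx a ((hmem a).1 ha)).2
    · exact hs'.elim (hgx a ((hmem a).1 ha)).1 (hgx a ((hmem a).1 ha)).2
  have h5 := Finset.card_le_univ ((N.image f ∪ N.image g) ∪ {x, y})
  rw [Finset.card_union_of_disjoint h4, Finset.card_union_of_disjoint h3, h1, h2,
    Finset.card_pair hxy] at h5
  have h6 := two_mul_card_nonsquares_add_one hF
  rw [← hN] at h6
  omega

lemma ne_zero_of_quadraticChar_eq_neg_one {a : F} (h : quadraticChar F a = -1) : a ≠ 0 := by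
  rintro rfl
  simp at h

lemma ne_one_of_quadraticChar_eq_neg_one {a : F} (h : quadraticChar F a = -1) : a ≠ 1 := by
  rintro rfl
  simp at h

lemma exists_consecutive_nonsquares (hF : ringChar F ≠ 2) (hm : quadraticChar F (-1) = 1)
    (h2 : quadraticChar F 2 = 1) :
    ∃ a : F, quadraticChar F a = -1 ∧ quadraticChar F (a + 2) = -1 := by
  have h20 : (2 : F) ≠ 0 := Ring.two_ne_zero hF
  have hm2 : quadraticChar F (-2) = 1 := by
    rw [← neg_one_mul, map_mul, hm, h2, one_mul]
  obtain ⟨a, b, ha, hb, hab⟩ := exists_eq_of_injOn_nonsquares hF (f := fun a => a)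
    (g := fun a => a - 2) (x := 0) (y := -2) (neg_ne_zero.2 h20).symm
    (fun a _ b _ h => h) (fun a _ b _ h => sub_left_injective h)
    (fun a ha => ⟨ne_zero_of_quadraticChar_eq_neg_one ha, by rintro rfl; rw [hm2] at ha; omega⟩)
    (fun a ha => ⟨by
      intro h
      rw [sub_eq_zero] at h
      rw [h, h2] at ha; omega, by
      intro h
      exact ne_zero_of_quadraticChar_eq_neg_one ha (by linear_combination h)⟩)
  exact ⟨a, ha, by rw [show a + 2 = b by rw [show a = b - 2 from hab]; ring]; exact hb⟩

/-- Parametrization of the elements `s` with `s ^ 2 - α ^ 2` a nonsquare. -/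
lemma quadraticChar_param {α c : F} (h20 : (2 : F) ≠ 0) (hα : α ≠ 0)
    (hc : quadraticChar F c = -1) :
    quadraticChar F ((α * (1 + c) / (1 - c)) ^ 2 - α ^ 2) = -1 := by
  have h1 : 1 - c ≠ 0 := sub_ne_zero.2 (ne_one_of_quadraticChar_eq_neg_one hc).symm
  rw [show (α * (1 + c) / (1 - c)) ^ 2 - α ^ 2 = (2 * α / (1 - c)) ^ 2 * c by field_simp; ring,
    map_mul, quadraticChar_sq_one' (div_ne_zero (mul_ne_zero h20 hα) h1), hc, one_mul]

lemma injOn_param {α : F} (h20 : (2 : F) ≠ 0) (hα : α ≠ 0) :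
    Set.InjOn (fun c => α * (1 + c) / (1 - c)) {a | quadraticChar F a = -1} := by
  intro a ha b hb hab
  have ha1 : 1 - a ≠ 0 := sub_ne_zero.2 (ne_one_of_quadraticChar_eq_neg_one ha).symm
  have hb1 : 1 - b ≠ 0 := sub_ne_zero.2 (ne_one_of_quadraticChar_eq_neg_one hb).symm
  simp only at hab
  rw [div_eq_div_iff ha1 hb1] at hab
  have : (2 * α) * (a - b) = 0 := by linear_combination hab
  rcases mul_eq_zero.1 this with h | h
  · exact absurd h (mul_ne_zero h20 hα)
  · exact sub_eq_zero.1 h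

lemma exists_sq_sub_nonsquare (hF : ringChar F ≠ 2) {a d : F}
    (ha : quadraticChar F a = 1) (hd : quadraticChar F d = 1)
    (h : a = d ∨ quadraticChar F (a - d) = 1 ∧ quadraticChar F (d - a) = 1) :
    ∃ s : F, quadraticChar F (s ^ 2 - a) = -1 ∧ quadraticChar F (s ^ 2 - d) = -1 := by
  have h20 : (2 : F) ≠ 0 := Ring.two_ne_zero hF
  have ha0 : a ≠ 0 := by rintro rfl; simp at ha
  have hd0 : d ≠ 0 := by rintro rfl; simp at hd
  obtain ⟨α, rfl⟩ := (quadraticChar_one_iff_isSquare ha0).1 ha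
  obtain ⟨δ, rfl⟩ := (quadraticChar_one_iff_isSquare hd0).1 hd
  have hα : α ≠ 0 := left_ne_zero_of_mul ha0
  have hδ : δ ≠ 0 := left_ne_zero_of_mul hd0
  simp only [← sq] at *
  rcases h with h | ⟨h, h'⟩
  · obtain ⟨c, hc⟩ := quadraticChar_exists_neg_one hF
    exact ⟨_, quadraticChar_param h20 hα hc, h ▸ quadraticChar_param h20 hα hc⟩
  · have hαα : α ≠ -α := by
      intro h
      exact mul_ne_zero h20 hα (by linear_combination h)
    obtain ⟨c, e, hc, he, hce⟩ := exists_eq_of_injOn_nonsquares hF hαα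
      (injOn_param h20 hα) (injOn_param h20 hδ)
      (fun c hc => by
        have := ne_zero_of_quadraticChar_eq_neg_one (quadraticChar_param h20 hα hc)
        constructor <;> intro h <;> apply this <;> rw [h] <;> ring)
      (fun c hc => by
        have := quadraticChar_param h20 hδ hc
        constructor <;> intro h'' <;> rw [h''] at this
        · omega
        · rw [neg_sq] at this
          omega)
    exact ⟨_, quadraticChar_param h20 hα hc, hce ▸ quadraticChar_param h20 hδ he⟩

end QuadraticChar

namespace PadicNormResidue

variable {p : ℕ} [Fact p.Prime]

lemma chi_neg (h1 : chi (-1 : ℚ_[p]) = 1) (w : ℚ_[p]) : chi (-w) = chi w := by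
  rw [← neg_one_mul, chi_mul, h1, one_mul]

lemma chi_inv (w : ℚ_[p]) : chi w⁻¹ = chi w := by
  by_cases h : w = 0
  · simp [h]
  have h2 := chi_mul w w⁻¹
  rw [mul_inv_cancel₀ h, ← one_pow 2, chi_sq one_ne_zero] at h2
  rcases chi_cases h with h | h <;> rw [h] at h2 ⊢ <;> linarith

lemma chi_div (a b : ℚ_[p]) : chi (a / b) = chi a * chi b := by
  rw [div_eq_mul_inv, chi_mul, chi_inv]

lemma ringChar_zmod_ne_two (hp : p ≠ 2) : ringChar (ZMod p) ≠ 2 := by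
  rwa [ZMod.ringChar_zmod_n]

lemma exists_unit_chi_eq_neg_one (hp : p ≠ 2) : ∃ w : ℚ_[p], ‖w‖ = 1 ∧ chi w = -1 := by
  obtain ⟨s, hs⟩ := quadraticChar_exists_neg_one (ringChar_zmod_ne_two hp)
  obtain ⟨S, rfl⟩ := exists_toZMod_eq s
  have h0 := ne_zero_of_quadraticChar_eq_neg_one hs
  exact ⟨S, norm_eq_one_of_toZMod_ne_zero h0, by rw [chi_coe h0, hs]⟩

/-- `w` and `w'` agree to leading order. -/
def Near (w w' : ℚ_[p]) : Prop := ‖w - w'‖ < ‖w'‖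

lemma Near.ne_zero_right {a b : ℚ_[p]} (h : Near a b) : b ≠ 0 :=
  norm_pos_iff.1 ((norm_nonneg _).trans_lt h)

lemma Near.norm_eq {a b : ℚ_[p]} (h : Near a b) : ‖a‖ = ‖b‖ := norm_eq_of_norm_sub_lt h

lemma Near.chi_eq {a b : ℚ_[p]} (h : Near a b) : chi a = chi b := chi_congr h

lemma Near.ne_zero {a b : ℚ_[p]} (h : Near a b) : a ≠ 0 :=
  norm_pos_iff.1 (h.norm_eq ▸ norm_pos_iff.2 h.ne_zero_right)

lemma Near.refl {a : ℚ_[p]} (h : a ≠ 0) : Near a a := by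
  simpa [Near] using h

lemma Near.trans {a b c : ℚ_[p]} (h : Near a b) (h' : Near b c) : Near a c := by
  have h1 : ‖a - b‖ < ‖c‖ := h'.norm_eq ▸ h
  have := Padic.nonarchimedean (a - b) (b - c)
  rw [sub_add_sub_cancel] at this
  exact this.trans_lt (max_lt h1 h')

lemma Near.mul {a b a' b' : ℚ_[p]} (h : Near a b) (h' : Near a' b') :
    Near (a * a') (b * b') := by
  have h1 : Near (a * a') (b * a') := by
    rw [Near, ← sub_mul, norm_mul, norm_mul]
    exact mul_lt_mul_of_pos_right h (norm_pos_iff.2 h'.ne_zero)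
  refine h1.trans ?_
  rw [Near, ← mul_sub, norm_mul, norm_mul]
  exact mul_lt_mul_of_pos_left h' (norm_pos_iff.2 h.ne_zero_right)

lemma Near.mul_left {a b : ℚ_[p]} (h : Near a b) {c : ℚ_[p]} (hc : c ≠ 0) :
    Near (c * a) (c * b) := (Near.refl hc).mul h

lemma near_add_of_lt {a b : ℚ_[p]} (h : ‖b‖ < ‖a‖) : Near (a + b) a := by
  simpa [Near] using h

lemma near_sub_of_lt {a b : ℚ_[p]} (h : ‖b‖ < ‖a‖) : Near (a - b) a := by
  simpa [Near] using h

lemma near_sub_of_lt_right {a b : ℚ_[p]} (h : ‖a‖ < ‖b‖) : Near (a - b) (-b) := by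
  simpa [Near] using h

lemma Near.exists_eq_mul_sq (hp : p ≠ 2) {a b : ℚ_[p]} (h : Near a b) :
    ∃ g : ℚ_[p], a = b * g ^ 2 ∧ Near g 1 := by
  obtain ⟨g, h1, h2⟩ := exists_sq_mul hp h
  exact ⟨g, h1, by simpa [Near] using h2⟩

lemma Near.exists_sq (hp : p ≠ 2) {a h : ℚ_[p]} (hn : Near a (h ^ 2)) :
    ∃ g : ℚ_[p], a = g ^ 2 ∧ Near g h := by
  obtain ⟨g, h1, h2⟩ := hn.exists_eq_mul_sq hp
  have h0 : h ≠ 0 := by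
    have := hn.ne_zero_right
    rintro rfl
    simp at this
  exact ⟨h * g, by rw [h1]; ring, by simpa using h2.mul_left h0⟩

lemma norm_p_mul_lt {w : ℚ_[p]} (h : w ≠ 0) : ‖(p : ℚ_[p]) * w‖ < ‖w‖ := by
  rw [norm_mul]
  exact mul_lt_of_lt_one_left (norm_pos_iff.2 h) Padic.norm_p_lt_one

lemma exists_eq_sq_of_norm_eq (hp : p ≠ 2) (h1 : chi (-1 : ℚ_[p]) = 1) {w r : ℚ_[p]}
    (h : chi w = 1) (hn : ‖w‖ = ‖r ^ 2‖) : ∃ s : ℚ_[p], s ≠ 0 ∧ w = s ^ 2 := by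
  obtain ⟨s, hs, h' | h'⟩ := eq_sq_or_p_mul_sq hp h1 h
  · exact ⟨s, hs, h'⟩
  · have hr : r ≠ 0 := by
      rintro rfl
      exact ne_zero_of_chi_eq_one h (by simpa using hn)
    rw [h'] at hn
    exact absurd hn.symm (norm_sq_ne_norm_p_mul_sq hr)

lemma exists_eq_p_mul_sq_of_norm_eq (hp : p ≠ 2) (h1 : chi (-1 : ℚ_[p]) = 1) {w r : ℚ_[p]}
    (h : chi w = 1) (hn : ‖w‖ = ‖p * r ^ 2‖) : ∃ s : ℚ_[p], s ≠ 0 ∧ w = p * s ^ 2 := by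
  obtain ⟨s, hs, h' | h'⟩ := eq_sq_or_p_mul_sq hp h1 h
  · rw [h'] at hn
    exact absurd hn (norm_sq_ne_norm_p_mul_sq hs)
  · exact ⟨s, hs, h'⟩

/-! ### Solving `y ^ 2 - p * x ^ 2 = m`, `z ^ 2 - p * x ^ 2 = q` -/

lemma exists_of_near_sq_of_near_sq (hp : p ≠ 2) {m q y₀ z₀ : ℚ_[p]}
    (hm : Near m (y₀ ^ 2)) (hq : Near q (z₀ ^ 2)) :
    ∃ x y z : ℚ_[p], y ^ 2 - p * x ^ 2 = m ∧ z ^ 2 - p * x ^ 2 = q ∧ Near y y₀ ∧ Near z z₀ := by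
  obtain ⟨y, hy, hy'⟩ := hm.exists_sq hp
  obtain ⟨z, hz, hz'⟩ := hq.exists_sq hp
  exact ⟨0, y, z, by rw [hy]; ring, by rw [hz]; ring, hy', hz'⟩

lemma exists_of_norm_lt_of_near_sq (hp : p ≠ 2) (h1 : chi (-1 : ℚ_[p]) = 1) {m q h : ℚ_[p]}
    (hm : chi m = 1) (hmh : ‖m‖ < ‖h ^ 2‖) (hq : Near q (h ^ 2)) :
    ∃ x y z : ℚ_[p], y ^ 2 - p * x ^ 2 = m ∧ z ^ 2 - p * x ^ 2 = q ∧ chi (z - y) = chi h := by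
  obtain ⟨i, hi⟩ := exists_sq_eq_neg_one hp h1
  obtain ⟨r, hr, rfl | rfl⟩ := eq_sq_or_p_mul_sq hp h1 hm
  · obtain ⟨z, hz, hz'⟩ := hq.exists_sq hp
    refine ⟨0, r, z, by ring, by rw [hz]; ring, ?_⟩
    rw [norm_pow, norm_pow] at hmh
    have : Near (z - r) z := near_sub_of_lt (by
      rw [hz'.norm_eq]
      exact lt_of_pow_lt_pow_left₀ 2 (norm_nonneg _) hmh)
    exact (this.trans hz').chi_eq
  · obtain ⟨z, hz, hz'⟩ := Near.exists_sq hp (a := q - p * r ^ 2) (h := h)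
      ((near_sub_of_lt (hmh.trans_eq hq.norm_eq.symm)).trans hq)
    refine ⟨i * r, 0, z, by linear_combination (-(p : ℚ_[p]) * r ^ 2) * hi,
      by linear_combination (-(p : ℚ_[p]) * r ^ 2) * hi - hz, ?_⟩
    rw [sub_zero, hz'.chi_eq]

lemma exists_of_near_sq_of_norm_lt (hp : p ≠ 2) (h1 : chi (-1 : ℚ_[p]) = 1) {m q h : ℚ_[p]}
    (hq : chi q = 1) (hqh : ‖q‖ < ‖h ^ 2‖) (hm : Near m (h ^ 2)) :
    ∃ x y z : ℚ_[p], y ^ 2 - p * x ^ 2 = m ∧ z ^ 2 - p * x ^ 2 = q ∧ chi (z - y) = chi h := by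
  obtain ⟨x, y, z, hy, hz, hc⟩ := exists_of_norm_lt_of_near_sq hp h1 hq hqh hm
  exact ⟨x, z, y, hz, hy, by rw [← neg_sub, chi_neg h1, hc]⟩

lemma exists_of_norm_le_sq (hp : p ≠ 2) (h1 : chi (-1 : ℚ_[p]) = 1) {m h : ℚ_[p]}
    (hm : chi m = 1) (h0 : h ≠ 0) (hmh : ‖m‖ ≤ ‖h ^ 2‖) :
    ∃ x y z : ℚ_[p], y ^ 2 - p * x ^ 2 = m ∧ z ^ 2 - p * x ^ 2 = h ^ 2 := by
  rcases hmh.lt_or_eq with hlt | heq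
  · obtain ⟨x, y, z, hy, hz, -⟩ :=
      exists_of_norm_lt_of_near_sq hp h1 hm hlt (Near.refl (pow_ne_zero 2 h0))
    exact ⟨x, y, z, hy, hz⟩
  · obtain ⟨s, -, rfl⟩ := exists_eq_sq_of_norm_eq hp h1 hm heq
    exact ⟨0, s, h, by ring, by ring⟩

lemma exists_of_near_p_mul_sq (hp : p ≠ 2) (h1 : chi (-1 : ℚ_[p]) = 1) {m q r δ : ℚ_[p]}
    (hm : m = p * r ^ 2) (hq : Near q m) (hδ : ‖δ‖ = ‖p * r‖) :
    ∃ x y z : ℚ_[p], y ^ 2 - p * x ^ 2 = m ∧ z ^ 2 - p * x ^ 2 = q ∧ z - y = δ := by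
  obtain ⟨i, hi⟩ := exists_sq_eq_neg_one hp h1
  have hp0 : (p : ℚ_[p]) ≠ 0 := p_ne_zero
  have hm0 := hq.ne_zero_right
  have hr : r ≠ 0 := by
    rintro rfl
    simp [hm] at hm0
  have hδ0 : δ ≠ 0 := by
    rw [← norm_pos_iff, hδ, norm_pos_iff]
    exact mul_ne_zero hp0 hr
  have h20 : (2 : ℚ_[p]) ≠ 0 := two_ne_zero
  set y := ((q - m) / δ - δ) / 2 with hy
  have hδpos : 0 < ‖δ‖ := norm_pos_iff.2 hδ0
  have hyn : ‖y‖ ≤ ‖δ‖ := by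
    rw [hy, norm_div, norm_two hp, div_one]
    refine (norm_sub_le_max _ _).trans (max_le ?_ le_rfl)
    rw [norm_div, div_le_iff₀ hδpos]
    refine (norm_le_norm_p_mul_of_lt hq).trans ?_
    rw [hδ, hm, ← norm_mul, ← norm_mul]
    apply le_of_eq
    congr 1
    ring
  have hyl : ‖y ^ 2 / p‖ < ‖(i * r) ^ 2‖ := by
    have : ‖δ ^ 2 / p‖ < ‖(i * r) ^ 2‖ := by
      rw [mul_pow, hi, neg_one_mul, norm_neg, norm_div, norm_pow, hδ, ← norm_pow, ← norm_div,
        show ((p : ℚ_[p]) * r) ^ 2 / p = p * r ^ 2 by field_simp]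
      exact norm_p_mul_lt (pow_ne_zero 2 hr)
    refine lt_of_le_of_lt ?_ this
    rw [norm_div, norm_div, norm_pow, norm_pow]
    gcongr
  obtain ⟨x, hx, -⟩ := (near_add_of_lt hyl).exists_sq hp
  have hxx : (p : ℚ_[p]) * x ^ 2 = y ^ 2 - m := by
    rw [← hx, mul_pow, hi, hm]
    field_simp
    ring
  refine ⟨x, y, y + δ, by rw [hxx]; ring, ?_, by ring⟩
  have : 2 * y * δ + δ ^ 2 = q - m := by
    rw [hy]
    field_simp
    ring
  linear_combination this - hxx

lemma Near.sub_sub {y y₀ z z₀ : ℚ_[p]} (hz : Near z z₀) (hy : Near y y₀)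
    (h₁ : ‖z₀‖ ≤ ‖z₀ - y₀‖) (h₂ : ‖y₀‖ ≤ ‖z₀ - y₀‖) : Near (z - y) (z₀ - y₀) := by
  rw [Near, sub_sub_sub_comm]
  exact (norm_sub_le_max _ _).trans_lt (max_lt (hz.trans_le h₁) (hy.trans_le h₂))

/-- The pair of conics `y² - p x² = k μ t`, `z² - p x² = k (t - a) (t - d)`. -/
def On (k a d μ t x y z : ℚ_[p]) : Prop :=
  y ^ 2 - p * x ^ 2 = k * μ * t ∧ z ^ 2 - p * x ^ 2 = k * (t - a) * (t - d)

/-- `chi (t * (z - y))` takes both values on the pair of conics. -/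
def VariesB (k a d μ : ℚ_[p]) : Prop :=
  ∃ t x y z t' x' y' z' : ℚ_[p], On k a d μ t x y z ∧ On k a d μ t' x' y' z' ∧
    chi (t * (z - y)) * chi (t' * (z' - y')) = -1

/-- `chi (t * (t - a))` takes both values on the pair of conics. -/
def VariesA (k a d μ : ℚ_[p]) : Prop :=
  ∃ t x y z t' x' y' z' : ℚ_[p], On k a d μ t x y z ∧ On k a d μ t' x' y' z' ∧
    chi (t * (t - a)) * chi (t' * (t' - a)) = -1

lemma VariesB.symm {k a d μ : ℚ_[p]} (h : VariesB k a d μ) : VariesB k d a μ := by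
  obtain ⟨t, x, y, z, t', x', y', z', h, h', hc⟩ := h
  exact ⟨t, x, y, z, t', x', y', z', ⟨h.1, by rw [h.2]; ring⟩, ⟨h'.1, by rw [h'.2]; ring⟩, hc⟩

lemma chi_t_of_on {k a d μ t x y z : ℚ_[p]} (hk : k ≠ 0) (hμ : μ ≠ 0) (ht : t ≠ 0)
    (h : On k a d μ t x y z) : chi t = chi (k * μ) := by
  have h2 : chi (k * μ * t) = 1 := by
    rw [← h.1]
    apply chi_sq_sub_p_mul_sq
    rw [h.1]
    exact mul_ne_zero (mul_ne_zero hk hμ) ht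
  rw [chi_mul] at h2
  rcases chi_cases ht with h | h <;> rw [h] at h2 ⊢ <;> linarith

lemma VariesB.of_inv {k a d μ : ℚ_[p]} (hk : k ≠ 0) (ha : a ≠ 0) (hd : d ≠ 0) (hμ : μ ≠ 0)
    (h : VariesB (k * a * d) d⁻¹ a⁻¹ (μ / (a * d))) : VariesB k a d μ := by
  obtain ⟨t, x, y, z, t', x', y', z', h, h', hc⟩ := h
  have ht : t ≠ 0 := by
    rintro rfl
    simp at hc
  have ht' : t' ≠ 0 := by
    rintro rfl
    simp at hc
  have key : ∀ {t x y z : ℚ_[p]}, t ≠ 0 → On (k * a * d) d⁻¹ a⁻¹ (μ / (a * d)) t x y z →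
      On k a d μ t⁻¹ (x / t) (y / t) (z / t) := by
    intro t x y z ht h
    obtain ⟨h₁, h₂⟩ := h
    constructor
    · have : (y / t) ^ 2 - p * (x / t) ^ 2 = (y ^ 2 - p * x ^ 2) / t ^ 2 := by ring
      rw [this, h₁]
      field_simp
    · have : (z / t) ^ 2 - p * (x / t) ^ 2 = (z ^ 2 - p * x ^ 2) / t ^ 2 := by ring
      rw [this, h₂]
      field_simp
      ring
  refine ⟨_, _, _, _, _, _, _, _, key ht h, key ht' h', ?_⟩
  have e : ∀ {t y z : ℚ_[p]}, t ≠ 0 → chi (t⁻¹ * (z / t - y / t)) = chi (z - y) := by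
    intro t y z ht
    rw [← sub_div, chi_mul, chi_div, chi_inv, mul_comm, mul_assoc, chi_mul_self ht, mul_one]
  rw [e ht, e ht']
  rw [chi_mul, chi_mul] at hc
  have hk' : k * a * d ≠ 0 := by positivity
  have hμ' : μ / (a * d) ≠ 0 := by positivity
  rw [chi_t_of_on hk' hμ' ht h, chi_t_of_on hk' hμ' ht' h'] at hc
  have := chi_mul_self (mul_ne_zero hk' hμ')
  linear_combination hc + (-chi (z - y) * chi (z' - y')) * this

lemma near_of_norm_lt (hp : p ≠ 2) {a d μ c n : ℚ_[p]} (hc : 2 * c = a + d + μ)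
    (hn : c ^ 2 - p * n ^ 2 = a * d) (had : ‖a‖ < ‖d‖) : Near μ (-d) := by
  have h2 : ‖c‖ < ‖d‖ := by
    have h := norm_sq_sub_p_mul_sq c n
    rw [hn, norm_mul] at h
    have h3 : ‖c‖ ^ 2 ≤ ‖a‖ * ‖d‖ := by
      rw [h, ← norm_pow]
      exact le_max_left _ _
    have hd : 0 < ‖d‖ := (norm_nonneg _).trans_lt had
    nlinarith [norm_nonneg c]
  have e : μ - -d = 2 * c - a := by rw [hc]; ring
  rw [Near, e, norm_neg]
  refine (norm_sub_le_max _ _).trans_lt (max_lt ?_ had)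
  rwa [norm_mul, norm_two hp, one_mul]

lemma variesB_of_norm_lt_of_eq_sq (hp : p ≠ 2) (h1 : chi (-1 : ℚ_[p]) = 1) {k a d μ κ : ℚ_[p]}
    (hk : k ≠ 0) (ha : a ≠ 0) (hd : d ≠ 0) (had : ‖a‖ < ‖d‖) (hμ : Near μ (-d))
    (hκ : k * a * d = κ ^ 2) : VariesB k a d μ := by
  obtain ⟨i, hi⟩ := exists_sq_eq_neg_one hp h1
  have hκ0 : κ ≠ 0 := by
    rintro rfl
    have : k * a * d ≠ 0 := by positivity
    simp [hκ] at this
  have hp0 : (p : ℚ_[p]) ≠ 0 := p_ne_zero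
  have hpa := norm_p_mul_lt ha
  have hi0 : i ≠ 0 := by
    rintro rfl
    simp at hi
  have hP : Near ((p : ℚ_[p]) * a - a) (-a) := near_sub_of_lt_right hpa
  have hP' : Near ((p : ℚ_[p]) * a - d) (-d) := near_sub_of_lt_right (hpa.trans had)
  have hm : Near (k * μ * ((p : ℚ_[p]) * a)) (-((p : ℚ_[p]) * κ ^ 2)) := by
    have := (hμ.mul_left hk).mul (Near.refl (mul_ne_zero hp0 ha))
    convert this using 1
    rw [← hκ]
    ring
  have hq : Near (k * ((p : ℚ_[p]) * a - a) * ((p : ℚ_[p]) * a - d)) (κ ^ 2) := by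
    have := (hP.mul_left hk).mul hP'
    convert this using 1
    rw [← hκ]
    ring
  have hpκ : chi ((p : ℚ_[p]) * κ ^ 2) = 1 := by
    rw [chi_mul, chi_p h1, chi_sq hκ0, one_mul]
  obtain ⟨x, y, z, hy, hz, hyz⟩ := exists_of_norm_lt_of_near_sq hp h1
    (by rw [hm.chi_eq, chi_neg h1, hpκ])
    (by rw [hm.norm_eq, norm_neg]; exact norm_p_mul_lt (pow_ne_zero 2 hκ0)) hq
  have hval : chi ((p : ℚ_[p]) * a * (z - y)) = chi a * chi κ := by
    rw [chi_mul, chi_mul, chi_p h1, hyz, one_mul]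
  have ha2 := chi_mul_self ha
  have hκ2 := chi_mul_self hκ0
  rcases chi_cases hi0 with hic | hic
  · obtain ⟨ε, hε, hεc⟩ := exists_unit_chi_eq_neg_one hp
    have hε0 : ε ≠ 0 := ne_zero_of_chi_eq_neg_one hεc
    have h20 : (2 : ℚ_[p]) ≠ 0 := by norm_num
    set s := (ε - ε⁻¹) / 2 with hs
    set w := (ε + ε⁻¹) / 2 with hw
    have hws : w ^ 2 = s ^ 2 + 1 := by
      rw [hs, hw]
      field_simp
      ring
    have hs0 : s ≠ 0 := by
      intro h
      have h' : (ε - 1) * (ε + 1) = 0 := by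
        have : (ε - 1) * (ε + 1) = s * (2 * ε) := by
          rw [hs]
          field_simp
          ring
        rw [this, h, zero_mul]
      rcases mul_eq_zero.1 h' with h' | h'
      · rw [sub_eq_zero.1 h', ← one_pow 2, chi_sq one_ne_zero] at hεc
        norm_num at hεc
      · rw [eq_neg_of_add_eq_zero_left h', h1] at hεc
        norm_num at hεc
    have hw0 : w ≠ 0 := by
      intro h
      have h' : (ε - i) * (ε + i) = 0 := by
        have : (ε - i) * (ε + i) = w * (2 * ε) := by
          have : (ε - i) * (ε + i) = ε ^ 2 - i ^ 2 := by ring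
          rw [this, hi, hw]
          field_simp
          ring
        rw [this, h, zero_mul]
      rcases mul_eq_zero.1 h' with h' | h'
      · rw [sub_eq_zero.1 h', hic] at hεc
        norm_num at hεc
      · rw [eq_neg_of_add_eq_zero_left h', chi_neg h1, hic] at hεc
        norm_num at hεc
    have hs1 : ‖s‖ ≤ 1 := by
      rw [hs, norm_div, norm_two hp, div_one]
      exact (norm_sub_le_max _ _).trans (by simp [hε])
    have hw1 : ‖w‖ ≤ 1 := by
      rw [hw, norm_div, norm_two hp, div_one]
      exact (Padic.nonarchimedean _ _).trans (by simp [hε])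
    have hsw : w - s = ε⁻¹ := by
      rw [hs, hw]
      ring
    have hP' : Near (-(a * s ^ 2) - d) (-d) := by
      refine near_sub_of_lt_right ?_
      rw [norm_neg, norm_mul, norm_pow]
      refine lt_of_le_of_lt ?_ had
      exact mul_le_of_le_one_right (norm_nonneg _) (pow_le_one₀ (norm_nonneg _) hs1)
    have hm : Near (k * μ * -(a * s ^ 2)) ((κ * s) ^ 2) := by
      have := (hμ.mul_left hk).mul (Near.refl (a := -(a * s ^ 2)) (by
        rw [neg_ne_zero]; positivity))
      convert this using 1
      rw [mul_pow, ← hκ]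
      ring
    have hq : Near (k * (-(a * s ^ 2) - a) * (-(a * s ^ 2) - d)) ((κ * w) ^ 2) := by
      have e : -(a * s ^ 2) - a = -a * w ^ 2 := by rw [hws]; ring
      rw [e]
      have := hP'.mul_left (c := k * (-a * w ^ 2)) (by
        refine mul_ne_zero hk (mul_ne_zero (neg_ne_zero.2 ha) (pow_ne_zero 2 hw0)))
      convert this using 1
      rw [mul_pow, ← hκ]
      ring
    obtain ⟨x', y', z', hy', hz', hyn, hzn⟩ := exists_of_near_sq_of_near_sq hp hm hq
    have e : κ * w - κ * s = κ * ε⁻¹ := by rw [← mul_sub, hsw]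
    have hn : Near (z' - y') (κ * ε⁻¹) := by
      rw [← e]
      have hne : ‖κ * w - κ * s‖ = ‖κ‖ := by rw [e, norm_mul, norm_inv, hε]; simp
      refine hzn.sub_sub hyn ?_ ?_ <;> rw [hne, norm_mul] <;>
        exact mul_le_of_le_one_right (norm_nonneg _) (by assumption)
    refine ⟨_, x, y, z, _, x', y', z', ⟨hy, hz⟩, ⟨hy', hz'⟩, ?_⟩
    rw [hval, chi_mul, chi_neg h1, chi_mul, chi_sq hs0, hn.chi_eq, chi_mul, chi_inv, hεc]
    linear_combination -hκ2 * chi a ^ 2 - ha2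
  · have hP : Near (a + (p : ℚ_[p]) * a) a := near_add_of_lt hpa
    have hP' : Near (a + (p : ℚ_[p]) * a - d) (-d) := near_sub_of_lt_right (by rw [hP.norm_eq]; exact had)
    have hm : Near (k * μ * (a + (p : ℚ_[p]) * a)) ((i * κ) ^ 2) := by
      have := (hμ.mul_left hk).mul hP
      convert this using 1
      rw [mul_pow, ← hκ, hi]
      ring
    have hq : Near (k * (a + (p : ℚ_[p]) * a - a) * (a + (p : ℚ_[p]) * a - d))
        (-((p : ℚ_[p]) * κ ^ 2)) := by
      have := hP'.mul_left (c := k * (a + p * a - a)) (by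
        rw [add_sub_cancel_left]; positivity)
      convert this using 1
      rw [← hκ]
      ring
    obtain ⟨x', y', z', hy', hz', hyz'⟩ := exists_of_near_sq_of_norm_lt hp h1
      (by rw [hq.chi_eq, chi_neg h1, hpκ])
      (by rw [hq.norm_eq, norm_neg, mul_pow, hi, neg_one_mul, norm_neg]
          exact norm_p_mul_lt (pow_ne_zero 2 hκ0)) hm
    refine ⟨_, x, y, z, _, x', y', z', ⟨hy, hz⟩, ⟨hy', hz'⟩, ?_⟩
    rw [hval, chi_mul, hyz', hP.chi_eq, chi_mul, hic]
    linear_combination -hκ2 * chi a ^ 2 - ha2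

lemma variesB_of_norm_lt_of_eq_p_mul_sq (hp : p ≠ 2) (h1 : chi (-1 : ℚ_[p]) = 1)
    {k a d μ κ e : ℚ_[p]} (hκ0 : κ ≠ 0) (ha : a ≠ 0) (hd : d ≠ 0) (had : ‖a‖ < ‖d‖)
    (hμ : Near μ (-d)) (hk : k = p * κ ^ 2) (he : a * d = e ^ 2) : VariesB k a d μ := by
  have hp0 : (p : ℚ_[p]) ≠ 0 := p_ne_zero
  have h20 : (2 : ℚ_[p]) ≠ 0 := by norm_num
  have hk0 : k ≠ 0 := by rw [hk]; positivity
  have hpd : ‖a‖ < ‖(p : ℚ_[p]) * d‖ := by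
    refine lt_of_le_of_ne (by rw [norm_mul]; exact norm_le_norm_p_mul_of_lt had) fun h => ?_
    refine norm_sq_ne_norm_p_mul_sq (p := p) (s := e) (t := d) ?_ ?_
    · rintro rfl
      have := mul_ne_zero ha hd
      simp [he] at this
    · rw [← he, norm_mul, h, sq, ← mul_assoc, norm_mul (p * d)]
  have key : ∀ g : ℚ_[p], ‖g‖ = 1 → ∃ t x y z, On k a d μ t x y z ∧
      chi (t * (z - y)) = chi d * chi (2 * ((p : ℚ_[p]) * κ * d)) * chi g := by
    intro g hg
    have hg0 : g ≠ 0 := norm_pos_iff.1 (by rw [hg]; exact one_pos)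
    have hnt : ‖-((p : ℚ_[p]) * d * g ^ 2)‖ = ‖(p : ℚ_[p]) * d‖ := by simp [hg]
    have ht0 : -((p : ℚ_[p]) * d * g ^ 2) ≠ 0 := neg_ne_zero.2 (by positivity)
    have hm : Near (k * μ * -((p : ℚ_[p]) * d * g ^ 2)) ((-((p : ℚ_[p]) * κ * d * g)) ^ 2) := by
      have := (hμ.mul_left hk0).mul (Near.refl ht0)
      convert this using 1
      rw [hk]
      ring
    have hq : Near (k * (-((p : ℚ_[p]) * d * g ^ 2) - a) * (-((p : ℚ_[p]) * d * g ^ 2) - d))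
        (((p : ℚ_[p]) * κ * d * g) ^ 2) := by
      have := ((near_sub_of_lt (hnt ▸ hpd)).mul_left hk0).mul
        (near_sub_of_lt_right (hnt ▸ norm_p_mul_lt hd : ‖-((p : ℚ_[p]) * d * g ^ 2)‖ < ‖d‖))
      convert this using 1
      rw [hk]
      ring
    obtain ⟨x, y, z, hy, hz, hyn, hzn⟩ := exists_of_near_sq_of_near_sq hp hm hq
    refine ⟨_, x, y, z, ⟨hy, hz⟩, ?_⟩
    have e2 : (p : ℚ_[p]) * κ * d * g - -(p * κ * d * g) = 2 * (p * κ * d) * g := by ring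
    have hn2 : ‖(p : ℚ_[p]) * κ * d * g - -(p * κ * d * g)‖ = ‖p * κ * d * g‖ := by
      rw [e2, mul_assoc, norm_mul, norm_two hp, one_mul]
    have := hzn.sub_sub hyn hn2.ge (by rw [norm_neg]; exact hn2.ge)
    rw [chi_mul, this.chi_eq, e2, chi_neg h1, chi_mul, chi_mul, chi_p h1, chi_sq hg0,
      chi_mul (2 * ((p : ℚ_[p]) * κ * d))]
    ring
  obtain ⟨ε, hε, hεc⟩ := exists_unit_chi_eq_neg_one (p := p) hp
  obtain ⟨t, x, y, z, h, hc⟩ := key 1 norm_one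
  obtain ⟨t', x', y', z', h', hc'⟩ := key ε hε
  refine ⟨t, x, y, z, t', x', y', z', h, h', ?_⟩
  have h11 : chi (1 : ℚ_[p]) = 1 := by
    rw [← one_pow 2, chi_sq one_ne_zero]
  rw [hc, hc', h11, hεc]
  have h2 := chi_mul_self hd
  have h3 := chi_mul_self (w := 2 * ((p : ℚ_[p]) * κ * d)) (by positivity)
  linear_combination -h3 * chi d ^ 2 - h2

lemma variesB_of_norm_lt (hp : p ≠ 2) (h1 : chi (-1 : ℚ_[p]) = 1) {k a d μ c n : ℚ_[p]}
    (hk : chi k = 1) (ha : a ≠ 0) (hd : d ≠ 0) (hμ0 : μ ≠ 0) (hc : 2 * c = a + d + μ)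
    (hn : c ^ 2 - p * n ^ 2 = a * d) (had : ‖a‖ < ‖d‖) : VariesB k a d μ := by
  have hk0 := ne_zero_of_chi_eq_one hk
  have hμ := near_of_norm_lt hp hc hn had
  have hadc : chi (a * d) = 1 := by
    rw [← hn]
    apply chi_sq_sub_p_mul_sq
    rw [hn]
    exact mul_ne_zero ha hd
  obtain ⟨r, hr, hr' | hr'⟩ := eq_sq_or_p_mul_sq hp h1 (w := k * a * d) (by
    rw [mul_assoc, chi_mul, hk, hadc, one_mul])
  · exact variesB_of_norm_lt_of_eq_sq hp h1 hk0 ha hd had hμ hr'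
  obtain ⟨κ, hκ, hκ' | hκ'⟩ := eq_sq_or_p_mul_sq hp h1 hk
  · refine VariesB.of_inv hk0 ha hd hμ0 ?_
    have hμ' : Near (μ / (a * d)) (-a⁻¹) := by
      have := hμ.mul_left (c := (a * d)⁻¹) (by positivity)
      convert this using 1
      · ring
      · field_simp
    refine variesB_of_norm_lt_of_eq_sq hp h1 (κ := κ) (by positivity) (inv_ne_zero hd)
      (inv_ne_zero ha) ?_ hμ' ?_
    · rw [norm_inv, norm_inv]
      exact inv_strictAnti₀ (norm_pos_iff.2 ha) had
    · rw [← hκ']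
      field_simp
  · refine variesB_of_norm_lt_of_eq_p_mul_sq hp h1 hκ ha hd had hμ hκ' (e := r / κ) ?_
    have hp0 : (p : ℚ_[p]) ≠ 0 := p_ne_zero
    rw [hκ'] at hr'
    field_simp
    apply mul_left_cancel₀ hp0
    linear_combination hr'

lemma variesB_of_norm_ne (hp : p ≠ 2) (h1 : chi (-1 : ℚ_[p]) = 1) {k a d μ c n : ℚ_[p]}
    (hk : chi k = 1) (ha : a ≠ 0) (hd : d ≠ 0) (hμ0 : μ ≠ 0) (hc : 2 * c = a + d + μ)
    (hn : c ^ 2 - p * n ^ 2 = a * d) (had : ‖a‖ ≠ ‖d‖) : VariesB k a d μ := by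
  rcases had.lt_or_gt with h | h
  · exact variesB_of_norm_lt hp h1 hk ha hd hμ0 hc hn h
  · exact (variesB_of_norm_lt hp h1 hk hd ha hμ0 (hc.trans (by ring)) (hn.trans (by ring)) h).symm

lemma chi_one : chi (1 : ℚ_[p]) = 1 := by
  rw [← one_pow 2, chi_sq one_ne_zero]

lemma norm_lt_and_norm_eq_of_odd {w z x r : ℚ_[p]} (hw : w ≠ 0) (h : z ^ 2 - p * x ^ 2 = w)
    (hr : ‖w‖ = ‖p * r ^ 2‖) : ‖z ^ 2‖ < ‖w‖ ∧ ‖p * x ^ 2‖ = ‖w‖ := by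
  have hm := norm_sq_sub_p_mul_sq z x
  rw [h] at hm
  have hz : ‖z ^ 2‖ < ‖w‖ := by
    refine lt_of_le_of_ne (hm ▸ le_max_left _ _) fun he => ?_
    refine norm_sq_ne_norm_p_mul_sq (p := p) (s := z) (t := r) ?_ (he.trans hr)
    rintro rfl
    exact hw (by simpa using he.symm)
  refine ⟨hz, ?_⟩
  rcases max_choice ‖z ^ 2‖ ‖(p : ℚ_[p]) * x ^ 2‖ with h' | h' <;> rw [h'] at hm
  · exact absurd hm hz.ne'
  · exact hm.symm

lemma variesB_of_near (hp : p ≠ 2) (h1 : chi (-1 : ℚ_[p]) = 1) {k a d μ t r : ℚ_[p]}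
    (hm : k * μ * t = p * r ^ 2) (hq : Near (k * (t - a) * (t - d)) (k * μ * t)) :
    VariesB k a d μ := by
  have ht : t ≠ 0 := by
    rintro rfl
    simpa using hq.ne_zero_right
  have hp0 : (p : ℚ_[p]) ≠ 0 := p_ne_zero
  have hr : r ≠ 0 := by
    rintro rfl
    exact hq.ne_zero_right (by simp [hm])
  obtain ⟨ε, hε, hεc⟩ := exists_unit_chi_eq_neg_one (p := p) hp
  obtain ⟨x, y, z, hy, hz, h⟩ := exists_of_near_p_mul_sq hp h1 hm hq (δ := p * r) rfl
  obtain ⟨x', y', z', hy', hz', h'⟩ :=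
    exists_of_near_p_mul_sq hp h1 hm hq (δ := p * r * ε) (by rw [norm_mul _ ε, hε, mul_one])
  refine ⟨t, x, y, z, t, x', y', z', ⟨hy, hz⟩, ⟨hy', hz'⟩, ?_⟩
  rw [h, h', ← mul_assoc t (p * r) ε, chi_mul _ ε, hεc]
  have := chi_mul_self (mul_ne_zero ht (mul_ne_zero hp0 hr))
  linear_combination -this

/-- Both roots are units and `a d` is within `p n²` of one. -/
structure Normalized (a d μ n : ℚ_[p]) : Prop where
  norm_a : ‖a‖ = 1
  norm_d : ‖d‖ = 1
  mul_eq : a * d = 1 - p * n ^ 2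
  mu_eq : μ = 2 - a - d
  n_ne_zero : n ≠ 0
  mu_ne_zero : μ ≠ 0
  ne : a ≠ d

namespace Normalized

variable {a d μ n : ℚ_[p]}

lemma a_ne_zero (H : Normalized a d μ n) : a ≠ 0 :=
  norm_pos_iff.1 (by rw [H.norm_a]; exact one_pos)

lemma norm_lt (H : Normalized a d μ n) : ‖p * n ^ 2‖ < 1 := by
  have h := norm_sq_sub_p_mul_sq 1 n
  rw [one_pow, ← H.mul_eq, norm_mul, H.norm_a, H.norm_d, norm_one, mul_one] at h
  refine lt_of_le_of_ne (h ▸ le_max_right _ _) fun h' => ?_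
  exact norm_sq_ne_norm_p_mul_sq (p := p) one_ne_zero (t := n) (by simpa using h'.symm)

lemma a_mul_mu (H : Normalized a d μ n) : a * μ = -((a - 1) ^ 2 - p * n ^ 2) := by
  rw [H.mu_eq]
  linear_combination -H.mul_eq

lemma norm_mu (H : Normalized a d μ n) : ‖μ‖ = max ‖(a - 1) ^ 2‖ ‖p * n ^ 2‖ := by
  rw [← norm_sq_sub_p_mul_sq, ← norm_neg (_ - _), ← H.a_mul_mu, norm_mul, H.norm_a, one_mul]

lemma norm_a_sub_one_le (H : Normalized a d μ n) : ‖a - 1‖ ≤ 1 :=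
  (norm_sub_le_max _ _).trans (by simp [H.norm_a])

lemma norm_mu_le (H : Normalized a d μ n) : ‖μ‖ ≤ 1 := by
  rw [H.norm_mu, norm_pow]
  exact max_le (pow_le_one₀ (norm_nonneg _) H.norm_a_sub_one_le) H.norm_lt.le

lemma chi_mu (h1 : chi (-1 : ℚ_[p]) = 1) (H : Normalized a d μ n) : chi μ = chi a := by
  have h : chi (a * μ) = 1 := by
    have h0 := mul_ne_zero H.a_ne_zero H.mu_ne_zero
    rw [H.a_mul_mu] at h0 ⊢
    rw [chi_neg h1]
    exact chi_sq_sub_p_mul_sq (neg_ne_zero.1 h0)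
  rw [chi_mul] at h
  rcases chi_cases H.a_ne_zero with h' | h' <;> rw [h'] at h ⊢ <;> linarith

lemma near_mul (H : Normalized a d μ n) : Near (a * d) 1 := by
  rw [H.mul_eq]
  exact near_sub_of_lt (by simpa using H.norm_lt)

lemma chi_d (H : Normalized a d μ n) : chi d = chi a := by
  have h := H.near_mul.chi_eq
  rw [chi_one, chi_mul] at h
  rcases chi_cases H.a_ne_zero with h' | h' <;> rw [h'] at h ⊢ <;> linarith

lemma sub_eq (H : Normalized a d μ n) (k t : ℚ_[p]) :
    k * (t - a) * (t - d) - k * μ * t = k * ((t - 1) ^ 2 - p * n ^ 2) := by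
  rw [H.mu_eq]
  linear_combination k * H.mul_eq

/-- The point near `t = 0`. -/
lemma exists_on_p_mul_mu (hp : p ≠ 2) (h1 : chi (-1 : ℚ_[p]) = 1) (H : Normalized a d μ n)
    {κ : ℚ_[p]} (hκ : κ ≠ 0) :
    ∃ x y z, On (κ ^ 2) a d μ ((p : ℚ_[p]) * μ) x y z ∧ chi (z - y) = chi κ := by
  have hpμ : ‖p * μ‖ < 1 := (norm_p_mul_lt H.mu_ne_zero).trans_le H.norm_mu_le
  have hm : κ ^ 2 * μ * ((p : ℚ_[p]) * μ) = p * (κ * μ) ^ 2 := by ring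
  have h0 : κ * μ ≠ 0 := mul_ne_zero hκ H.mu_ne_zero
  have hq : Near (κ ^ 2 * ((p : ℚ_[p]) * μ - a) * ((p : ℚ_[p]) * μ - d)) (κ ^ 2) := by
    have h2 := ((near_sub_of_lt_right (H.norm_a ▸ hpμ)).mul_left (pow_ne_zero 2 hκ)).mul
      (near_sub_of_lt_right (H.norm_d ▸ hpμ))
    refine h2.trans ?_
    have h3 := H.near_mul.mul_left (pow_ne_zero 2 hκ)
    convert h3 using 1 <;> ring
  obtain ⟨x, y, z, hy, hz, h⟩ := exists_of_norm_lt_of_near_sq hp h1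
    (m := κ ^ 2 * μ * (p * μ)) (by rw [hm, chi_mul, chi_p h1, chi_sq h0, one_mul]) (by
      rw [hm]
      refine (norm_p_mul_lt (pow_ne_zero 2 h0)).trans_le ?_
      rw [norm_pow, norm_pow, norm_mul]
      gcongr
      exact mul_le_of_le_one_right (norm_nonneg _) H.norm_mu_le) hq
  exact ⟨x, y, z, ⟨hy, hz⟩, h⟩

lemma variesB_of_eq_sq (hp : p ≠ 2) (h1 : chi (-1 : ℚ_[p]) = 1) (H : Normalized a d μ n)
    {κ : ℚ_[p]} (hκ : κ ≠ 0) (ha : chi a = -1) : VariesB (κ ^ 2) a d μ := by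
  obtain ⟨x, y, z, hon, hc⟩ := H.exists_on_p_mul_mu hp h1 hκ
  have hp0 : (p : ℚ_[p]) ≠ 0 := p_ne_zero
  have hμ0 := H.mu_ne_zero
  have hpμ : ‖p * μ‖ < 1 := (norm_p_mul_lt H.mu_ne_zero).trans_le H.norm_mu_le
  set t := (p * μ)⁻¹ with ht
  have ht0 : t ≠ 0 := inv_ne_zero (mul_ne_zero hp0 hμ0)
  have ht1 : 1 < ‖t‖ := by
    rw [ht, norm_inv]
    exact (one_lt_inv₀ (norm_pos_iff.2 (mul_ne_zero hp0 hμ0))).2 hpμ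
  have hm : κ ^ 2 * μ * t = p * (κ / p) ^ 2 := by
    rw [ht]
    field_simp
  have hq : Near (κ ^ 2 * (t - a) * (t - d)) ((κ * t) ^ 2) := by
    have h2 := ((near_sub_of_lt (H.norm_a ▸ ht1 : ‖a‖ < ‖t‖)).mul_left (pow_ne_zero 2 hκ)).mul
      (near_sub_of_lt (H.norm_d ▸ ht1 : ‖d‖ < ‖t‖))
    convert h2 using 1
    ring
  obtain ⟨x', y', z', hy', hz', hc'⟩ := exists_of_norm_lt_of_near_sq hp h1
    (m := κ ^ 2 * μ * t) (by
      rw [hm, chi_mul, chi_p h1, chi_sq (div_ne_zero hκ hp0), one_mul]) (by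
      rw [mul_pow, mul_assoc, norm_mul, norm_mul (κ ^ 2), norm_mul, norm_pow t]
      refine mul_lt_mul_of_pos_left ?_ (norm_pos_iff.2 (pow_ne_zero 2 hκ))
      nlinarith [H.norm_mu_le]) hq
  refine ⟨_, x, y, z, _, x', y', z', hon, ⟨hy', hz'⟩, ?_⟩
  rw [chi_mul, hc, chi_mul _ μ, chi_p h1, H.chi_mu h1, ha, chi_mul, hc', chi_mul κ]
  have h2 := chi_mul_self hκ
  have h3 := chi_mul_self ht0
  linear_combination -h2 * chi t ^ 2 - h3

lemma variesA_of_eq_sq (hp : p ≠ 2) (h1 : chi (-1 : ℚ_[p]) = 1) (H : Normalized a d μ n)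
    {κ : ℚ_[p]} (hκ : κ ≠ 0) (ha : chi a = 1) : VariesA (κ ^ 2) a d μ := by
  obtain ⟨x, y, z, hon, hc⟩ := H.exists_on_p_mul_mu hp h1 hκ
  have hp0 : (p : ℚ_[p]) ≠ 0 := p_ne_zero
  have hμ0 := H.mu_ne_zero
  have hpμ : ‖p * μ‖ < 1 := (norm_p_mul_lt H.mu_ne_zero).trans_le H.norm_mu_le
  have hv : chi ((p : ℚ_[p]) * μ * ((p : ℚ_[p]) * μ - a)) = 1 := by
    rw [chi_mul, (near_sub_of_lt_right (H.norm_a ▸ hpμ) : Near ((p : ℚ_[p]) * μ - a) (-a)).chi_eq, chi_neg h1,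
      chi_mul, chi_p h1, H.chi_mu h1, ha]
    norm_num
  suffices h : ∃ t x y z, On (κ ^ 2) a d μ t x y z ∧ chi (t * (t - a)) = -1 by
    obtain ⟨t, x', y', z', hon', h'⟩ := h
    exact ⟨_, x, y, z, t, x', y', z', hon, hon', by rw [hv, h', one_mul]⟩
  have hκc : chi (κ ^ 2) = 1 := chi_sq hκ
  have hμc : chi μ = 1 := (H.chi_mu h1).trans ha
  have hdc : chi d = 1 := H.chi_d.trans ha
  obtain ⟨a', haa⟩ : ∃ a' : ℤ_[p], (a' : ℚ_[p]) = a := ⟨⟨a, H.norm_a.le⟩, rfl⟩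
  obtain ⟨d', hdd⟩ : ∃ d' : ℤ_[p], (d' : ℚ_[p]) = d := ⟨⟨d, H.norm_d.le⟩, rfl⟩
  have ha0 : PadicInt.toZMod a' ≠ 0 := fun h =>
    (toZMod_eq_zero_iff.1 h).ne (by rw [PadicInt.norm_def, haa, H.norm_a])
  have hd0 : PadicInt.toZMod d' ≠ 0 := fun h =>
    (toZMod_eq_zero_iff.1 h).ne (by rw [PadicInt.norm_def, hdd, H.norm_d])
  have had0 : PadicInt.toZMod a' * PadicInt.toZMod d' = 1 := by
    rw [← sub_eq_zero, ← map_mul, ← map_one (PadicInt.toZMod (p := p)), ← map_sub,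
      toZMod_eq_zero_iff, PadicInt.norm_def]
    push_cast
    rw [haa, hdd]
    simpa [Near] using H.near_mul
  have hχ1 : quadraticChar (ZMod p) (-1) = 1 := by
    have h := chi_coe (p := p) (S := -1) (by simp)
    push_cast at h
    rw [h1] at h
    simpa using h.symm
  have ha' := chi_coe ha0
  rw [haa, ha] at ha'
  have hd' := chi_coe hd0
  rw [hdd, hdc] at hd'
  by_cases hcase : PadicInt.toZMod a' = PadicInt.toZMod d' ∨
      quadraticChar (ZMod p) (PadicInt.toZMod a' - PadicInt.toZMod d') = 1
  · obtain ⟨s, hsa, hsd⟩ := exists_sq_sub_nonsquare (ringChar_zmod_ne_two hp) ha'.symm hd'.symm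
      (hcase.imp_right fun h => ⟨h, by rw [← neg_sub, ← neg_one_mul, map_mul, hχ1, h, one_mul]⟩)
    obtain ⟨S, rfl⟩ := exists_toZMod_eq s
    have hS : (S : ℚ_[p]) ≠ 0 := by
      intro h
      have : S = 0 := PadicInt.ext h
      rw [this, map_zero, zero_pow two_ne_zero, zero_sub, ← neg_one_mul, map_mul, hχ1, ← ha'] at hsa
      norm_num at hsa
    rw [← map_pow, ← map_sub] at hsa hsd
    have ea0 := ne_zero_of_quadraticChar_eq_neg_one hsa
    have ed0 := ne_zero_of_quadraticChar_eq_neg_one hsd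
    have ea := chi_coe ea0
    have ed := chi_coe ed0
    have na := norm_eq_one_of_toZMod_ne_zero ea0
    have nd := norm_eq_one_of_toZMod_ne_zero ed0
    push_cast at ea ed na nd
    rw [haa] at ea na
    rw [hdd] at ed nd
    rw [hsa] at ea
    rw [hsd] at ed
    have hqc : chi (κ ^ 2 * ((S : ℚ_[p]) ^ 2 - a) * ((S : ℚ_[p]) ^ 2 - d)) = 1 := by
      rw [chi_mul, chi_mul, hκc, ea, ed]
      norm_num
    have hqn : ‖κ ^ 2 * ((S : ℚ_[p]) ^ 2 - a) * ((S : ℚ_[p]) ^ 2 - d)‖ = ‖κ ^ 2‖ := by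
      rw [norm_mul, norm_mul, na, nd, mul_one, mul_one]
    obtain ⟨h, hh, hqh⟩ := exists_eq_sq_of_norm_eq hp h1 hqc hqn
    obtain ⟨x', y', z', hy', hz'⟩ := exists_of_norm_le_sq hp h1
      (m := κ ^ 2 * μ * (S : ℚ_[p]) ^ 2) (by
        rw [chi_mul, chi_mul, hκc, hμc, chi_sq hS]
        norm_num) hh (by
        rw [← hqh, hqn, mul_assoc, norm_mul, norm_mul μ, norm_pow (S : ℚ_[p])]
        refine mul_le_of_le_one_right (norm_nonneg _) ?_
        exact mul_le_one₀ H.norm_mu_le (by positivity) (pow_le_one₀ (norm_nonneg _) S.norm_le_one))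
    exact ⟨_, x', y', z', ⟨hy', hz'.trans hqh.symm⟩, by rw [chi_mul, ea, chi_sq hS, one_mul]⟩
  · push Not at hcase
    obtain ⟨hne, hχ⟩ := hcase
    have had' : PadicInt.toZMod (a' - d') ≠ 0 := by
      rw [map_sub]
      exact sub_ne_zero.2 hne
    have hadc : chi (a - d) = -1 := by
      have h2 := chi_coe had'
      push_cast at h2
      rw [haa, hdd] at h2
      rw [h2]
      rw [← map_sub] at hχ
      exact (quadraticChar_dichotomy had').resolve_left hχ
    have hadn : ‖a - d‖ = 1 := by
      have h2 := norm_eq_one_of_toZMod_ne_zero had'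
      push_cast at h2
      rwa [haa, hdd] at h2
    have ha1 : PadicInt.toZMod (a' - 1) ≠ 0 := by
      intro h2
      rw [map_sub, map_one, sub_eq_zero] at h2
      rw [h2, one_mul] at had0
      exact hne (h2.trans had0.symm)
    have hμn : ‖μ‖ = 1 := by
      have h2 := norm_eq_one_of_toZMod_ne_zero ha1
      push_cast at h2
      rw [haa] at h2
      rw [H.norm_mu, norm_pow, h2, one_pow]
      exact max_eq_left H.norm_lt.le
    set e := a - d with he
    have he0 : e ≠ 0 := ne_zero_of_chi_eq_neg_one hadc
    have hpe : ‖p * e‖ < 1 := hadn ▸ norm_p_mul_lt he0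
    have htn : Near (a + (p : ℚ_[p]) * e) a := near_add_of_lt (H.norm_a ▸ hpe)
    have hmc : chi (κ ^ 2 * μ * (a + (p : ℚ_[p]) * e)) = 1 := by
      rw [chi_mul, chi_mul, hκc, hμc, htn.chi_eq, ha]
      norm_num
    have hmn : ‖κ ^ 2 * μ * (a + p * e)‖ = ‖κ ^ 2‖ := by
      rw [norm_mul, norm_mul, hμn, htn.norm_eq, H.norm_a, mul_one, mul_one]
    obtain ⟨h, hh, hmh⟩ := exists_eq_sq_of_norm_eq hp h1 hmc hmn
    have hq : Near (κ ^ 2 * (a + (p : ℚ_[p]) * e - a) * (a + (p : ℚ_[p]) * e - d))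
        ((p : ℚ_[p]) * (κ * e) ^ 2) := by
      have h2 := (near_add_of_lt (norm_p_mul_lt he0)).mul_left (c := κ ^ 2 * (p * e)) (by positivity)
      convert h2 using 1
      · rw [he]
        ring
      · ring
    have hκe : κ * e ≠ 0 := mul_ne_zero hκ he0
    obtain ⟨x', y', z', hy', hz', -⟩ := exists_of_near_sq_of_norm_lt hp h1
      (q := κ ^ 2 * (a + p * e - a) * (a + p * e - d)) (h := h) (by
        rw [hq.chi_eq, chi_mul, chi_p h1, chi_sq hκe, one_mul]) (by
        rw [hq.norm_eq, ← hmh, hmn]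
        refine (norm_p_mul_lt (pow_ne_zero 2 hκe)).trans_le ?_
        rw [norm_pow, norm_mul, hadn, mul_one, norm_pow]) (Near.refl (pow_ne_zero 2 hh))
    refine ⟨_, x', y', z', ⟨hy'.trans hmh.symm, hz'⟩, ?_⟩
    rw [add_sub_cancel_left, chi_mul, htn.chi_eq, ha, chi_mul, chi_p h1, hadc]
    norm_num

lemma variesB_of_on (hp : p ≠ 2) (h1 : chi (-1 : ℚ_[p]) = 1) (H : Normalized a d μ n)
    {κ : ℚ_[p]} (hκ : κ ≠ 0) (han : ‖a - 1‖ = 1) {t x y z : ℚ_[p]}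
    (hon : On ((p : ℚ_[p]) * κ ^ 2) a d μ t x y z) : VariesB ((p : ℚ_[p]) * κ ^ 2) a d μ := by
  have hp0 : (p : ℚ_[p]) ≠ 0 := p_ne_zero
  obtain ⟨hy, hz⟩ := hon
  set k := (p : ℚ_[p]) * κ ^ 2 with hk
  have hk0 : k ≠ 0 := by positivity
  have hkpos : 0 < ‖k‖ := norm_pos_iff.2 hk0
  have hμn : ‖μ‖ = 1 := by
    rw [H.norm_mu, norm_pow, han, one_pow]
    exact max_eq_left H.norm_lt.le
  have hmn : ‖k * μ * t‖ = ‖k‖ * ‖t‖ := by rw [norm_mul, norm_mul, hμn, mul_one]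
  have hxm : ‖p * x ^ 2‖ ≤ ‖k‖ * ‖t‖ := by
    rw [← hmn, ← hy, norm_sq_sub_p_mul_sq]
    exact le_max_right _ _
  have ht : ‖t‖ = 1 := by
    rcases lt_trichotomy ‖t‖ 1 with ht | ht | ht
    · have hq : ‖k * (t - a) * (t - d)‖ = ‖p * κ ^ 2‖ := by
        rw [norm_mul, norm_mul, (near_sub_of_lt_right (H.norm_a ▸ ht)).norm_eq,
          (near_sub_of_lt_right (H.norm_d ▸ ht)).norm_eq, norm_neg, norm_neg, H.norm_a, H.norm_d,
          mul_one, mul_one]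
      obtain ⟨-, h⟩ := norm_lt_and_norm_eq_of_odd
        (norm_pos_iff.1 (by rw [hq]; exact hkpos)) hz hq
      rw [h, hq, ← hk] at hxm
      exact absurd hxm (not_le.2 (mul_lt_of_lt_one_right hkpos ht))
    · exact ht
    · have hq : ‖k * (t - a) * (t - d)‖ = ‖k‖ * ‖t‖ ^ 2 := by
        rw [norm_mul, norm_mul, (near_sub_of_lt (H.norm_a ▸ ht : ‖a‖ < ‖t‖)).norm_eq,
          (near_sub_of_lt (H.norm_d ▸ ht : ‖d‖ < ‖t‖)).norm_eq]
        ring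
      obtain ⟨-, h⟩ := norm_lt_and_norm_eq_of_odd (r := κ * t)
        (norm_pos_iff.1 (by rw [hq]; positivity)) hz
        (by rw [hq, mul_pow, ← mul_assoc, ← hk, norm_mul k, norm_pow t])
      rw [h, hq] at hxm
      have h2 := le_of_mul_le_mul_left hxm hkpos
      nlinarith
  have ht0 : t ≠ 0 := norm_pos_iff.1 (by rw [ht]; exact one_pos)
  have hm0 : k * μ * t ≠ 0 := mul_ne_zero (mul_ne_zero hk0 H.mu_ne_zero) ht0
  have hmk : ‖k * μ * t‖ = ‖p * κ ^ 2‖ := by rw [hmn, ht, mul_one]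
  have hmc : chi (k * μ * t) = 1 := by
    rw [← hy] at hm0 ⊢
    exact chi_sq_sub_p_mul_sq hm0
  obtain ⟨r, -, hr⟩ := exists_eq_p_mul_sq_of_norm_eq hp h1 hmc hmk
  obtain ⟨hylt, -⟩ := norm_lt_and_norm_eq_of_odd hm0 hy hmk
  refine variesB_of_near hp h1 hr ?_
  rw [Near]
  have e : k * (t - a) * (t - d) - k * μ * t = z ^ 2 - y ^ 2 := by
    rw [← hz, ← hy]
    ring
  rw [e]
  refine (norm_sub_le_max _ _).trans_lt (max_lt ?_ hylt)
  have hqle : ‖k * (t - a) * (t - d)‖ ≤ ‖k * μ * t‖ := by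
    rw [hmk, norm_mul, norm_mul, mul_assoc, ← hk]
    refine mul_le_of_le_one_right (norm_nonneg _) (mul_le_one₀ ?_ (norm_nonneg _) ?_)
    · exact (norm_sub_le_max _ _).trans (by rw [ht, H.norm_a, max_self])
    · exact (norm_sub_le_max _ _).trans (by rw [ht, H.norm_d, max_self])
  have hzle : ‖z ^ 2‖ ≤ ‖k * μ * t‖ := by
    refine le_trans ?_ hqle
    rw [← hz, norm_sq_sub_p_mul_sq]
    exact le_max_left _ _
  refine lt_of_le_of_ne hzle fun h => ?_
  refine norm_sq_ne_norm_p_mul_sq (p := p) (s := z) (t := κ) ?_ (h.trans hmk)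
  rintro rfl
  rw [zero_pow two_ne_zero, norm_zero] at h
  exact hm0 (norm_eq_zero.1 h.symm)

lemma variesB_of_norm_lt (hp : p ≠ 2) (h1 : chi (-1 : ℚ_[p]) = 1) (H : Normalized a d μ n)
    {κ : ℚ_[p]} (hκ : κ ≠ 0) (han : ‖a - 1‖ < 1) (hna : ‖p * n ^ 2‖ < ‖(a - 1) ^ 2‖) :
    VariesB ((p : ℚ_[p]) * κ ^ 2) a d μ := by
  have hp0 : (p : ℚ_[p]) ≠ 0 := p_ne_zero
  have hk0 : (p : ℚ_[p]) * κ ^ 2 ≠ 0 := by positivity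
  have hac : chi a = 1 := by
    rw [← chi_one (p := p)]
    exact Near.chi_eq (by simpa [Near] using han)
  have hμn : ‖μ‖ = ‖(a - 1) ^ 2‖ := by
    rw [H.norm_mu]
    exact max_eq_left hna.le
  obtain ⟨r, -, hr⟩ := exists_eq_p_mul_sq_of_norm_eq hp h1 (w := p * κ ^ 2 * μ * 1)
    (r := κ * (a - 1)) (by
      rw [mul_one, chi_mul, chi_mul, chi_p h1, chi_sq hκ, H.chi_mu h1, hac]
      norm_num) (by rw [mul_one, norm_mul, hμn, mul_pow, ← mul_assoc, norm_mul _ ((a - 1) ^ 2)])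
  refine variesB_of_near hp h1 hr ?_
  rw [Near, H.sub_eq, mul_one, norm_mul, norm_mul _ μ]
  refine mul_lt_mul_of_pos_left ?_ (norm_pos_iff.2 hk0)
  rw [sub_self, zero_pow two_ne_zero, zero_sub, norm_neg, hμn]
  exact hna

lemma variesA_of_norm_lt (hp : p ≠ 2) (h1 : chi (-1 : ℚ_[p]) = 1) (H : Normalized a d μ n)
    {κ : ℚ_[p]} (hκ : κ ≠ 0) (hna : ‖(a - 1) ^ 2‖ < ‖p * n ^ 2‖) :
    VariesA ((p : ℚ_[p]) * κ ^ 2) a d μ := by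
  have hp0 : (p : ℚ_[p]) ≠ 0 := p_ne_zero
  have hn0 := H.n_ne_zero
  have h20 : (2 : ℚ_[p]) ≠ 0 := by norm_num
  have hk0 : (p : ℚ_[p]) * κ ^ 2 ≠ 0 := by positivity
  have hnpos : 0 < ‖(p : ℚ_[p]) * n ^ 2‖ := norm_pos_iff.2 (by positivity)
  have hN := H.norm_lt
  have ha1 : ‖a - 1‖ < 1 := by
    rw [norm_pow] at hna
    nlinarith [norm_nonneg (a - 1)]
  have hac : chi a = 1 := by
    rw [← chi_one (p := p)]
    exact Near.chi_eq (by simpa [Near] using ha1)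
  have hμn : ‖μ‖ = ‖p * n ^ 2‖ := by
    rw [H.norm_mu]
    exact max_eq_right hna.le
  have hd1 : ‖d - 1‖ ^ 2 < ‖p * n ^ 2‖ := by
    have e : a * (d - 1) = -((p : ℚ_[p]) * n ^ 2) - (a - 1) := by linear_combination H.mul_eq
    have h : ‖d - 1‖ ≤ max ‖p * n ^ 2‖ ‖a - 1‖ := by
      have := norm_sub_le_max (-((p : ℚ_[p]) * n ^ 2)) (a - 1)
      rwa [← e, norm_mul, H.norm_a, one_mul, norm_neg] at this
    rw [norm_pow] at hna
    rcases le_max_iff.1 h with h | h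
    · nlinarith [norm_nonneg (d - 1)]
    · nlinarith [norm_nonneg (d - 1)]
  have hd1' : ‖d - 1‖ < 1 := by nlinarith [norm_nonneg (d - 1)]
  set ε := (a - d) / 2 with hε
  have hε0 : ε ≠ 0 := div_ne_zero (sub_ne_zero.2 H.ne) h20
  have hεn : ‖ε‖ ≤ max ‖a - 1‖ ‖d - 1‖ := by
    rw [hε, norm_div, norm_two hp, div_one, ← sub_sub_sub_cancel_right a d 1]
    exact norm_sub_le_max _ _
  have hε2 : ‖ε‖ ^ 2 < ‖p * n ^ 2‖ := by
    rw [norm_pow] at hna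
    rcases le_max_iff.1 hεn with h | h
    · nlinarith [norm_nonneg ε]
    · nlinarith [norm_nonneg ε]
  have hε1 : ‖ε‖ < 1 := hεn.trans_lt (max_lt ha1 hd1')
  have key : ∀ τ : ℚ_[p], ‖τ‖ ≤ ‖ε‖ → chi (τ ^ 2 - ε ^ 2) = 1 →
      ∃ t x y z, On ((p : ℚ_[p]) * κ ^ 2) a d μ t x y z ∧ chi (t * (t - a)) = chi (τ - ε) := by
    intro τ hτ hc
    set t := (a + d) / 2 + τ with ht
    have hta : t - a = τ - ε := by rw [ht, hε]; ring
    have htd : t - d = τ + ε := by rw [ht, hε]; ring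
    have ht1 : Near t 1 := by
      have e : t - 1 = ((a - 1) + (d - 1)) / 2 + τ := by rw [ht]; ring
      rw [Near, e, norm_one]
      refine (Padic.nonarchimedean _ _).trans_lt (max_lt ?_ (hτ.trans_lt hε1))
      rw [norm_div, norm_two hp, div_one]
      exact (Padic.nonarchimedean _ _).trans_lt (max_lt ha1 hd1')
    have htc : chi t = 1 := ht1.chi_eq.trans chi_one
    have htn : ‖t‖ = 1 := ht1.norm_eq.trans norm_one
    have hmn : ‖p * κ ^ 2 * μ * t‖ = ‖(p * κ * n) ^ 2‖ := by
      rw [norm_mul, htn, mul_one, norm_mul, hμn, ← norm_mul]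
      congr 1
      ring
    obtain ⟨h, hh, hmh⟩ := exists_eq_sq_of_norm_eq hp h1 (by
      rw [chi_mul, chi_mul, chi_mul, chi_p h1, chi_sq hκ, H.chi_mu h1, hac, htc]
      norm_num) hmn
    have hq : p * κ ^ 2 * (t - a) * (t - d) = p * κ ^ 2 * (τ ^ 2 - ε ^ 2) := by
      rw [hta, htd]
      ring
    obtain ⟨x, y, z, hy, hz, -⟩ := exists_of_near_sq_of_norm_lt hp h1
      (q := p * κ ^ 2 * (t - a) * (t - d)) (h := h) (by
        rw [hq, chi_mul, chi_mul, chi_p h1, chi_sq hκ, hc]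
        norm_num) (by
        rw [← hmh, norm_mul _ t, htn, mul_one, hq, norm_mul, norm_mul _ μ, hμn]
        refine mul_lt_mul_of_pos_left ?_ (norm_pos_iff.2 hk0)
        refine (norm_sub_le_max _ _).trans_lt (max_lt ?_ ?_)
        · rw [norm_pow]
          exact (pow_le_pow_left₀ (norm_nonneg _) hτ 2).trans_lt hε2
        · rwa [norm_pow]) (Near.refl (pow_ne_zero 2 hh))
    exact ⟨t, x, y, z, ⟨hy.trans hmh.symm, hz⟩, by rw [chi_mul, htc, one_mul, hta]⟩
  obtain ⟨t, x, y, z, hon, hc⟩ := key 0 (by simp) (by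
    rw [zero_pow two_ne_zero, zero_sub, chi_neg h1, chi_sq hε0])
  suffices h : ∃ τ : ℚ_[p], ‖τ‖ ≤ ‖ε‖ ∧ chi (τ ^ 2 - ε ^ 2) = 1 ∧ chi (τ - ε) = -chi ε by
    obtain ⟨τ, h₁, h₂, h₃⟩ := h
    obtain ⟨t', x', y', z', hon', hc'⟩ := key τ h₁ h₂
    refine ⟨t, x, y, z, t', x', y', z', hon, hon', ?_⟩
    rw [hc, hc', h₃, zero_sub, chi_neg h1]
    linear_combination -chi_mul_self hε0
  rcases chi_cases h20 with h2 | h2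
  · have hm := chi_coe (p := p) (S := -1) (by simp)
    have h2' := chi_coe (p := p) (S := 2) (by
      rw [map_ofNat]
      exact Ring.two_ne_zero (ringChar_zmod_ne_two hp))
    push_cast at hm h2'
    rw [h1, map_neg, map_one] at hm
    rw [map_ofNat] at h2'
    have h2'' : ((2 : ℤ_[p]) : ℚ_[p]) = 2 := by norm_cast
    obtain ⟨g, hg, hg2⟩ := exists_consecutive_nonsquares (ringChar_zmod_ne_two hp) hm.symm
      (h2'.symm.trans ((congrArg chi h2'').trans h2))
    obtain ⟨G, rfl⟩ := exists_toZMod_eq g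
    have e1 := chi_coe (ne_zero_of_quadraticChar_eq_neg_one hg)
    have e3 : PadicInt.toZMod G + 2 = PadicInt.toZMod (G + 2) := by rw [map_add, map_ofNat]
    rw [e3] at hg2
    have e2 := chi_coe (ne_zero_of_quadraticChar_eq_neg_one hg2)
    push_cast at e2
    rw [hg] at e1
    rw [hg2, h2''] at e2
    set γ := (G : ℚ_[p]) with hγ
    have hγ1 : ‖γ‖ ≤ 1 := G.norm_le_one
    refine ⟨ε * (1 + γ), ?_, ?_, ?_⟩
    · rw [norm_mul]
      refine mul_le_of_le_one_right (norm_nonneg _) ?_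
      exact (Padic.nonarchimedean _ _).trans (max_le norm_one.le hγ1)
    · have e : (ε * (1 + γ)) ^ 2 - ε ^ 2 = ε ^ 2 * γ * (γ + 2) := by ring
      rw [e, chi_mul, chi_mul, chi_sq hε0, e1, e2]
      norm_num
    · have e : ε * (1 + γ) - ε = ε * γ := by ring
      rw [e, chi_mul, e1, mul_neg_one]
  · have hn2 : ‖(2 : ℚ_[p]) * (p * ε)‖ ≤ ‖ε‖ := by
      rw [norm_mul, norm_two hp, one_mul]
      exact (norm_p_mul_lt hε0).le
    refine ⟨ε + 2 * (p * ε), ?_, ?_, ?_⟩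
    · exact (Padic.nonarchimedean _ _).trans (max_le le_rfl hn2)
    · have e : (ε + 2 * (p * ε)) ^ 2 - ε ^ 2 = p * (2 * ε) ^ 2 * (1 + p) := by ring
      have h3 : Near (1 + (p : ℚ_[p])) 1 := near_add_of_lt (by
        rw [norm_one]
        exact Padic.norm_p_lt_one)
      rw [e, chi_mul, chi_mul, chi_p h1, chi_sq (mul_ne_zero h20 hε0), h3.chi_eq, chi_one]
      norm_num
    · rw [add_sub_cancel_left, chi_mul, chi_mul, h2, chi_p h1]
      ring

lemma variesB_or_variesA (hp : p ≠ 2) (h1 : chi (-1 : ℚ_[p]) = 1) (H : Normalized a d μ n)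
    {k : ℚ_[p]} (hk : chi k = 1)
    (hloc : (∃ r, k = r ^ 2) ∨ ∃ t x y z, On k a d μ t x y z) :
    VariesB k a d μ ∨ VariesA k a d μ := by
  obtain ⟨κ, hκ, rfl | rfl⟩ := eq_sq_or_p_mul_sq hp h1 hk
  · rcases chi_cases H.a_ne_zero with h | h
    · exact Or.inr (H.variesA_of_eq_sq hp h1 hκ h)
    · exact Or.inl (H.variesB_of_eq_sq hp h1 hκ h)
  · rcases lt_trichotomy ‖(a - 1) ^ 2‖ ‖p * n ^ 2‖ with h | h | h
    · exact Or.inr (H.variesA_of_norm_lt hp h1 hκ h)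
    · refine absurd h (norm_sq_ne_norm_p_mul_sq fun h0 => ?_)
      rw [h0, zero_pow two_ne_zero, norm_zero, eq_comm, norm_eq_zero] at h
      exact mul_ne_zero p_ne_zero (pow_ne_zero 2 H.n_ne_zero) h
    · left
      rcases H.norm_a_sub_one_le.lt_or_eq with ha | ha
      · exact H.variesB_of_norm_lt hp h1 hκ ha h
      · rcases hloc with ⟨r, hr⟩ | ⟨t, x, y, z, hon⟩
        · refine absurd (congrArg norm hr.symm) (norm_sq_ne_norm_p_mul_sq ?_)
          rintro rfl
          exact ne_zero_of_chi_eq_one hk (by simpa using hr)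
        · exact H.variesB_of_on hp h1 hκ ha hon

end Normalized

/-- On the pair of conics one of the two functions takes both values. -/
theorem variesB_or_variesA (hp : p ≠ 2) (h1 : chi (-1 : ℚ_[p]) = 1) {k a d μ c n : ℚ_[p]}
    (hk : chi k = 1) (ha : a ≠ 0) (hd : d ≠ 0) (hμ : μ ≠ 0) (hn0 : n ≠ 0) (hne : a ≠ d)
    (hc : 2 * c = a + d + μ) (hn : c ^ 2 - p * n ^ 2 = a * d)
    (hloc : (∃ r, k = r ^ 2) ∨ ∃ t x y z, On k a d μ t x y z) :
    VariesB k a d μ ∨ VariesA k a d μ := by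
  by_cases had : ‖a‖ = ‖d‖
  swap
  · exact Or.inl (variesB_of_norm_ne hp h1 hk ha hd hμ hc hn had)
  have hcn : ‖c‖ = ‖a‖ := by
    have h := norm_sq_sub_p_mul_sq c n
    rw [hn, norm_mul, ← had, ← sq, ← norm_pow] at h
    rcases max_choice ‖c ^ 2‖ ‖(p : ℚ_[p]) * n ^ 2‖ with h' | h' <;> rw [h'] at h
    · rw [norm_pow, norm_pow] at h
      exact (pow_left_inj₀ (norm_nonneg _) (norm_nonneg _) two_ne_zero).1 h.symm
    · exact absurd h (norm_sq_ne_norm_p_mul_sq ha)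
  have hc0 : c ≠ 0 := norm_pos_iff.1 (by rw [hcn]; exact norm_pos_iff.2 ha)
  have H : Normalized (a / c) (d / c) (μ / c) (n / c) := by
    refine ⟨?_, ?_, ?_, ?_, ?_, ?_, ?_⟩
    · rw [norm_div, hcn]
      exact div_self (norm_ne_zero_iff.2 ha)
    · rw [norm_div, hcn, had]
      exact div_self (norm_ne_zero_iff.2 hd)
    · field_simp
      linear_combination -hn
    · field_simp
      linear_combination -hc
    · exact div_ne_zero hn0 hc0
    · exact div_ne_zero hμ hc0
    · intro h
      exact hne ((div_left_inj' hc0).1 h)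
  have hon : ∀ {t x y z : ℚ_[p]}, On k a d μ t x y z →
      On (k * c ^ 2) (a / c) (d / c) (μ / c) (t / c) x y z := by
    rintro t x y z ⟨hy, hz⟩
    refine ⟨hy.trans ?_, hz.trans ?_⟩ <;> field_simp
  have hon' : ∀ {t x y z : ℚ_[p]}, On (k * c ^ 2) (a / c) (d / c) (μ / c) t x y z →
      On k a d μ (c * t) x y z := by
    rintro t x y z ⟨hy, hz⟩
    refine ⟨hy.trans ?_, hz.trans ?_⟩ <;> field_simp
  have hcc := chi_mul_self hc0
  rcases H.variesB_or_variesA hp h1 (k := k * c ^ 2) (by rw [chi_mul, hk, chi_sq hc0, one_mul])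
    (hloc.imp (fun ⟨r, hr⟩ => ⟨r * c, by rw [hr]; ring⟩)
      fun ⟨t, x, y, z, h⟩ => ⟨_, x, y, z, hon h⟩) with h | h
  · obtain ⟨t, x, y, z, t', x', y', z', h, h', hv⟩ := h
    refine Or.inl ⟨_, x, y, z, _, x', y', z', hon' h, hon' h', ?_⟩
    rw [mul_assoc, mul_assoc, chi_mul c, chi_mul c]
    linear_combination hv + (chi (t * (z - y)) * chi (t' * (z' - y'))) * hcc
  · obtain ⟨t, x, y, z, t', x', y', z', h, h', hv⟩ := h
    refine Or.inr ⟨_, x, y, z, _, x', y', z', hon' h, hon' h', ?_⟩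
    have e : ∀ t : ℚ_[p], c * t * (c * t - a) = c ^ 2 * (t * (t - a / c)) := by
      intro t
      field_simp
    rw [e, e, chi_mul, chi_mul (c ^ 2), chi_sq hc0, one_mul, one_mul, hv]

lemma eq_zero_of_sq_sub_p_mul_sq_eq_zero {s t : ℚ_[p]} (h : s ^ 2 - p * t ^ 2 = 0) :
    s = 0 ∧ t = 0 := by
  have hm := norm_sq_sub_p_mul_sq s t
  rw [h, norm_zero] at hm
  have h₁ := norm_le_zero_iff.1 ((le_max_left _ _).trans hm.ge)
  have h₂ := norm_le_zero_iff.1 ((le_max_right _ _).trans hm.ge)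
  exact ⟨pow_eq_zero_iff two_ne_zero |>.1 h₁,
    pow_eq_zero_iff two_ne_zero |>.1 ((mul_eq_zero.1 h₂).resolve_left p_ne_zero)⟩

lemma surjInvAt_of_chi (hp : p ≠ 2) {A B C D M : ℤ}
    {f : ℚ_[p] → ℚ_[p] → ℚ_[p] → ℚ_[p] → ℚ_[p] → ℚ_[p]} {u v x y z u' v' x' y' z' : ℚ_[p]}
    (h : IsQpPoint p A B C D M u v x y z) (h' : IsQpPoint p A B C D M u' v' x' y' z')
    (hf : chi (f u v x y z) * chi (f u' v' x' y' z') = -1) : SurjInvAt p A B C D M f := by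
  have h0 : f u v x y z ≠ 0 := fun h => by simp [h] at hf
  have h0' : f u' v' x' y' z' ≠ 0 := fun h => by simp [h] at hf
  rcases chi_cases h0 with hc | hc <;> rw [hc] at hf
  · refine ⟨u, v, x, y, z, u', v', x', y', z', h, h', h0, h0',
      (exists_eq_iff_chi hp h0).2 hc, fun s t hst => ?_⟩
    rw [(exists_eq_iff_chi hp h0').1 ⟨s, t, hst⟩] at hf
    norm_num at hf
  · refine ⟨u', v', x', y', z', u, v, x, y, z, h', h, h0', h0,
      (exists_eq_iff_chi hp h0').2 (by linarith), fun s t hst => ?_⟩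
    rw [(exists_eq_iff_chi hp h0).1 ⟨s, t, hst⟩] at hc
    norm_num at hc

section Point

variable {A B C D M N : ℤ} {u v x y z : ℚ_[p]}

lemma isQpPoint_neg_y (h : IsQpPoint p A B C D M u v x y z) :
    IsQpPoint p A B C D M u v x (-y) z :=
  ⟨by simpa using h.1, by rw [neg_sq]; exact h.2.1, h.2.2⟩

lemma isQpPoint_neg_z (h : IsQpPoint p A B C D M u v x y z) :
    IsQpPoint p A B C D M u v x y (-z) :=
  ⟨by simpa using h.1, h.2.1, by rw [neg_sq]; exact h.2.2⟩

lemma u_ne_zero_or_v_ne_zero (h : IsQpPoint p A B C D M u v x y z) : u ≠ 0 ∨ v ≠ 0 := by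
  by_contra! hc
  obtain ⟨rfl, rfl⟩ := hc
  obtain ⟨h0, hy, hz⟩ := h
  obtain ⟨rfl, rfl⟩ := eq_zero_of_sq_sub_p_mul_sq_eq_zero (hy.trans (by ring))
  obtain ⟨rfl, -⟩ := eq_zero_of_sq_sub_p_mul_sq_eq_zero (hz.trans (by ring))
  simp at h0

lemma mul_sq_sub_sq_eq
    (hC1 : ((A : ℚ_[p]) * D + B * C - M) ^ 2 - 4 * A * B * C * D = p * (N : ℚ_[p]) ^ 2)
    (h : IsQpPoint p A B C D M u v x y z) :
    (A : ℚ_[p]) * C * ((z - y) * (z + y)) =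
      ((A : ℚ_[p]) * C * u + (A * D + B * C - M) * v / 2) ^ 2 - p * (N * v / 2) ^ 2 := by
  linear_combination (A : ℚ_[p]) * C * (h.2.2 - h.2.1) - v ^ 2 / 4 * hC1

lemma mul_sq_sub_sq_ne_zero
    (hC1 : ((A : ℚ_[p]) * D + B * C - M) ^ 2 - 4 * A * B * C * D = p * (N : ℚ_[p]) ^ 2)
    (hA : (A : ℚ_[p]) ≠ 0) (hC : (C : ℚ_[p]) ≠ 0) (hN : (N : ℚ_[p]) ≠ 0)
    (h : IsQpPoint p A B C D M u v x y z) :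
    (A : ℚ_[p]) * C * ((z - y) * (z + y)) ≠ 0 := by
  rw [mul_sq_sub_sq_eq hC1 h]
  intro h0
  obtain ⟨hs, ht⟩ := eq_zero_of_sq_sub_p_mul_sq_eq_zero h0
  have hv : v = 0 := by simpa [hN] using ht
  have hu : u = 0 := by simpa [hv, hA, hC] using hs
  exact (u_ne_zero_or_v_ne_zero h).elim (· hu) (· hv)

/-- Two points with the same `u`, `v` on which `z - y` changes its norm residue symbol. -/
lemma surjInvAt_of_chi_sub (hp : p ≠ 2) (hB : (B : ℚ_[p]) ≠ 0) {x' y' z' : ℚ_[p]}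
    (h : IsQpPoint p A B C D M u v x y z) (h' : IsQpPoint p A B C D M u v x' y' z')
    (hc : chi (z - y) * chi (z' - y') = -1) :
    SurjInvAt p A B C D M (fun u _ _ y z => u * (z - y)) ∨
    SurjInvAt p A B C D M
      (fun u v _ y z => ((A : ℚ_[p]) * u + (B : ℚ_[p]) * v) * (z - y)) := by
  have key : ∀ w : ℚ_[p], w ≠ 0 → chi (w * (z - y)) * chi (w * (z' - y')) = -1 := by
    intro w hw
    rw [chi_mul, chi_mul]
    linear_combination hc + chi (z - y) * chi (z' - y') * chi_mul_self hw
  by_cases hu : u = 0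
  · have hv := (u_ne_zero_or_v_ne_zero h).resolve_left (not_not.2 hu)
    refine Or.inr (surjInvAt_of_chi hp h h' (key _ ?_))
    rw [hu, mul_zero, zero_add]
    exact mul_ne_zero hB hv
  · exact Or.inl (surjInvAt_of_chi hp h h' (key _ hu))

end Point

end PadicNormResidue

open PadicNormResidue in
/-- Assuming (C1), (C2) and that `X := X_{p,A,B,C,D,M,N}` has a `ℚ_p`-point,
the invariant map at `p` of at least one of the three classes
`𝒜 = (p, u/(Au+Bv))`, `ℬ = (p, (z−y)/u)`, `𝒞 = (p, (Au+Bv)/(z−y))` is surjective. -/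
theorem stmt_3
    (p : ℕ) [Fact p.Prime] (hpodd : p ≠ 2)
    (A B C D M N : ℤ)
    (hC1 : (A * D + B * C - M) ^ 2 - 4 * A * B * C * D = (p : ℤ) * N ^ 2)
    (hC2 : N * M * (A * D - B * C) ≠ 0)
    (hloc : ∃ u v x y z : ℚ_[p], IsQpPoint p A B C D M u v x y z) :
    SurjInvAt p A B C D M (fun u v _ _ _ => u * ((A : ℚ_[p]) * u + (B : ℚ_[p]) * v)) ∨
    SurjInvAt p A B C D M (fun u _ _ y z => u * (z - y)) ∨
    SurjInvAt p A B C D M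
      (fun u v _ y z => ((A : ℚ_[p]) * u + (B : ℚ_[p]) * v) * (z - y)) := by
  obtain ⟨u, v, x, y, z, hP⟩ := hloc
  have hN : (N : ℚ_[p]) ≠ 0 := Int.cast_ne_zero.2 fun h => hC2 (by simp [h])
  have hM : (M : ℚ_[p]) ≠ 0 := Int.cast_ne_zero.2 fun h => hC2 (by simp [h])
  have hdet : (A : ℚ_[p]) * D - B * C ≠ 0 := by
    have : A * D - B * C ≠ 0 := fun h => hC2 (by simp [h])
    exact_mod_cast this
  have hC1' : ((A : ℚ_[p]) * D + B * C - M) ^ 2 - 4 * A * B * C * D = p * (N : ℚ_[p]) ^ 2 := by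
    exact_mod_cast congrArg (Int.cast : ℤ → ℚ_[p]) hC1
  have hABCD : (A : ℚ_[p]) * B * C * D ≠ 0 := by
    intro h
    refine hN (eq_zero_of_sq_sub_p_mul_sq_eq_zero
      (s := (A : ℚ_[p]) * (D : ℚ_[p]) + (B : ℚ_[p]) * (C : ℚ_[p]) - (M : ℚ_[p]))
      (t := (N : ℚ_[p])) ?_).2
    linear_combination hC1' + 4 * h
  have hD := right_ne_zero_of_mul hABCD
  have hC := right_ne_zero_of_mul (left_ne_zero_of_mul hABCD)
  have hB := right_ne_zero_of_mul (left_ne_zero_of_mul (left_ne_zero_of_mul hABCD))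
  have hA := left_ne_zero_of_mul (left_ne_zero_of_mul (left_ne_zero_of_mul hABCD))
  have hne := mul_sq_sub_sq_ne_zero hC1' hA hC hN hP
  have hzy : z - y ≠ 0 := left_ne_zero_of_mul (right_ne_zero_of_mul hne)
  have hchi : chi ((A : ℚ_[p]) * (C : ℚ_[p])) * (chi (z - y) * chi (z + y)) = 1 := by
    rw [← chi_mul (z - y), ← chi_mul]
    rw [mul_sq_sub_sq_eq hC1' hP] at hne ⊢
    exact chi_sq_sub_p_mul_sq hne
  rcases chi_cases (neg_ne_zero.2 (one_ne_zero (α := ℚ_[p]))) with h1 | h1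
  swap
  · right
    refine surjInvAt_of_chi_sub hpodd hB hP (isQpPoint_neg_z (isQpPoint_neg_y hP)) ?_
    have e : -z - -y = -1 * (z - y) := by ring
    rw [e, chi_mul, h1]
    linear_combination -chi_mul_self hzy
  rcases chi_cases (mul_ne_zero hA hC) with hk | hk
  swap
  · right
    refine surjInvAt_of_chi_sub hpodd hB hP (isQpPoint_neg_y hP) ?_
    rw [hk] at hchi
    rw [sub_neg_eq_add]
    linarith
  have h20 : (2 : ℚ_[p]) ≠ 0 := by norm_num
  have hpoint : ∀ {t x y z : ℚ_[p]},
      On ((A : ℚ_[p]) * (C : ℚ_[p])) (-(B : ℚ_[p]) / (A : ℚ_[p])) (-(D : ℚ_[p]) / (C : ℚ_[p]))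
        ((M : ℚ_[p]) / ((A : ℚ_[p]) * (C : ℚ_[p]))) t x y z →
      IsQpPoint p A B C D M t 1 x y z := by
    rintro t x y z ⟨hy, hz⟩
    refine ⟨by simp, hy.trans ?_, hz.trans ?_⟩
    · field_simp
    · field_simp
      ring
  have hV := variesB_or_variesA hpodd h1 (k := (A : ℚ_[p]) * (C : ℚ_[p]))
    (a := -(B : ℚ_[p]) / (A : ℚ_[p])) (d := -(D : ℚ_[p]) / (C : ℚ_[p]))
    (μ := (M : ℚ_[p]) / ((A : ℚ_[p]) * (C : ℚ_[p])))
    (c := ((M : ℚ_[p]) - (A : ℚ_[p]) * (D : ℚ_[p]) - (B : ℚ_[p]) * (C : ℚ_[p])) /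
      (2 * ((A : ℚ_[p]) * (C : ℚ_[p]))))
    (n := (N : ℚ_[p]) / (2 * ((A : ℚ_[p]) * (C : ℚ_[p]))))
    hk (div_ne_zero (neg_ne_zero.2 hB) hA) (div_ne_zero (neg_ne_zero.2 hD) hC)
    (div_ne_zero hM (mul_ne_zero hA hC))
    (div_ne_zero hN (mul_ne_zero h20 (mul_ne_zero hA hC)))
    (by
      intro h
      rw [div_eq_div_iff hA hC] at h
      exact hdet (by linear_combination h))
    (by
      field_simp
      ring)
    (by
      field_simp
      linear_combination hC1')
    (by
      obtain ⟨-, hy, hz⟩ := id hP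
      by_cases hv : v = 0
      · left
        have hu := (u_ne_zero_or_v_ne_zero hP).resolve_right (not_not.2 hv)
        subst hv
        obtain ⟨-, rfl⟩ := eq_zero_of_sq_sub_p_mul_sq_eq_zero (hy.trans (mul_zero _))
        refine ⟨z / u, ?_⟩
        field_simp
        linear_combination -hz
      · right
        refine ⟨u / v, x / v, y / v, z / v, ?_, ?_⟩
        · field_simp
          linear_combination hy
        · field_simp
          linear_combination hz)
  rcases hV with ⟨t, x, y, z, t', x', y', z', h, h', hc⟩ | ⟨t, x, y, z, t', x', y', z', h, h', hc⟩
  · exact Or.inr (Or.inl (surjInvAt_of_chi hpodd (hpoint h) (hpoint h') hc))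
  · refine Or.inl (surjInvAt_of_chi hpodd (hpoint h) (hpoint h') ?_)
    have e : ∀ t : ℚ_[p], t * ((A : ℚ_[p]) * t + (B : ℚ_[p]) * 1) =
        (A : ℚ_[p]) * (t * (t - -(B : ℚ_[p]) / (A : ℚ_[p]))) := by
      intro t
      field_simp
      ring
    rw [e, e, chi_mul, chi_mul (A : ℚ_[p])]
    linear_combination hc +
      chi (t * (t - -(B : ℚ_[p]) / (A : ℚ_[p]))) *
        chi (t' * (t' - -(B : ℚ_[p]) / (A : ℚ_[p]))) * chi_mul_self hA
end

section
/- Let p be a prime with p ≡ 1 (mod 4) and let a, b be nonzero squares in F_p. Then S(a,b) contains exactly one element x with χ(x) = 0 (namely |S(a,b)_0| = 1), exactly (p−5)/4 elements with χ(x) = 1, and exactly (p−1)/4 elements with χ(x) = −1. -/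
section QuadraticCharSums

variable {F : Type*} [Field F] [Fintype F] [DecidableEq F]

theorem two_mul_sum_filter_quadraticChar_eq_one (f : F → ℤ) :
    2 * ∑ y with quadraticChar F y = 1, f y =
      ∑ y, f y - f 0 + ∑ y, quadraticChar F y * f y := by
  have h0 : f 0 = ∑ y : F, if y = 0 then f y else 0 := by simp
  rw [h0, Finset.sum_filter, Finset.mul_sum, ← Finset.sum_sub_distrib, ← Finset.sum_add_distrib]
  refine Finset.sum_congr rfl fun y _ => ?_
  by_cases hy : y = 0
  · simp [hy]
  · rcases quadraticChar_dichotomy hy with h | h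
    · simp [h, hy]
      ring
    · simp [h, hy]

theorem sum_quadraticChar_add_mul (hF : ringChar F ≠ 2) (a : F) {b : F} (hb : b ≠ 0) :
    ∑ y, quadraticChar F (a + b * y) = 0 := by
  rw [← quadraticChar_sum_zero hF]
  exact Fintype.sum_equiv ((Equiv.mulLeft₀ b hb).trans (Equiv.addLeft a)) _ _ fun _ => rfl

theorem sum_quadraticChar_mul_quadraticChar_add_mul (hF : ringChar F ≠ 2) {a b : F}
    (ha : a ≠ 0) (hb : b ≠ 0) :
    ∑ y, quadraticChar F y * quadraticChar F (a + b * y) = -quadraticChar F b := by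
  have hJ := jacobiSum_nontrivial_inv (quadraticChar_ne_one hF)
  rw [(quadraticChar_isQuadratic F).inv, jacobiSum] at hJ
  have hc : -(a / b) ≠ 0 := neg_ne_zero.mpr (div_ne_zero ha hb)
  have key : ∑ y, quadraticChar F y * quadraticChar F (a + b * y) =
      ∑ x, quadraticChar F (-(a / b)) * quadraticChar F a *
        (quadraticChar F x * quadraticChar F (1 - x)) := by
    refine (Fintype.sum_equiv (Equiv.mulLeft₀ _ hc) _ _ fun x => ?_).symm
    have h : a + b * (-(a / b) * x) = a * (1 - x) := by
      field_simp
      ring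
    change _ = quadraticChar F (-(a / b) * x) * quadraticChar F (a + b * (-(a / b) * x))
    rw [h, map_mul, map_mul]
    ring
  have hsq : -(a / b) * a * -1 = (a / b) ^ 2 * b := by
    field_simp
  rw [key, ← Finset.mul_sum, hJ, mul_neg, ← map_mul, ← map_mul, hsq, map_mul,
    quadraticChar_sq_one' (div_ne_zero ha hb), one_mul]

end QuadraticCharSums


/-- Let `p ≡ 1 (mod 4)` be prime and `a, b` nonzero squares in `F_p`.
Then `S(a,b) = {a + b·y : y a nonzero square}` contains exactly one element `x` with
`χ(x) = 0`, exactly `(p−5)/4` with `χ(x) = 1`, and exactly `(p−1)/4` with `χ(x) = −1`. -/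
theorem stmt_5 (p : ℕ) [Fact p.Prime] (hp : p % 4 = 1)
    (a b : ZMod p) (ha : a ≠ 0) (hb : b ≠ 0)
    (hasq : IsSquare a) (hbsq : IsSquare b) :
    ((Finset.univ.filter fun y : ZMod p => quadraticChar (ZMod p) y = 1).image
        (fun y => a + b * y) |>.filter
        fun x => quadraticChar (ZMod p) x = 0).card = 1 ∧
    ((Finset.univ.filter fun y : ZMod p => quadraticChar (ZMod p) y = 1).image
        (fun y => a + b * y) |>.filter
        fun x => quadraticChar (ZMod p) x = 1).card = (p - 5) / 4 ∧
    ((Finset.univ.filter fun y : ZMod p => quadraticChar (ZMod p) y = 1).image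
        (fun y => a + b * y) |>.filter
        fun x => quadraticChar (ZMod p) x = -1).card = (p - 1) / 4 := by
  have hF : ringChar (ZMod p) ≠ 2 := by
    rw [ZMod.ringChar_zmod_n]
    omega
  have hχa : quadraticChar (ZMod p) a = 1 := (quadraticChar_one_iff_isSquare ha).mpr hasq
  have hχb : quadraticChar (ZMod p) b = 1 := (quadraticChar_one_iff_isSquare hb).mpr hbsq
  have hneg : IsSquare (-1 : ZMod p) := ZMod.exists_sq_eq_neg_one_iff.mpr (by omega)
  have hinj : Function.Injective fun y : ZMod p => a + b * y :=
    (add_right_injective a).comp (mul_right_injective₀ hb)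
  simp only [Finset.filter_image, Finset.card_image_of_injective _ hinj]
  set Q := Finset.univ.filter fun y : ZMod p => quadraticChar (ZMod p) y = 1 with hQ
  have hcard : 2 * (Q.card : ℤ) = p - 1 := by
    have h := two_mul_sum_filter_quadraticChar_eq_one (F := ZMod p) fun _ => 1
    simp only [mul_one, quadraticChar_sum_zero hF, ← hQ, add_zero, Finset.sum_const, nsmul_eq_mul,
      Finset.card_univ, ZMod.card] at h
    exact h
  have hsum : ∑ y ∈ Q, quadraticChar (ZMod p) (a + b * y) = -1 := by
    have h := two_mul_sum_filter_quadraticChar_eq_one fun y => quadraticChar (ZMod p) (a + b * y)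
    rw [sum_quadraticChar_add_mul hF a hb,
      sum_quadraticChar_mul_quadraticChar_add_mul hF ha hb, mul_zero, add_zero, hχa, hχb] at h
    linarith
  have hzero : (Q.filter fun y => quadraticChar (ZMod p) (a + b * y) = 0).card = 1 := by
    refine Finset.card_eq_one.mpr ⟨-(a / b), ?_⟩
    have hmem : quadraticChar (ZMod p) (-(a / b)) = 1 := by
      refine (quadraticChar_one_iff_isSquare (neg_ne_zero.mpr (div_ne_zero ha hb))).mpr ?_
      simpa using hneg.mul (hasq.div hbsq)
    ext y
    have hy : a + b * y = 0 ↔ y = -(a / b) := by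
      rw [← neg_div, eq_div_iff hb, mul_comm y, eq_neg_iff_add_eq_zero, add_comm]
    simp only [hQ, Finset.mem_filter, Finset.mem_univ, true_and, Finset.mem_singleton,
      quadraticChar_eq_zero_iff, hy]
    exact ⟨And.right, fun h => ⟨h ▸ hmem, h⟩⟩
  have hpoint (y : ZMod p) : quadraticChar (ZMod p) y = 0 ∨ quadraticChar (ZMod p) y = 1 ∨
      quadraticChar (ZMod p) y = -1 := quadraticChar_isQuadratic (ZMod p) y
  have htotal : (Q.card : ℤ) =
      (Q.filter fun y => quadraticChar (ZMod p) (a + b * y) = 0).card +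
      (Q.filter fun y => quadraticChar (ZMod p) (a + b * y) = 1).card +
      (Q.filter fun y => quadraticChar (ZMod p) (a + b * y) = -1).card := by
    simp only [Finset.card_eq_sum_ones, Finset.sum_filter, Nat.cast_sum, ← Finset.sum_add_distrib]
    refine Finset.sum_congr rfl fun y _ => ?_
    rcases hpoint (a + b * y) with h | h | h <;> simp [h]
  have hdiff : ∑ y ∈ Q, quadraticChar (ZMod p) (a + b * y) =
      (Q.filter fun y => quadraticChar (ZMod p) (a + b * y) = 1).card -
      (Q.filter fun y => quadraticChar (ZMod p) (a + b * y) = -1).card := by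
    simp only [Finset.card_eq_sum_ones, Finset.sum_filter, Nat.cast_sum, ← Finset.sum_sub_distrib]
    refine Finset.sum_congr rfl fun y _ => ?_
    rcases hpoint (a + b * y) with h | h | h <;> simp [h]
  refine ⟨hzero, ?_, ?_⟩ <;> omega
end

section
/- Let p be a prime with p ≡ 1 (mod 4), let a be a nonzero square in F_p and let b ∈ F_p^× be a non-square. Then S(a,b) contains no element x with χ(x) = 0 (namely |S(a,b)_0| = 0), exactly (p−1)/4 elements with χ(x) = 1, and exactly (p−1)/4 elements with χ(x) = −1. -/
section QuadraticChar

variable {F : Type*} [Field F] [Fintype F] [DecidableEq F]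

/-- If `b` is a non-square, half of the nonzero elements are squares. -/
theorem two_mul_card_quadraticChar_eq_one {b : F} (hb : quadraticChar F b = -1) :
    2 * (Finset.univ.filter fun y : F => quadraticChar F y = 1).card + 1 = Fintype.card F := by
  have hb0 : b ≠ 0 := by rintro rfl; simp at hb
  have hneg : (Finset.univ.filter fun y : F => quadraticChar F y = 1).card =
      (Finset.univ.filter fun y : F => quadraticChar F y = -1).card := by
    refine Finset.card_bij' (fun y _ => b * y) (fun y _ => b⁻¹ * y) ?_ ?_ ?_ ?_
    · intro y hy
      simp only [Finset.mem_filter, Finset.mem_univ, true_and, map_mul] at hy ⊢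
      rw [hb, hy, mul_one]
    · intro y hy
      have h : quadraticChar F b * quadraticChar F b⁻¹ = 1 := by
        rw [← map_mul, mul_inv_cancel₀ hb0, map_one]
      simp only [Finset.mem_filter, Finset.mem_univ, true_and, map_mul] at hy ⊢
      rw [hb] at h
      rw [hy]
      linarith
    · intro y _
      simp [hb0]
    · intro y _
      simp [hb0]
  have hunion : (Finset.univ.filter fun y : F => quadraticChar F y = 1) ∪
      (Finset.univ.filter fun y : F => quadraticChar F y = -1) = Finset.univ.erase 0 := by
    ext y
    simp only [Finset.mem_union, Finset.mem_filter, Finset.mem_univ, true_and, Finset.mem_erase,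
      and_true]
    refine ⟨?_, quadraticChar_dichotomy⟩
    rintro h rfl
    simp at h
  have hdisj : Disjoint (Finset.univ.filter fun y : F => quadraticChar F y = 1)
      (Finset.univ.filter fun y : F => quadraticChar F y = -1) := by
    refine Finset.disjoint_filter.2 fun y _ h₁ h₂ => ?_
    rw [h₁] at h₂
    norm_num at h₂
  have hcard := congrArg Finset.card hunion
  rw [Finset.card_union_of_disjoint hdisj, ← hneg, Finset.card_erase_of_mem (Finset.mem_univ _),
    Finset.card_univ] at hcard
  have := Fintype.card_pos (α := F)
  omega

theorem mem_image_quadraticChar_eq_one_iff {a b x : F} (hb : quadraticChar F b = -1) :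
    x ∈ (Finset.univ.filter fun y : F => quadraticChar F y = 1).image (fun y => a + b * y) ↔
      quadraticChar F (x - a) = -1 := by
  have hb0 : b ≠ 0 := by rintro rfl; simp at hb
  simp only [Finset.mem_image, Finset.mem_filter, Finset.mem_univ, true_and]
  constructor
  · rintro ⟨y, hy, rfl⟩
    rw [add_sub_cancel_left, map_mul, hb, hy, mul_one]
  · intro hx
    refine ⟨(x - a) / b, ?_, by field_simp; ring⟩
    have h : quadraticChar F b * quadraticChar F ((x - a) / b) = -1 := by
      rw [← map_mul, mul_div_cancel₀ _ hb0, hx]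
    rw [hb] at h
    linarith

/-- The substitution `x ↦ a - a² / x` exchanges non-squares and squares among the `x` for which
`x - a` is a non-square. -/
theorem card_quadraticChar_sub_eq_neg_one {a : F} (ha : quadraticChar F a = 1)
    (hneg : quadraticChar F (-1) = 1) :
    (Finset.univ.filter fun x : F =>
      quadraticChar F (x - a) = -1 ∧ quadraticChar F x = -1).card =
    (Finset.univ.filter fun x : F =>
      quadraticChar F (x - a) = -1 ∧ quadraticChar F x = 1).card := by
  have ha0 : a ≠ 0 := by rintro rfl; simp at ha
  refine Finset.card_bij' (fun x _ => a - a ^ 2 / x) (fun x _ => a ^ 2 / (a - x)) ?_ ?_ ?_ ?_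
  · intro x hx
    obtain ⟨h₁, h₂⟩ := (Finset.mem_filter.1 hx).2
    have hx0 : x ≠ 0 := by rintro rfl; simp at h₂
    have e₁ := congrArg (quadraticChar F)
      (show x * (a - a ^ 2 / x - a) = -1 * a * a by field_simp; ring)
    have e₂ := congrArg (quadraticChar F)
      (show x * (a - a ^ 2 / x) = a * (x - a) by field_simp)
    rw [map_mul, map_mul, map_mul, h₂, hneg, ha] at e₁
    rw [map_mul, map_mul, h₂, h₁, ha] at e₂
    refine Finset.mem_filter.2 ⟨Finset.mem_univ _, ?_, ?_⟩ <;> linarith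
  · intro x hx
    obtain ⟨h₁, h₂⟩ := (Finset.mem_filter.1 hx).2
    have h₃ : quadraticChar F (a - x) = -1 := by
      rw [show a - x = -1 * (x - a) by ring, map_mul, h₁, hneg, one_mul]
    have hx0 : a - x ≠ 0 := by intro h; simp [h] at h₃
    have e₁ := congrArg (quadraticChar F)
      (show (a - x) * (a ^ 2 / (a - x) - a) = a * x by field_simp; ring)
    have e₂ := congrArg (quadraticChar F)
      (show (a - x) * (a ^ 2 / (a - x)) = a * a by field_simp)
    rw [map_mul, map_mul, h₃, h₂, ha] at e₁
    rw [map_mul, map_mul, h₃, ha] at e₂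
    refine Finset.mem_filter.2 ⟨Finset.mem_univ _, ?_, ?_⟩ <;> linarith
  · intro x hx
    have hx0 : x ≠ 0 := by rintro rfl; simp at hx
    have : a ^ 2 / x ≠ 0 := by positivity
    simp only [sub_sub_cancel]
    field_simp
  · intro x hx
    have hx0 : a - x ≠ 0 := by
      intro h
      simp [← sub_eq_zero.1 h] at hx
    field_simp
    ring

end QuadraticChar

/-- Let `p ≡ 1 (mod 4)` be prime, `a` a nonzero square and `b` a nonzero
non-square in `F_p`. Then `S(a,b)` contains no element with `χ(x) = 0`, exactly
`(p−1)/4` elements with `χ(x) = 1`, and exactly `(p−1)/4` with `χ(x) = −1`. -/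
theorem stmt_6 (p : ℕ) [Fact p.Prime] (hp : p % 4 = 1)
    (a b : ZMod p) (ha : a ≠ 0) (hb : b ≠ 0)
    (hasq : IsSquare a) (hbsq : ¬ IsSquare b) :
    ((Finset.univ.filter fun y : ZMod p => quadraticChar (ZMod p) y = 1).image
        (fun y => a + b * y) |>.filter
        fun x => quadraticChar (ZMod p) x = 0).card = 0 ∧
    ((Finset.univ.filter fun y : ZMod p => quadraticChar (ZMod p) y = 1).image
        (fun y => a + b * y) |>.filter
        fun x => quadraticChar (ZMod p) x = 1).card = (p - 1) / 4 ∧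
    ((Finset.univ.filter fun y : ZMod p => quadraticChar (ZMod p) y = 1).image
        (fun y => a + b * y) |>.filter
        fun x => quadraticChar (ZMod p) x = -1).card = (p - 1) / 4 := by
  have hχa : quadraticChar (ZMod p) a = 1 := (quadraticChar_one_iff_isSquare ha).2 hasq
  have hχb : quadraticChar (ZMod p) b = -1 := quadraticChar_neg_one_iff_not_isSquare.2 hbsq
  have hχneg : quadraticChar (ZMod p) (-1) = 1 :=
    (quadraticChar_one_iff_isSquare (neg_ne_zero.2 one_ne_zero)).2
      (FiniteField.isSquare_neg_one_iff.2 (by rw [ZMod.card]; omega))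
  have hcard := two_mul_card_quadraticChar_eq_one hχb
  rw [ZMod.card, ← Finset.card_image_of_injective _
    ((add_right_injective a).comp (mul_right_injective₀ hb))] at hcard
  change 2 * ((Finset.univ.filter fun y : ZMod p => quadraticChar (ZMod p) y = 1).image
    (fun y => a + b * y)).card + 1 = p at hcard
  have hS : (Finset.univ.filter fun y : ZMod p => quadraticChar (ZMod p) y = 1).image
      (fun y => a + b * y) =
      Finset.univ.filter fun x : ZMod p => quadraticChar (ZMod p) (x - a) = -1 := by
    ext x
    rw [mem_image_quadraticChar_eq_one_iff hχb]
    simp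
  rw [hS] at hcard ⊢
  have hzero : ∀ x : ZMod p, quadraticChar (ZMod p) (x - a) = -1 → x ≠ 0 := by
    rintro x hx rfl
    rw [zero_sub, ← neg_one_mul, map_mul, hχneg, hχa] at hx
    norm_num at hx
  have hsplit := Finset.card_filter_add_card_filter_not
    (s := Finset.univ.filter fun x : ZMod p => quadraticChar (ZMod p) (x - a) = -1)
    (fun x => quadraticChar (ZMod p) x = 1)
  have hnot : ((Finset.univ.filter fun x : ZMod p => quadraticChar (ZMod p) (x - a) = -1).filter
      fun x => ¬ quadraticChar (ZMod p) x = 1) =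
      (Finset.univ.filter fun x : ZMod p => quadraticChar (ZMod p) (x - a) = -1).filter
        fun x => quadraticChar (ZMod p) x = -1 :=
    Finset.filter_congr fun x hx =>
      (quadraticChar_eq_neg_one_iff_not_one (hzero x (Finset.mem_filter.1 hx).2)).symm
  have hswap := card_quadraticChar_sub_eq_neg_one hχa hχneg
  rw [← Finset.filter_filter, ← Finset.filter_filter] at hswap
  rw [hnot] at hsplit
  refine ⟨?_, by omega, by omega⟩
  refine Finset.card_eq_zero.2 (Finset.filter_eq_empty_iff.2 fun x hx h => ?_)
  exact hzero x (Finset.mem_filter.1 hx).2 (quadraticChar_eq_zero_iff.1 h)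
end

section
/- Let p be a prime with p ≡ 1 (mod 4) and let a, b, c, d be nonzero squares in F_p. Then there exists y_0 ∈ F_p^× such that a + b·y_0² is a nonzero non-square in F_p, and c + d·y_0² is either zero or a nonzero non-square in F_p (i.e. c + d·y_0² is not a nonzero square). -/
section QuadraticCharacterSum

variable {F : Type*} [Field F] [Fintype F] [DecidableEq F]

theorem sum_quadraticChar_sq_add_mul_sq (hF : ringChar F ≠ 2) (hneg : IsSquare (-1 : F))
    {a b : F} (ha : a ≠ 0) (hb : b ≠ 0) :
    ∑ t : F, quadraticChar F (a ^ 2 + (b * t) ^ 2) = -1 := by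
  obtain ⟨i, hi⟩ := hneg
  have hi0 : i ≠ 0 := by
    rintro rfl
    simp at hi
  have h2 : (2 : F) ≠ 0 := Ring.two_ne_zero hF
  have hinv : (quadraticChar F)⁻¹ = quadraticChar F := quadraticChar_isQuadratic F |>.inv
  have hneg_one : quadraticChar F (-1) = 1 :=
    (quadraticChar_one_iff_isSquare (neg_ne_zero.mpr one_ne_zero)).mpr ⟨i, hi⟩
  have hJ := jacobiSum_nontrivial_inv (quadraticChar_ne_one hF)
  rw [hinv, hneg_one, jacobiSum] at hJ
  rw [← hJ]
  symm
  have hab : a / (i * b) ≠ 0 := div_ne_zero ha (mul_ne_zero hi0 hb)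
  have hinj : Function.Injective fun x : F ↦ (2 * x - 1) * (a / (i * b)) := fun x y hxy ↦
    mul_left_cancel₀ h2 (sub_left_injective (mul_right_cancel₀ hab hxy))
  refine Fintype.sum_bijective _ (Finite.injective_iff_bijective.mp hinj) _ _ fun x ↦ ?_
  have hx : a ^ 2 + (b * ((2 * x - 1) * (a / (i * b)))) ^ 2 = (2 * a) ^ 2 * (x * (1 - x)) := by
    field_simp
    linear_combination -(2 * x - 1) ^ 2 * hi
  rw [hx, map_mul, map_mul, quadraticChar_sq_one' (mul_ne_zero h2 ha), one_mul]

theorem exists_quadraticChar_eq_neg_one_and_ne_one (hF : ringChar F ≠ 2)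
    (hneg : IsSquare (-1 : F)) {a b c d : F} (ha : a ≠ 0) (hb : b ≠ 0) (hc : c ≠ 0)
    (hd : d ≠ 0) :
    ∃ t : F, t ≠ 0 ∧ quadraticChar F (a ^ 2 + (b * t) ^ 2) = -1 ∧
      quadraticChar F (c ^ 2 + (d * t) ^ 2) ≠ 1 := by
  by_contra! H
  have hf := sum_quadraticChar_sq_add_mul_sq hF hneg ha hb
  have hg := sum_quadraticChar_sq_add_mul_sq hF hneg hc hd
  obtain ⟨i, hi⟩ := hneg
  have hi0 : i ≠ 0 := by
    rintro rfl
    simp at hi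
  set r : F := i * a / b with hr
  have hr0 : r ≠ 0 := div_ne_zero (mul_ne_zero hi0 ha) hb
  have hle (t : F) : (if t = 0 then (2 : ℤ) else 0) - (if t = r then 1 else 0) -
      (if t = -r then 1 else 0) ≤
      quadraticChar F (a ^ 2 + (b * t) ^ 2) + quadraticChar F (c ^ 2 + (d * t) ^ 2) := by
    by_cases ht : t = 0
    · subst ht
      have h1 := quadraticChar_sq_one' ha
      have h2 := quadraticChar_sq_one' hc
      simp [-quadraticChar_apply, h1, h2, hr0, hr0.symm]
    have hg' := quadraticChar_isQuadratic F (c ^ 2 + (d * t) ^ 2)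
    rcases quadraticChar_isQuadratic F (a ^ 2 + (b * t) ^ 2) with h | h | h
    · have hroot : t = r ∨ t = -r := by
        rw [quadraticChar_eq_zero_iff] at h
        apply sq_eq_sq_iff_eq_or_eq_neg.mp
        rw [hr]
        field_simp
        linear_combination h + a ^ 2 * hi
      grind
    · grind
    · have := H t ht h
      grind
  have hsum := Finset.sum_le_sum fun t (_ : t ∈ Finset.univ) ↦ hle t
  simp only [Finset.sum_add_distrib, Finset.sum_sub_distrib, Finset.sum_ite_eq', Finset.mem_univ,
    if_true, hf, hg] at hsum
  norm_num at hsum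

end QuadraticCharacterSum

/-- Let `p ≡ 1 (mod 4)` be prime and `a, b, c, d` nonzero squares in `F_p`.
Then there is `y₀ ∈ F_p^×` such that `a + b·y₀²` is a nonzero non-square and
`c + d·y₀²` is not a nonzero square (i.e. it is zero or a nonzero non-square). -/
theorem stmt_7 (p : ℕ) [Fact p.Prime] (hp : p % 4 = 1)
    (a b c d : ZMod p) (ha : a ≠ 0) (hb : b ≠ 0) (hc : c ≠ 0) (hd : d ≠ 0)
    (hasq : IsSquare a) (hbsq : IsSquare b) (hcsq : IsSquare c) (hdsq : IsSquare d) :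
    ∃ y₀ : ZMod p, y₀ ≠ 0 ∧
      (a + b * y₀ ^ 2 ≠ 0 ∧ ¬ IsSquare (a + b * y₀ ^ 2)) ∧
      ¬ (c + d * y₀ ^ 2 ≠ 0 ∧ IsSquare (c + d * y₀ ^ 2)) := by
  obtain ⟨a, rfl⟩ := hasq
  obtain ⟨b, rfl⟩ := hbsq
  obtain ⟨c, rfl⟩ := hcsq
  obtain ⟨d, rfl⟩ := hdsq
  have hF : ringChar (ZMod p) ≠ 2 := by
    rw [ZMod.ringChar_zmod_n]
    omega
  have hneg : IsSquare (-1 : ZMod p) := ZMod.exists_sq_eq_neg_one_iff.mpr (by omega)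
  obtain ⟨t, ht, hf, hg⟩ := exists_quadraticChar_eq_neg_one_and_ne_one hF hneg
    (left_ne_zero_of_mul ha) (left_ne_zero_of_mul hb) (left_ne_zero_of_mul hc)
    (left_ne_zero_of_mul hd)
  simp only [← pow_two, ← mul_pow]
  have hns := quadraticChar_neg_one_iff_not_isSquare.mp hf
  refine ⟨t, ht, ⟨fun h ↦ hns (h ▸ IsSquare.zero), hns⟩, fun h ↦ hg ?_⟩
  exact (quadraticChar_one_iff_isSquare h.1).mpr h.2
end

section
/- The surface Y_{p,a,b} is everywhere locally soluble: there is a nonzero vector (u,v,x,y,z) ∈ ℝ^5 satisfying y² − p·x² = u·v and z² − p·x² = (a·u − p·v)(u − b·v), and for every prime q there is a nonzero vector (u,v,x,y,z) ∈ ℚ_q^5 satisfying the same two equations. -/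
/-- `K`-solubility of the surface `Y_{p,a,b}`, over a commutative ring `K` and with arbitrary
coefficients. -/
def HasNonzeroPoint {K : Type*} [CommRing K] (p a b : K) : Prop :=
  ∃ u v x y z : K, ¬ (u = 0 ∧ v = 0 ∧ x = 0 ∧ y = 0 ∧ z = 0) ∧
    y ^ 2 - p * x ^ 2 = u * v ∧ z ^ 2 - p * x ^ 2 = (a * u - p * v) * (u - b * v)

theorem HasNonzeroPoint.of_isSquare {K : Type*} [CommRing K] [Nontrivial K] {p a b : K}
    (h : IsSquare p ∨ IsSquare a ∨ IsSquare b ∨ (p ≠ 0 ∧ IsSquare (p * a)) ∨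
      IsSquare (p * b)) : HasNonzeroPoint p a b := by
  rcases h with ⟨r, h⟩ | ⟨r, h⟩ | ⟨r, h⟩ | ⟨h₀, r, h⟩ | ⟨r, h⟩
  · exact ⟨0, 0, 1, r, r, by simp, by linear_combination -h, by linear_combination -h⟩
  · exact ⟨1, 0, 0, 0, r, by simp, by ring, by linear_combination -h⟩
  · exact ⟨b, 1, 0, r, 0, by simp, by linear_combination -h, by ring⟩
  · exact ⟨p, a, 0, r, 0, by simp [h₀], by linear_combination -h, by ring⟩
  · exact ⟨0, 1, 0, 0, r, by simp, by ring, by linear_combination -h⟩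

section Padic

variable {q : ℕ} [Fact q.Prime]

theorem Padic.isSquare_intCast_of_norm_sub_sq_lt {n m : ℤ}
    (h : ‖((n - m ^ 2 : ℤ) : ℤ_[q])‖ < ‖((2 * m : ℤ) : ℤ_[q])‖ ^ 2) :
    IsSquare (n : ℚ_[q]) := by
  have hF := hensels_lemma (p := q) (F := Polynomial.X ^ 2 - Polynomial.C (n : ℤ_[q]))
    (a := (m : ℤ_[q])) (by
      rw [← norm_neg] at h
      simpa [one_add_one_eq_two] using h)
  obtain ⟨z, hz, -⟩ := hF
  refine ⟨(z : ℚ_[q]), ?_⟩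
  have hz' : z ^ 2 = n := by simpa [sub_eq_zero] using hz
  have := congrArg (fun t : ℤ_[q] => (t : ℚ_[q])) hz'
  push_cast at this
  rw [← this, sq]

theorem Padic.isSquare_intCast_of_isSquare_zmod (hq : q ≠ 2) {n : ℤ} (hn : (n : ZMod q) ≠ 0)
    (h : IsSquare (n : ZMod q)) : IsSquare (n : ℚ_[q]) := by
  obtain ⟨r, hr⟩ := h
  obtain ⟨m, rfl⟩ := ZMod.intCast_surjective r
  have h2 : (2 : ZMod q) ≠ 0 := fun h => hq <|
    (Nat.prime_dvd_prime_iff_eq Fact.out Nat.prime_two).1 ((ZMod.natCast_eq_zero_iff 2 q).1 h)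
  have hm : (m : ZMod q) ≠ 0 := by
    intro h0
    simp [hr, h0] at hn
  apply Padic.isSquare_intCast_of_norm_sub_sq_lt (m := m)
  have h1 : ‖((2 * m : ℤ) : ℤ_[q])‖ = 1 := by
    refine le_antisymm (PadicInt.norm_le_one _) (not_lt.1 fun hlt => ?_)
    rw [PadicInt.norm_int_lt_one_iff_dvd, ← ZMod.intCast_zmod_eq_zero_iff_dvd] at hlt
    push_cast at hlt
    exact mul_ne_zero h2 hm hlt
  rw [h1, one_pow, PadicInt.norm_int_lt_one_iff_dvd, ← ZMod.intCast_zmod_eq_zero_iff_dvd]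
  push_cast
  rw [hr]
  ring

theorem Padic.isSquare_or_isSquare_or_isSquare_mul (hq : q ≠ 2) {m n : ℤ}
    (hm : (m : ZMod q) ≠ 0) (hn : (n : ZMod q) ≠ 0) :
    IsSquare (m : ℚ_[q]) ∨ IsSquare (n : ℚ_[q]) ∨ IsSquare (m * n : ℚ_[q]) := by
  by_cases h₁ : IsSquare (m : ZMod q)
  · exact .inl (isSquare_intCast_of_isSquare_zmod hq hm h₁)
  by_cases h₂ : IsSquare (n : ZMod q)
  · exact .inr (.inl (isSquare_intCast_of_isSquare_zmod hq hn h₂))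
  have hmn : ((m * n : ℤ) : ZMod q) ≠ 0 := by
    push_cast
    exact mul_ne_zero hm hn
  refine .inr (.inr ?_)
  rw [← Int.cast_mul]
  refine isSquare_intCast_of_isSquare_zmod hq hmn ?_
  rw [← legendreSym.eq_one_iff q hmn, legendreSym.mul, (legendreSym.eq_neg_one_iff q).2 h₁,
    (legendreSym.eq_neg_one_iff q).2 h₂]
  norm_num

end Padic

theorem Padic.isSquare_intCast_two {n : ℤ}
    (h : (n : ZMod 32) ∈ ([1, 9, 17, 25, 4] : List (ZMod 32))) : IsSquare (n : ℚ_[2]) := by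
  have key : ∀ m k : ℕ, ((2 : ℕ) ^ k : ℤ) ∣ n - m ^ 2 →
      ‖((2 * m : ℤ) : ℤ_[2])‖ ^ 2 > (2 : ℝ) ^ (-k : ℤ) → IsSquare (n : ℚ_[2]) := by
    intro m k hd hlt
    refine isSquare_intCast_of_norm_sub_sq_lt (m := m) (lt_of_le_of_lt ?_ hlt)
    exact_mod_cast PadicInt.norm_int_le_pow_iff_dvd.2 (by exact_mod_cast hd)
  have h2 : ‖(2 : ℤ_[2])‖ = 2⁻¹ := by simpa using PadicInt.norm_p (p := 2)
  have h' : n % 8 = 1 ∨ n % 32 = 4 := by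
    have e : ∀ c : ℤ, (n : ZMod 32) = c → n % 32 = c % 32 := fun c hc =>
      (ZMod.intCast_eq_intCast_iff' n c 32).1 hc
    simp only [List.mem_cons, List.not_mem_nil, or_false] at h
    rcases h with h | h | h | h | h
    · have := e 1 (by exact_mod_cast h); omega
    · have := e 9 (by exact_mod_cast h); omega
    · have := e 17 (by exact_mod_cast h); omega
    · have := e 25 (by exact_mod_cast h); omega
    · have := e 4 (by exact_mod_cast h); omega
  rcases h' with h' | h'
  · refine key 1 3 (by norm_num; omega) ?_
    norm_num [h2]
  · refine key 2 5 (by norm_num; omega) ?_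
    have h4 : ‖(4 : ℤ_[2])‖ = 2⁻¹ * 2⁻¹ := by
      rw [← h2, ← norm_mul]
      norm_num
    norm_num [h4]

theorem hasNonzeroPoint_padic_two {p a b : ℤ} (hp : p % 4 = 1) (hab : a * b = p - 1) :
    HasNonzeroPoint (p : ℚ_[2]) a b := by
  have key : ∀ a b : ZMod 32, 8 * (a * b) = 0 →
      let S : List (ZMod 32) := [1, 9, 17, 25, 4]
      let p := a * b + 1
      p ∈ S ∨ a ∈ S ∨ b ∈ S ∨ p * a ∈ S ∨ p * b ∈ S ∨
      ∃ t ∈ ([(-6, -6), (-7, 7), (-1, 1), (-7, -4), (-7, 4), (-5, 4), (-4, -7), (-4, -3),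
          (-4, -1), (-4, 1), (-3, 4)] : List (ℤ × ℤ)),
        (t.1 * t.2 : ZMod 32) + p ∈ S ∧ (a * t.1 - p * t.2) * (t.1 - b * t.2) + p ∈ S := by
    decide +kernel
  have h8 : (8 * (a * b) : ZMod 32) = 0 := by
    have : ((8 * (a * b) : ℤ) : ZMod 32) = 0 := by
      rw [ZMod.intCast_zmod_eq_zero_iff_dvd]
      push_cast
      omega
    exact_mod_cast this
  have hpe : (a * b + 1 : ZMod 32) = (p : ZMod 32) := by
    rw [show p = a * b + 1 by omega]
    push_cast
    rfl
  have hp0 : (p : ℚ_[2]) ≠ 0 := by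
    have : p ≠ 0 := by omega
    exact_mod_cast this
  have sq := @Padic.isSquare_intCast_two
  have := key a b h8
  simp only [hpe] at this
  rcases this with h | h | h | h | h | ⟨⟨u, v⟩, -, h₁, h₂⟩
  · exact .of_isSquare (.inl (sq h))
  · exact .of_isSquare (.inr (.inl (sq h)))
  · exact .of_isSquare (.inr (.inr (.inl (sq h))))
  · exact .of_isSquare (.inr (.inr (.inr (.inl ⟨hp0, by
      rw [← Int.cast_mul]; exact sq (by rwa [Int.cast_mul])⟩))))
  · exact .of_isSquare (.inr (.inr (.inr (.inr (by
      rw [← Int.cast_mul]; exact sq (by rwa [Int.cast_mul]))))))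
  · obtain ⟨y, hy⟩ := sq (n := u * v + p) (by push_cast; exact h₁)
    obtain ⟨z, hz⟩ := sq (n := (a * u - p * v) * (u - b * v) + p) (by push_cast; exact h₂)
    push_cast at hy hz
    exact ⟨u, v, 1, y, z, by simp, by linear_combination -hy, by linear_combination -hz⟩

theorem hasNonzeroPoint_padic_of_ne {p q : ℕ} [Fact p.Prime] [Fact q.Prime] (hq : q ≠ 2)
    (hpq : q ≠ p) {a b : ℤ} (hab : a * b = (p : ℤ) - 1) :
    HasNonzeroPoint (p : ℚ_[q]) a b := by
  have hp : ((p : ℤ) : ZMod q) ≠ 0 := by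
    rw [Int.cast_natCast, Ne, ZMod.natCast_eq_zero_iff]
    exact fun h => hpq ((Nat.prime_dvd_prime_iff_eq Fact.out Fact.out).1 h)
  have hp0 : (p : ℚ_[q]) ≠ 0 := Nat.cast_ne_zero.2 (NeZero.ne p)
  by_cases ha : (a : ZMod q) = 0
  · have h1 : ((p : ℤ) : ZMod q) = 1 := by
      have := congrArg (Int.cast : ℤ → ZMod q) hab
      push_cast at this ⊢
      rw [ha] at this
      linear_combination -this
    have := Padic.isSquare_intCast_of_isSquare_zmod hq hp (by rw [h1]; exact IsSquare.one)
    exact .of_isSquare (.inl (by exact_mod_cast this))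
  · rcases Padic.isSquare_or_isSquare_or_isSquare_mul hq hp ha with h | h | h
    · exact .of_isSquare (.inl (by exact_mod_cast h))
    · exact .of_isSquare (.inr (.inl h))
    · exact .of_isSquare (.inr (.inr (.inr (.inl ⟨hp0, by simpa using h⟩))))

theorem hasNonzeroPoint_padic_self {p : ℕ} [Fact p.Prime] (hp : p % 4 = 1)
    {a b : ℤ} (hab : a * b = (p : ℤ) - 1) : HasNonzeroPoint (p : ℚ_[p]) a b := by
  have hp2 : p ≠ 2 := by omega
  have h2 : (2 : ZMod p) ≠ 0 := fun h => hp2 <|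
    (Nat.prime_dvd_prime_iff_eq Fact.out Nat.prime_two).1 ((ZMod.natCast_eq_zero_iff 2 p).1 h)
  have hab' : (a * b : ZMod p) = -1 := by
    have := congrArg (Int.cast : ℤ → ZMod p) hab
    push_cast at this
    simpa using this
  by_cases hsq : IsSquare (a : ZMod p)
  · refine .of_isSquare (.inr (.inl (Padic.isSquare_intCast_of_isSquare_zmod hp2 ?_ hsq)))
    intro h0
    simp [h0] at hab'
  have ha1 : (1 + a : ZMod p) ≠ 0 := by
    intro h
    apply hsq
    rw [show (a : ZMod p) = -1 by linear_combination h, ZMod.exists_sq_eq_neg_one_iff]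
    omega
  have hval : (((4 * a - p * (1 - a) ^ 2) * (4 - b * (1 - a) ^ 2) : ℤ) : ZMod p)
      = (2 * (1 + a)) * (2 * (1 + a)) := by
    push_cast
    rw [ZMod.natCast_self]
    linear_combination (-4 * (1 - a : ZMod p) ^ 2) * hab'
  obtain ⟨z, hz⟩ := Padic.isSquare_intCast_of_isSquare_zmod hp2
    (n := (4 * a - p * (1 - a) ^ 2) * (4 - b * (1 - a) ^ 2))
    (by
      rw [hval]
      exact mul_self_ne_zero.2 (mul_ne_zero h2 ha1)) ⟨_, hval⟩
  push_cast at hz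
  refine ⟨4, (1 - a) ^ 2, 0, 2 * (1 - a), z, by simp, by ring, by linear_combination -hz⟩

/-- For a prime `p ≡ 1 (mod 4)` and integers `a, b` with `a·b = p − 1`,
the surface `Y_{p,a,b}` is everywhere locally soluble: it has a real point and a
`ℚ_q`-point for every prime `q`. -/
theorem stmt_8 (p : ℕ) [Fact p.Prime] (hp : p % 4 = 1)
    (a b : ℤ) (hab : a * b = (p : ℤ) - 1) :
    (∃ u v x y z : ℝ,
      ¬ (u = 0 ∧ v = 0 ∧ x = 0 ∧ y = 0 ∧ z = 0) ∧
      y ^ 2 - (p : ℝ) * x ^ 2 = u * v ∧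
      z ^ 2 - (p : ℝ) * x ^ 2
        = ((a : ℝ) * u - (p : ℝ) * v) * (u - (b : ℝ) * v)) ∧
    ∀ (q : ℕ) [Fact q.Prime], ∃ u v x y z : ℚ_[q],
      ¬ (u = 0 ∧ v = 0 ∧ x = 0 ∧ y = 0 ∧ z = 0) ∧
      y ^ 2 - (p : ℚ_[q]) * x ^ 2 = u * v ∧
      z ^ 2 - (p : ℚ_[q]) * x ^ 2
        = ((a : ℚ_[q]) * u - (p : ℚ_[q]) * v) * (u - (b : ℚ_[q]) * v) := by
  refine ⟨?_, fun q _ => ?_⟩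
  · exact HasNonzeroPoint.of_isSquare (.inl (Real.isSquare_iff.2 (Nat.cast_nonneg p)))
  · change HasNonzeroPoint (p : ℚ_[q]) a b
    by_cases hq : q = 2
    · subst hq
      exact_mod_cast hasNonzeroPoint_padic_two (p := p) (by omega) hab
    by_cases hpq : q = p
    · subst hpq
      exact hasNonzeroPoint_padic_self hp hab
    · exact hasNonzeroPoint_padic_of_ne hq hpq hab
end

section
/- There exist ℚ_p-points P_1 = (u_1, v_1, x_1, y_1, z_1) and P_2 = (u_2, v_2, x_2, y_2, z_2) of Y_{p,a,b} such that u_1·(z_1 − y_1) ≠ 0 and u_2·(z_2 − y_2) ≠ 0, u_1·(z_1 − y_1) = s² − p·t² for some s, t ∈ ℚ_p, and u_2·(z_2 − y_2) ≠ s² − p·t² for all s, t ∈ ℚ_p. (Equivalently, the invariant map at p of the quaternion class ℬ = (p, (z − y)/u) ∈ Br Y_{p,a,b} is surjective.) -/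
/-- Among the `ℚ_p`-points of `Y_{p,a,b}` with `u = 1` and `x = 0`, the difference `z - y` can be
prescribed to be any integer prime to `p`. -/
theorem exists_padic_point_of_not_dvd (p : ℕ) [Fact p.Prime] (hp : p ≠ 2)
    (a b : ℤ) (hab : a * b = (p : ℤ) - 1) (d : ℤ) (hd : ¬ (p : ℤ) ∣ d) :
    ∃ y : ℚ_[p], (y + d) ^ 2 = ((a : ℚ_[p]) - p * y ^ 2) * (1 - b * y ^ 2) := by
  have hprime : Prime (p : ℤ) := Nat.prime_iff_prime_int.mp Fact.out
  have h2 : ¬ (p : ℤ) ∣ 2 := by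
    intro h
    exact hp ((Nat.prime_dvd_prime_iff_eq Fact.out Nat.prime_two).mp (by exact_mod_cast h))
  have h2d : ‖(((2 * d : ℤ)) : ℤ_[p])‖ = 1 := by
    refine le_antisymm (PadicInt.norm_le_one _) (not_lt.mp fun h => ?_)
    rw [PadicInt.norm_int_lt_one_iff_dvd] at h
    exact (hprime.dvd_or_dvd h).elim h2 hd
  obtain ⟨e, he⟩ := (PadicInt.isUnit_iff.mpr h2d).exists_right_inv
  push_cast at he
  let F : Polynomial ℤ_[p] := Polynomial.C ((d : ℤ_[p]) ^ 2 - a)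
    + Polynomial.C (2 * (d : ℤ_[p])) * Polynomial.X
    + Polynomial.C (p : ℤ_[p]) * (2 * Polynomial.X ^ 2 - Polynomial.C (b : ℤ_[p]) * Polynomial.X ^ 4)
  have hF (y : ℤ_[p]) : Polynomial.aeval y F
      = (d : ℤ_[p]) ^ 2 - a + 2 * d * y + p * (2 * y ^ 2 - b * y ^ 4) := by
    simp [F]
  have hF' (y : ℤ_[p]) : Polynomial.aeval y (Polynomial.derivative F)
      = 2 * d + p * (4 * y - 4 * b * y ^ 3) := by
    simp only [F, Polynomial.derivative_mul, Polynomial.derivative_pow, Polynomial.derivative_C,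
      Polynomial.derivative_X, Polynomial.derivative_ofNat, map_add, map_sub, map_mul, map_pow,
      Polynomial.aeval_X, Polynomial.aeval_C, map_zero, map_one, map_ofNat,
      Algebra.algebraMap_self, RingHom.id_apply]
    push_cast
    ring
  have hlt (w : ℤ_[p]) : ‖(p : ℤ_[p]) * w‖ < 1 :=
    (PadicInt.norm_lt_one_iff_dvd _).mpr (dvd_mul_right _ _)
  have hroot : ‖Polynomial.aeval (((a : ℤ_[p]) - d ^ 2) * e) F‖
      < ‖Polynomial.aeval (((a : ℤ_[p]) - d ^ 2) * e) (Polynomial.derivative F)‖ ^ 2 := by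
    rw [hF, hF']
    generalize hy : ((a : ℤ_[p]) - d ^ 2) * e = y
    have hlin : (d : ℤ_[p]) ^ 2 - a + 2 * d * y = 0 := by
      rw [← hy]
      linear_combination ((a : ℤ_[p]) - d ^ 2) * he
    push_cast at h2d
    rw [hlin, zero_add, PadicInt.norm_add_eq_max_of_ne, h2d, max_eq_left (hlt _).le, one_pow]
    · exact hlt _
    · rw [h2d]
      exact (hlt _).ne'
  obtain ⟨y, hy, -⟩ := hensels_lemma hroot
  refine ⟨y, ?_⟩
  rw [hF] at hy
  have hy' := congrArg (fun w : ℤ_[p] => (w : ℚ_[p])) hy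
  have htwo : ((2 : ℤ_[p]) : ℚ_[p]) = 2 := rfl
  push_cast [htwo] at hy'
  have hab' : (a : ℚ_[p]) * b = p - 1 := by exact_mod_cast congrArg (Int.cast : ℤ → ℚ_[p]) hab
  linear_combination hy' + (y : ℚ_[p]) ^ 2 * hab'

/-- The valuation of `p * t ^ 2` is odd, that of `s ^ 2` is even. -/
theorem Padic.norm_sq_ne_norm_p_mul_sq (p : ℕ) [Fact p.Prime] {s t : ℚ_[p]} (hs : s ≠ 0)
    (ht : t ≠ 0) : ‖s ^ 2‖ ≠ ‖(p : ℚ_[p]) * t ^ 2‖ := by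
  have hp0 : (p : ℚ_[p]) ≠ 0 := by exact_mod_cast (Fact.out : p.Prime).ne_zero
  have hp1 : (1 : ℝ) < p := by exact_mod_cast (Fact.out : p.Prime).one_lt
  intro h
  rw [Padic.norm_eq_zpow_neg_valuation (pow_ne_zero 2 hs),
    Padic.norm_eq_zpow_neg_valuation (mul_ne_zero hp0 (pow_ne_zero 2 ht))] at h
  have h' := zpow_right_injective₀ (by positivity) hp1.ne' h
  simp only [Padic.valuation_mul hp0 (pow_ne_zero 2 ht), Padic.valuation_pow,
    Padic.valuation_p] at h'
  omega

/-- A quadratic nonresidue modulo `p` is not a norm from `ℚ_p(√p)`. -/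
theorem Padic.intCast_ne_sq_sub_p_mul_sq (p : ℕ) [Fact p.Prime] {d : ℤ}
    (hd : ¬ IsSquare (d : ZMod p)) (s t : ℚ_[p]) :
    (d : ℚ_[p]) ≠ s ^ 2 - (p : ℚ_[p]) * t ^ 2 := by
  intro h
  have hd1 : ‖(d : ℚ_[p])‖ = 1 := by
    refine le_antisymm (Padic.norm_int_le_one d) (not_lt.mp fun hlt => hd ?_)
    rw [Padic.norm_intCast_lt_one_iff, ← ZMod.intCast_zmod_eq_zero_iff_dvd] at hlt
    simp [hlt]
  have key : ‖s‖ ≤ 1 ∧ ‖(p : ℚ_[p]) * t ^ 2‖ < 1 := by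
    rcases eq_or_ne t 0 with rfl | ht
    · have hs : ‖s‖ ^ 2 = 1 := by rw [← norm_pow, ← hd1, h]; simp
      exact ⟨((pow_eq_one_iff_of_nonneg (norm_nonneg s) two_ne_zero).mp hs).le, by simp⟩
    · have h1 := Padic.norm_sq_ne_norm_p_mul_sq p one_ne_zero ht
      rw [one_pow, norm_one] at h1
      rcases eq_or_ne s 0 with rfl | hs
      · rw [h] at hd1
        exact absurd (by simpa using hd1.symm) h1
      · have hmax := Padic.add_eq_max_of_ne (q := s ^ 2) (r := -((p : ℚ_[p]) * t ^ 2))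
          (by simpa only [norm_neg] using Padic.norm_sq_ne_norm_p_mul_sq p hs ht)
        rw [← sub_eq_add_neg, ← h, hd1, norm_neg] at hmax
        refine ⟨?_, lt_of_le_of_ne (hmax ▸ le_max_right _ _) h1.symm⟩
        have : ‖s ^ 2‖ ≤ 1 := hmax ▸ le_max_left _ _
        rwa [norm_pow, pow_le_one_iff_of_nonneg (norm_nonneg s) two_ne_zero] at this
  let S : ℤ_[p] := ⟨s, key.1⟩
  have hS : ‖S ^ 2 - (d : ℤ_[p])‖ < 1 := by
    have : ((S ^ 2 - (d : ℤ_[p]) : ℤ_[p]) : ℚ_[p]) = p * t ^ 2 := by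
      push_cast
      rw [h]
      simp [S]
    rw [PadicInt.norm_def, this]
    exact key.2
  have hker : S ^ 2 - (d : ℤ_[p]) ∈ RingHom.ker (PadicInt.toZMod (p := p)) := by
    rw [PadicInt.ker_toZMod, IsLocalRing.mem_maximalIdeal, PadicInt.mem_nonunits]
    exact hS
  rw [RingHom.mem_ker, map_sub, map_pow, map_intCast, sub_eq_zero] at hker
  exact hd ⟨PadicInt.toZMod S, by rw [← hker, sq]⟩

/-- For a prime `p ≡ 1 (mod 4)` and integers `a, b` with `a·b = p − 1`,
there are `ℚ_p`-points `P₁, P₂` of `Y_{p,a,b}` with `u_i·(z_i − y_i) ≠ 0`, such that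
`u₁·(z₁ − y₁)` is of the form `s² − p·t²` while `u₂·(z₂ − y₂)` is not; i.e. the
invariant map at `p` of the class `ℬ = (p, (z−y)/u)` is surjective. -/
theorem stmt_9 (p : ℕ) [Fact p.Prime] (hp : p % 4 = 1)
    (a b : ℤ) (hab : a * b = (p : ℤ) - 1) :
    ∃ u₁ v₁ x₁ y₁ z₁ u₂ v₂ x₂ y₂ z₂ : ℚ_[p],
      (¬ (u₁ = 0 ∧ v₁ = 0 ∧ x₁ = 0 ∧ y₁ = 0 ∧ z₁ = 0) ∧
        y₁ ^ 2 - (p : ℚ_[p]) * x₁ ^ 2 = u₁ * v₁ ∧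
        z₁ ^ 2 - (p : ℚ_[p]) * x₁ ^ 2
          = ((a : ℚ_[p]) * u₁ - (p : ℚ_[p]) * v₁) * (u₁ - (b : ℚ_[p]) * v₁)) ∧
      (¬ (u₂ = 0 ∧ v₂ = 0 ∧ x₂ = 0 ∧ y₂ = 0 ∧ z₂ = 0) ∧
        y₂ ^ 2 - (p : ℚ_[p]) * x₂ ^ 2 = u₂ * v₂ ∧
        z₂ ^ 2 - (p : ℚ_[p]) * x₂ ^ 2
          = ((a : ℚ_[p]) * u₂ - (p : ℚ_[p]) * v₂) * (u₂ - (b : ℚ_[p]) * v₂)) ∧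
      u₁ * (z₁ - y₁) ≠ 0 ∧ u₂ * (z₂ - y₂) ≠ 0 ∧
      (∃ s t : ℚ_[p], u₁ * (z₁ - y₁) = s ^ 2 - (p : ℚ_[p]) * t ^ 2) ∧
      (∀ s t : ℚ_[p], u₂ * (z₂ - y₂) ≠ s ^ 2 - (p : ℚ_[p]) * t ^ 2) := by
  have hp2 : p ≠ 2 := by omega
  obtain ⟨c, hc⟩ := FiniteField.exists_nonsquare (F := ZMod p) (by rwa [ZMod.ringChar_zmod_n])
  obtain ⟨d, rfl⟩ := ZMod.intCast_surjective c
  have hd : ¬ (p : ℤ) ∣ d := by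
    intro h
    rw [← ZMod.intCast_zmod_eq_zero_iff_dvd] at h
    simp [h] at hc
  have h1 : ¬ (p : ℤ) ∣ 1 := by
    intro h
    exact (Fact.out : p.Prime).one_lt.ne' (Nat.dvd_one.mp (by exact_mod_cast h))
  obtain ⟨y₁, hy₁⟩ := exists_padic_point_of_not_dvd p hp2 a b hab 1 h1
  obtain ⟨y₂, hy₂⟩ := exists_padic_point_of_not_dvd p hp2 a b hab d hd
  have hd0 : (d : ℚ_[p]) ≠ 0 := by
    rw [Int.cast_ne_zero]
    rintro rfl
    exact hd (dvd_zero _)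
  refine ⟨1, y₁ ^ 2, 0, y₁, y₁ + 1, 1, y₂ ^ 2, 0, y₂, y₂ + d, ⟨by simp, by ring, ?_⟩,
    ⟨by simp, by ring, ?_⟩, by simp, by simpa using hd0, ⟨1, 0, by ring⟩, fun s t => ?_⟩
  · push_cast at hy₁
    linear_combination hy₁
  · linear_combination hy₂
  · rw [one_mul, add_sub_cancel_left]
    exact Padic.intCast_ne_sq_sub_p_mul_sq p hc s t
end

section
/- Let (u, v, x, y, z) ∈ ℤ_p^5 be a tuple whose coordinates are not all divisible by p, satisfying y² − p·x² = u·v and z² − p·x² = (a·u − p·v)(u − b·v). Then u is a unit in ℤ_p; consequently u·(a·u − p·v) is a unit in ℤ_p whose reduction modulo p is a nonzero square in F_p if and only if the reduction of a modulo p is a nonzero square in F_p. -/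
/-- Let `(u,v,x,y,z) ∈ ℤ_p^5` be a primitive tuple (not all coordinates
divisible by `p`) satisfying the equations of `Y_{p,a,b}`. Then `u` is a unit in `ℤ_p`;
consequently `u·(a·u − p·v)` is a unit whose reduction mod `p` is a nonzero square in
`F_p` iff the reduction of `a` is. -/
theorem stmt_10 (p : ℕ) [Fact p.Prime] (hp : p % 4 = 1)
    (a b : ℤ) (hab : a * b = (p : ℤ) - 1)
    (u v x y z : ℤ_[p])
    (hprim : ¬ ((p : ℤ_[p]) ∣ u ∧ (p : ℤ_[p]) ∣ v ∧ (p : ℤ_[p]) ∣ x ∧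
      (p : ℤ_[p]) ∣ y ∧ (p : ℤ_[p]) ∣ z))
    (h1 : y ^ 2 - (p : ℤ_[p]) * x ^ 2 = u * v)
    (h2 : z ^ 2 - (p : ℤ_[p]) * x ^ 2
      = ((a : ℤ_[p]) * u - (p : ℤ_[p]) * v) * (u - (b : ℤ_[p]) * v)) :
    IsUnit u ∧
    IsUnit (u * ((a : ℤ_[p]) * u - (p : ℤ_[p]) * v)) ∧
    ((PadicInt.toZMod (u * ((a : ℤ_[p]) * u - (p : ℤ_[p]) * v)) ≠ 0 ∧
        IsSquare (PadicInt.toZMod (u * ((a : ℤ_[p]) * u - (p : ℤ_[p]) * v)))) ↔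
      ((a : ZMod p) ≠ 0 ∧ IsSquare (a : ZMod p))) := by
  have hpp : Prime (p : ℤ_[p]) := PadicInt.prime_p
  have hab' : (a : ℤ_[p]) * b = p - 1 := by exact_mod_cast congrArg (Int.cast : ℤ → ℤ_[p]) hab
  have unit_iff (t : ℤ_[p]) : IsUnit t ↔ ¬ (p : ℤ_[p]) ∣ t := by
    rw [PadicInt.isUnit_iff, ← PadicInt.norm_lt_one_iff_dvd, not_lt]
    exact ⟨fun h => h.ge, fun h => le_antisymm (PadicInt.norm_le_one t) h⟩
  have hu : ¬ (p : ℤ_[p]) ∣ u := by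
    rintro ⟨U, rfl⟩
    obtain ⟨Y, rfl⟩ : (p : ℤ_[p]) ∣ y :=
      hpp.dvd_of_dvd_pow (n := 2) ⟨U * v + x ^ 2, by linear_combination h1⟩
    obtain ⟨Z, rfl⟩ : (p : ℤ_[p]) ∣ z :=
      hpp.dvd_of_dvd_pow (n := 2)
        ⟨(a * U - v) * (p * U - b * v) + x ^ 2, by linear_combination h2⟩
    have h1' : (p : ℤ_[p]) * Y ^ 2 - x ^ 2 = U * v :=
      mul_left_cancel₀ hpp.ne_zero (by linear_combination h1)
    have h2' : (p : ℤ_[p]) * Z ^ 2 - x ^ 2 = (a * U - v) * (p * U - b * v) :=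
      mul_left_cancel₀ hpp.ne_zero (by linear_combination h2)
    obtain ⟨V, rfl⟩ : (p : ℤ_[p]) ∣ v :=
      hpp.dvd_of_dvd_pow (n := 2)
        ⟨v ^ 2 - a * (Z ^ 2 - a * U ^ 2 + 2 * (U * v) - Y ^ 2), by
          linear_combination a * h2' - a * h1' + (v ^ 2 - a * U * v) * hab'⟩
    have hx : (p : ℤ_[p]) ∣ x :=
      hpp.dvd_of_dvd_pow (n := 2) ⟨Y ^ 2 - U * V, by linear_combination -h1'⟩
    exact hprim ⟨dvd_mul_right _ _, dvd_mul_right _ _, hx, dvd_mul_right _ _, dvd_mul_right _ _⟩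
  have ha : ¬ (p : ℤ_[p]) ∣ a := by
    rintro ⟨c, hc⟩
    exact hpp.not_isUnit (isUnit_of_dvd_one ⟨1 - c * b, by linear_combination hab' - b * hc⟩)
  have hred : PadicInt.toZMod (u * ((a : ℤ_[p]) * u - (p : ℤ_[p]) * v)) =
      (a : ZMod p) * PadicInt.toZMod u ^ 2 := by
    simp only [map_mul, map_sub, map_intCast, map_natCast, CharP.cast_eq_zero]
    ring
  have hu0 : PadicInt.toZMod u ≠ 0 := (((unit_iff u).2 hu).map PadicInt.toZMod).ne_zero
  refine ⟨(unit_iff u).2 hu, (unit_iff _).2 fun h => ?_, ?_⟩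
  · refine (hpp.dvd_or_dvd h).elim hu fun h => ?_
    rw [dvd_sub_left (dvd_mul_right _ _)] at h
    exact (hpp.dvd_or_dvd h).elim ha hu
  · rw [hred]
    refine and_congr (by simp [hu0]) ⟨?_, fun h => h.mul (IsSquare.sq _)⟩
    intro h
    simpa [hu0] using h.div (IsSquare.sq (PadicInt.toZMod u))
end

section
/- Let p be a prime with p ≡ 1 (mod 4) and let a, b be integers with a·b = p − 1. Then the Legendre symbols (a/p) and (b/p) are equal, and (a/p) = (b/p) = −1 holds if and only if p ≡ 5 (mod 8) and both a and b are even. -/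
open NumberTheorySymbols in
/-- An odd positive divisor of `p - 1` is a square modulo `p` when `p ≡ 1 (mod 4)`. -/
theorem jacobiSym_eq_one_of_odd_of_dvd_sub_one {p n : ℕ} (hp : p % 4 = 1) (hn : Odd n)
    (h : (n : ℤ) ∣ (p : ℤ) - 1) : J(n | p) = 1 := by
  rw [jacobiSym.quadratic_reciprocity_one_mod_four' hn hp,
    jacobiSym.mod_left' (Int.emod_eq_emod_iff_emod_sub_eq_zero.2 (Int.emod_eq_zero_of_dvd h)),
    jacobiSym.one_left]

open NumberTheorySymbols in
theorem jacobiSym_natAbs {p : ℕ} (hp : p % 4 = 1) (a : ℤ) : J(a.natAbs | p) = J(a | p) := by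
  rcases Int.natAbs_eq a with h | h
  · rw [← h]
  · conv_rhs => rw [h]
    rw [jacobiSym.neg _ (Nat.odd_iff.2 (by lia)), ZMod.χ₄_nat_one_mod_four hp, one_mul]

open NumberTheorySymbols in
theorem jacobiSym_eq_one_of_odd_int_of_dvd_sub_one {p : ℕ} {a : ℤ} (hp : p % 4 = 1)
    (ha : Odd a) (h : a ∣ (p : ℤ) - 1) : J(a | p) = 1 := by
  rw [← jacobiSym_natAbs hp]
  exact jacobiSym_eq_one_of_odd_of_dvd_sub_one hp (Int.natAbs_odd.2 ha) (Int.natAbs_dvd.2 h)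

open NumberTheorySymbols in
/-- Every divisor of `p - 1` is a square modulo `p` when `p ≡ 1 (mod 8)`. -/
theorem jacobiSym_eq_one_of_dvd_sub_one {p : ℕ} {a : ℤ} (hp : p % 8 = 1) (ha : a ≠ 0)
    (h : a ∣ (p : ℤ) - 1) : J(a | p) = 1 := by
  have hp4 : p % 4 = 1 := by lia
  obtain ⟨k, m, hm, hk⟩ := Nat.exists_eq_two_pow_mul_odd (Int.natAbs_ne_zero.2 ha)
  have hmd : (m : ℤ) ∣ (p : ℤ) - 1 :=
    (Int.natCast_dvd.2 (hk ▸ dvd_mul_left _ _)).trans h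
  have h2 : J(2 | p) = 1 := by
    rw [jacobiSym.at_two (Nat.odd_iff.2 (by lia)), ZMod.χ₈_nat_mod_eight, hp]
    decide
  rw [← jacobiSym_natAbs hp4, hk]
  push_cast
  rw [jacobiSym.mul_left, jacobiSym.pow_left, h2, one_pow, one_mul,
    jacobiSym_eq_one_of_odd_of_dvd_sub_one hp4 hm hmd]

open NumberTheorySymbols in
/-- An even `a` with `a * b = p - 1` and `b` even is a non-square modulo `p`
when `p ≡ 5 (mod 8)`. -/
theorem jacobiSym_eq_neg_one_of_even_of_mul_eq {p : ℕ} {a b : ℤ} (hp : p % 8 = 5)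
    (ha : Even a) (hb : Even b) (h : a * b = (p : ℤ) - 1) : J(a | p) = -1 := by
  obtain ⟨c, rfl⟩ := ha.two_dvd
  obtain ⟨d, rfl⟩ := hb.two_dvd
  have hcd : Odd (c * d) := by
    have : 4 * (c * d) = (p : ℤ) - 1 := by rw [← h]; ring
    rw [Int.odd_iff]
    lia
  have h2 : J(2 | p) = -1 := by
    rw [jacobiSym.at_two (Nat.odd_iff.2 (by lia)), ZMod.χ₈_nat_mod_eight, hp]
    decide
  rw [jacobiSym.mul_left, h2, jacobiSym_eq_one_of_odd_int_of_dvd_sub_one (by lia)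
    (Int.odd_mul.1 hcd).1 ⟨2 * (2 * d), by rw [← h]; ring⟩, mul_one]

open NumberTheorySymbols in
theorem jacobiSym_mul_eq_one_of_mul_eq_sub_one {p : ℕ} {a b : ℤ} (hp : p % 4 = 1)
    (h : a * b = (p : ℤ) - 1) : J(a | p) * J(b | p) = 1 := by
  rw [← jacobiSym.mul_left, h,
    jacobiSym.mod_left' (a₂ := -1) (by simp), jacobiSym.at_neg_one (Nat.odd_iff.2 (by lia)),
    ZMod.χ₄_nat_one_mod_four hp]

/-- Let `p ≡ 1 (mod 4)` be prime and `a, b` integers with `a·b = p − 1`.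
Then the Legendre symbols `(a/p)` and `(b/p)` are equal, and `(a/p) = (b/p) = −1`
holds iff `p ≡ 5 (mod 8)` and both `a` and `b` are even. -/
theorem stmt_11 (p : ℕ) [Fact p.Prime] (hp : p % 4 = 1)
    (a b : ℤ) (hab : a * b = (p : ℤ) - 1) :
    legendreSym p a = legendreSym p b ∧
    ((legendreSym p a = -1 ∧ legendreSym p b = -1) ↔
      (p % 8 = 5 ∧ Even a ∧ Even b)) := by
  simp only [jacobiSym.legendreSym.to_jacobiSym]
  have hba : b * a = (p : ℤ) - 1 := mul_comm a b ▸ hab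
  refine ⟨Int.eq_of_mul_eq_one (jacobiSym_mul_eq_one_of_mul_eq_sub_one hp hab), ?_, ?_⟩
  · rintro ⟨ha, hb⟩
    have hp1 : (p : ℤ) - 1 ≠ 0 := by
      have := (Fact.out : p.Prime).two_le
      lia
    refine ⟨?_, ?_, ?_⟩
    · by_contra h5
      have := jacobiSym_eq_one_of_dvd_sub_one (by lia) (left_ne_zero_of_mul (hab ▸ hp1))
        ⟨b, hab.symm⟩
      lia
    · by_contra h
      have := jacobiSym_eq_one_of_odd_int_of_dvd_sub_one hp (Int.not_even_iff_odd.1 h)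
        ⟨b, hab.symm⟩
      lia
    · by_contra h
      have := jacobiSym_eq_one_of_odd_int_of_dvd_sub_one hp (Int.not_even_iff_odd.1 h)
        ⟨a, hba.symm⟩
      lia
  · rintro ⟨h5, ha, hb⟩
    exact ⟨jacobiSym_eq_neg_one_of_even_of_mul_eq h5 ha hb hab,
      jacobiSym_eq_neg_one_of_even_of_mul_eq h5 hb ha hba⟩
end

section
/- Assume additionally that a is not a quadratic residue modulo p, i.e. the Legendre symbol (a/p) = −1. Then Y_{p,a,b} has no rational points: there is no nonzero vector (u,v,x,y,z) ∈ ℚ^5 with y² − p·x² = u·v and z² − p·x² = (a·u − p·v)(u − b·v). (Since Y_{p,a,b} is everywhere locally soluble, this is a failure of the Hasse principle, explained by a Brauer–Manin obstruction coming from the class 𝒜 = (p, u/(au − pv)).) -/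
/-- If `p ≡ 1 (mod 4)` and `ℓ` is a prime that is not a square modulo `p`, then every nonzero value
of the form `y ^ 2 - p * x ^ 2` over the integers has even `ℓ`-adic valuation. -/
theorem even_padicValInt_sq_sub_mul_sq {p ℓ : ℕ} [Fact p.Prime] [Fact ℓ.Prime] (hp : p % 4 = 1)
    (hℓ : legendreSym p ℓ = -1) (x y : ℤ) (h0 : y ^ 2 - p * x ^ 2 ≠ 0) :
    Even (padicValInt ℓ (y ^ 2 - p * x ^ 2)) := by
  induction hn : (y ^ 2 - (p : ℤ) * x ^ 2).natAbs using Nat.strong_induction_on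
    generalizing x y with
  | _ n ih =>
  have hℓ0 : (ℓ : ℤ) ≠ 0 := by exact_mod_cast (Fact.out : ℓ.Prime).ne_zero
  have hℓp := (Fact.out : ℓ.Prime)
  by_cases hdvd : (ℓ : ℤ) ∣ y ^ 2 - p * x ^ 2
  swap
  · rw [padicValInt.eq_zero_of_not_dvd hdvd]
    exact Even.zero
  have descent : (ℓ : ℤ) ∣ y → (ℓ : ℤ) ∣ x → Even (padicValInt ℓ (y ^ 2 - p * x ^ 2)) := by
    rintro ⟨y, rfl⟩ ⟨x, rfl⟩
    have hfac : ((ℓ : ℤ) * y) ^ 2 - p * (ℓ * x) ^ 2 = ℓ * (ℓ * (y ^ 2 - p * x ^ 2)) := by ring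
    rw [hfac] at h0 hn ⊢
    have h0' : y ^ 2 - (p : ℤ) * x ^ 2 ≠ 0 := fun h => h0 (by rw [h]; ring)
    have hlt : (y ^ 2 - (p : ℤ) * x ^ 2).natAbs < n := by
      rw [← hn, Int.natAbs_mul, Int.natAbs_mul, Int.natAbs_natCast, ← mul_assoc]
      exact lt_mul_of_one_lt_left (Int.natAbs_pos.mpr h0')
        (Nat.one_lt_mul_iff.mpr ⟨hℓp.pos, hℓp.pos, Or.inl hℓp.one_lt⟩)
    have hev := ih _ hlt x y h0' rfl
    rw [padicValInt.mul hℓ0 (mul_ne_zero hℓ0 h0'), padicValInt.mul hℓ0 h0', padicValInt.self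
      hℓp.one_lt]
    grind
  by_cases h2 : ℓ = 2
  · subst h2
    have hp8 : p % 8 = 5 := by
      have hne : ¬ IsSquare (2 : ZMod p) := by
        have := (legendreSym.eq_neg_one_iff p).mp hℓ
        simpa using this
      have hp2 : p ≠ 2 := by omega
      rw [ZMod.exists_sq_eq_two_iff hp2] at hne
      omega
    rcases Int.even_or_odd' y with ⟨k, rfl | rfl⟩ <;> rcases Int.even_or_odd' x with ⟨m, rfl | rfl⟩
    · exact descent ⟨k, by simp⟩ ⟨m, by simp⟩
    · exfalso
      obtain ⟨c, hc⟩ := hdvd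
      obtain ⟨q, hq⟩ : ∃ q : ℤ, (p : ℤ) = 8 * q + 5 := ⟨p / 8, by omega⟩
      rw [hq] at hc
      push_cast at hc
      ring_nf at hc
      omega
    · exfalso
      obtain ⟨c, hc⟩ := hdvd
      push_cast at hc
      ring_nf at hc
      omega
    · obtain ⟨q, hq⟩ : ∃ q : ℤ, (p : ℤ) = 8 * q + 5 := ⟨p / 8, by omega⟩
      obtain ⟨r, hr⟩ := Int.even_mul_succ_self k
      obtain ⟨s, hs⟩ := Int.even_mul_succ_self m
      have hfac : (2 * k + 1) ^ 2 - (p : ℤ) * (2 * m + 1) ^ 2 =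
          (2 : ℕ) * ((2 : ℕ) * (2 * (r - q * (4 * (m * (m + 1)) + 1) - 5 * s - 1) + 1)) := by
        push_cast
        rw [hq]
        linear_combination 4 * hr - 20 * hs
      rw [hfac, padicValInt.mul (by simp) (by simp; omega), padicValInt.mul (by simp) (by omega),
        padicValInt.self (by norm_num), padicValInt.eq_zero_of_not_dvd (by push_cast; omega)]
      decide
  · have hrec : legendreSym ℓ p = -1 := by
      rw [← hℓ]
      exact legendreSym.quadratic_reciprocity_one_mod_four hp h2
    have := legendreSym.prime_dvd_of_eq_neg_one (p := ℓ) (a := p) hrec (x := y) (y := x) hdvd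
    exact descent this.1 this.2

/-- If `p ≡ 1 (mod 4)` does not divide `n`, and every prime that is not a square modulo `p` occurs
in `n` to an even power, then `n` is a square modulo `p`. -/
theorem legendreSym_eq_one_of_even_padicValInt {p : ℕ} [Fact p.Prime] (hp : p % 4 = 1) {n : ℤ}
    (hn : ¬ (p : ℤ) ∣ n)
    (h : ∀ ℓ : ℕ, ℓ.Prime → legendreSym p ℓ = -1 → Even (padicValInt ℓ n)) :
    legendreSym p n = 1 := by
  have hnat : legendreSym p (n.natAbs : ℤ) = 1 := by
    have hn0 : n.natAbs ≠ 0 := by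
      rintro h0
      exact hn (by simp [Int.natAbs_eq_zero.mp h0])
    rw [← Nat.prod_factorization_pow_eq_self hn0, Finsupp.prod]
    push_cast
    change legendreSym.hom p _ = 1
    rw [map_prod]
    refine Finset.prod_eq_one fun ℓ hℓ => ?_
    have hprime := Nat.prime_of_mem_primeFactors hℓ
    have hdvd := Nat.dvd_of_mem_primeFactors hℓ
    rw [map_pow]
    change legendreSym p ℓ ^ _ = 1
    have hne : ((ℓ : ℤ) : ZMod p) ≠ 0 := by
      rw [Ne, ZMod.intCast_zmod_eq_zero_iff_dvd]
      exact fun hpl => hn (hpl.trans (Int.natCast_dvd.mpr hdvd))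
    rcases legendreSym.eq_one_or_neg_one p hne with h1 | h1
    · rw [h1, one_pow]
    · have hev := h ℓ hprime h1
      rw [padicValInt, ← Nat.factorization_def _ hprime] at hev
      rw [h1, hev.neg_one_pow]
  rcases Int.natAbs_eq n with h1 | h1
  · rwa [h1]
  · rw [h1, ← neg_one_mul, legendreSym.mul, hnat, legendreSym.at_neg_one (by omega),
      ZMod.χ₄_nat_one_mod_four hp, one_mul]

/-- If `p ≡ 1 (mod 4)` and the product of two coprime integers `m`, `n` is a norm from `ℚ(√p)`,
then `m` is a square modulo `p` as soon as it is prime to `p`. -/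
theorem legendreSym_eq_one_of_isCoprime_of_mul_eq {p : ℕ} [Fact p.Prime] (hp : p % 4 = 1)
    {m n : ℤ} (hmn : IsCoprime m n) (hm : ¬ (p : ℤ) ∣ m) {x y : ℚ}
    (hxy : y ^ 2 - p * x ^ 2 = m * n) : legendreSym p m = 1 := by
  refine legendreSym_eq_one_of_even_padicValInt hp hm fun ℓ hℓ hleg => ?_
  have : Fact ℓ.Prime := ⟨hℓ⟩
  by_cases hdvd : (ℓ : ℤ) ∣ m
  swap
  · rw [padicValInt.eq_zero_of_not_dvd hdvd]
    exact Even.zero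
  have hndvd : ¬ (ℓ : ℤ) ∣ n := fun hn =>
    (Nat.prime_iff_prime_int.mp hℓ).not_isUnit (hmn.isUnit_of_dvd' hdvd hn)
  have hm0 : m ≠ 0 := by
    rintro rfl
    exact hm (dvd_zero _)
  have hn0 : n ≠ 0 := by
    rintro rfl
    exact hndvd (dvd_zero _)
  have hx : (x.den : ℚ) ≠ 0 := by exact_mod_cast x.den_nz
  have hy : (y.den : ℚ) ≠ 0 := by exact_mod_cast y.den_nz
  have hd0 : (x.den * y.den : ℤ) ≠ 0 := by exact_mod_cast mul_ne_zero x.den_nz y.den_nz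
  have hint : (y.num * x.den) ^ 2 - (p : ℤ) * (x.num * y.den) ^ 2 =
      m * n * ((x.den * y.den) * (x.den * y.den)) := by
    have hq : ((y.num : ℚ) * x.den) ^ 2 - p * (x.num * y.den) ^ 2 =
        m * n * ((x.den * y.den) * (x.den * y.den)) := by
      rw [← Rat.mul_den_eq_num x, ← Rat.mul_den_eq_num y]
      linear_combination (x.den * y.den : ℚ) ^ 2 * hxy
    exact_mod_cast hq
  have hne : m * n * ((x.den * y.den) * (x.den * y.den) : ℤ) ≠ 0 :=
    mul_ne_zero (mul_ne_zero hm0 hn0) (mul_ne_zero hd0 hd0)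
  have hev := even_padicValInt_sq_sub_mul_sq hp hleg (x.num * y.den) (y.num * x.den)
    (hint ▸ hne)
  rw [hint, padicValInt.mul (mul_ne_zero hm0 hn0) (mul_ne_zero hd0 hd0),
    padicValInt.mul hm0 hn0, padicValInt.mul hd0 hd0, padicValInt.eq_zero_of_not_dvd hndvd] at hev
  grind

/-- Two rational numbers that are not both zero are proportional to two coprime integers. -/
theorem exists_isCoprime_int_mul_eq {u v : ℚ} (h : ¬ (u = 0 ∧ v = 0)) :
    ∃ (g : ℚ) (m n : ℤ), g ≠ 0 ∧ IsCoprime m n ∧ u = g * m ∧ v = g * n := by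
  have hu : (u.den : ℚ) ≠ 0 := by exact_mod_cast u.den_nz
  have hv : (v.den : ℚ) ≠ 0 := by exact_mod_cast v.den_nz
  have hpos : 0 < Int.gcd (u.num * v.den) (v.num * u.den) := by
    rw [Int.gcd_pos_iff]
    by_contra! hc
    simp only [mul_eq_zero, Rat.num_eq_zero, Nat.cast_eq_zero, Rat.den_nz, or_false] at hc
    exact h hc
  obtain ⟨m, n, hmn, hm, hn⟩ := Int.exists_gcd_one hpos
  set d := Int.gcd (u.num * v.den) (v.num * u.den)
  have hd : (d : ℚ) ≠ 0 := by exact_mod_cast hpos.ne'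
  refine ⟨d / (u.den * v.den), m, n, by positivity, Int.isCoprime_iff_gcd_eq_one.mpr hmn, ?_, ?_⟩
  · have hm' : (u.num : ℚ) * v.den = m * d := by exact_mod_cast hm
    rw [← Rat.mul_den_eq_num u] at hm'
    field_simp
    linear_combination hm'
  · have hn' : (v.num : ℚ) * u.den = n * d := by exact_mod_cast hn
    rw [← Rat.mul_den_eq_num v] at hn'
    field_simp
    linear_combination hn'

/-- If a prime number times `x ^ 2` is a square in `ℚ`, then `x = 0`. -/
theorem eq_zero_of_sq_eq_prime_mul_sq {p : ℕ} (hp : p.Prime) {x y : ℚ}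
    (h : y ^ 2 = p * x ^ 2) : x = 0 := by
  by_contra hx
  have hsq : IsSquare (p : ℚ) := ⟨y / x, by field_simp; linear_combination -h⟩
  exact hp.prime.not_isSquare (Rat.isSquare_natCast_iff.mp hsq)

/-- For a prime `p ≡ 1 (mod 4)` and integers `a, b` with `a·b = p − 1`
and `(a/p) = −1`, the surface `Y_{p,a,b}` has no rational points. -/
theorem stmt_12 (p : ℕ) [Fact p.Prime] (hp : p % 4 = 1)
    (a b : ℤ) (hab : a * b = (p : ℤ) - 1)
    (hleg : legendreSym p a = -1) :
    ¬ ∃ u v x y z : ℚ,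
      ¬ (u = 0 ∧ v = 0 ∧ x = 0 ∧ y = 0 ∧ z = 0) ∧
      y ^ 2 - (p : ℚ) * x ^ 2 = u * v ∧
      z ^ 2 - (p : ℚ) * x ^ 2
        = ((a : ℚ) * u - (p : ℚ) * v) * (u - (b : ℚ) * v) := by
  rintro ⟨u, v, x, y, z, hne, h1, h2⟩
  have hpp : p.Prime := Fact.out
  have huv : ¬ (u = 0 ∧ v = 0) := by
    rintro ⟨rfl, rfl⟩
    have hx : x = 0 := eq_zero_of_sq_eq_prime_mul_sq hpp (y := y) (by linear_combination h1)
    subst hx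
    have hy : y = 0 := by simpa using h1
    have hz : z = 0 := by simpa using h2
    exact hne ⟨rfl, rfl, rfl, hy, hz⟩
  obtain ⟨g, m, n, hg, hmn, rfl, rfl⟩ := exists_isCoprime_int_mul_eq huv
  have h1' : (y / g) ^ 2 - p * (x / g) ^ 2 = m * n := by
    field_simp
    linear_combination h1
  have h2' : (z / g) ^ 2 - p * (x / g) ^ 2 =
      ((a * m - p * n : ℤ) : ℚ) * ((m - b * n : ℤ) : ℚ) := by
    push_cast
    field_simp
    linear_combination h2
  have hmn' : IsCoprime (a * m - p * n) (m - b * n) := by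
    obtain ⟨r, s, hrs⟩ := hmn
    exact ⟨-(r * b + s), r * p + s * a, by linear_combination hrs - (r * m + s * n) * hab⟩
  have hmod (c : ℤ) (k l : ℤ) (hkl : k = l + p * c) : legendreSym p k = legendreSym p l := by
    rw [legendreSym.mod p k, legendreSym.mod p l, hkl, Int.add_mul_emod_self_left]
  have hunit {k : ℤ} (hk : legendreSym p k ≠ 0) : ¬ (p : ℤ) ∣ k := by
    rwa [← ZMod.intCast_zmod_eq_zero_iff_dvd, ← legendreSym.eq_zero_iff]
  by_cases hm : (p : ℤ) ∣ m
  · have hn : ¬ (p : ℤ) ∣ n := fun hn =>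
      (Nat.prime_iff_prime_int.mp hpp).not_isUnit (hmn.isUnit_of_dvd' hm hn)
    have hln := legendreSym_eq_one_of_isCoprime_of_mul_eq hp hmn.symm hn
      (h1'.trans (mul_comm _ _))
    obtain ⟨c, rfl⟩ := hm
    have hlb : legendreSym p (-b) = -1 := by
      have hprod : legendreSym p (a * -b) = 1 := by
        rw [hmod (-1) (a * -b) 1 (by linear_combination -hab), legendreSym.at_one]
      rw [legendreSym.mul, hleg] at hprod
      linarith
    have hl : legendreSym p (p * c - b * n) = -1 := by
      rw [hmod c _ (-b * n) (by ring), legendreSym.mul, hlb, hln, mul_one]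
    have := legendreSym_eq_one_of_isCoprime_of_mul_eq hp hmn'.symm (hunit (by rw [hl]; decide))
      (h2'.trans (mul_comm _ _))
    omega
  · have hlm := legendreSym_eq_one_of_isCoprime_of_mul_eq hp hmn hm h1'
    have hl : legendreSym p (a * m - p * n) = -1 := by
      rw [hmod (-n) _ (a * m) (by ring), legendreSym.mul, hleg, hlm, mul_one]
    have := legendreSym_eq_one_of_isCoprime_of_mul_eq hp hmn' (hunit (by rw [hl]; decide)) h2'
    omega
end
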